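/- Let p ≥ 5 be a prime, let L = ℚ[x]/(x^p − 2) with α the image of x (so L = ℚ(2^{1/p}) is a number field of degree p), let L₂ = ℚ₂[x]/(x^p − 2) with λ the image of x (a totally ramified field extension of ℚ₂ of degree p, since x^p − 2 is Eisenstein at 2), and let ι : L → L₂ be the ring homomorphism over ℚ with ι(α) = λ. Let Z ⊆ L₂^× be the three-element set consisting of z₁ = 1 + λ^{p+2}, z₂ = 1 + λ^{2p−1}, and z₃ = ∏_{k ≥ 1, 2^k ≤ p} (1 + λ^{p+2^k}). Assume: (1) p² does not divide 2^{p−1} − 1; (2) the class number of L is odd; (3) for every unit u of the ring of integers O_L and every z ∈ Z, the element ι(u)·z is not a square in L₂. Then Fermat's Last Theorem holds for the exponent p: there are no integers x, y, z with xyz ≠ 0 and x^p + y^p = z^p. -/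

import Mathlib

open NumberField Polynomial

section InvolutionUnits

variable {A B : Type*} [CommRing A] [CommRing B] [Algebra A B]

/-- An involution of `B` with ring of invariants `A` for which some difference `b - σ b` is a unit
(the case of an everywhere unramified quadratic extension). -/
structure UnramifiedInvolution (σ : B ≃ₐ[A] B) (b : B) : Prop where
  involutive : ∀ x, σ (σ x) = x
  fixed : ∀ x, σ x = x → ∃ a, algebraMap A B a = x
  isUnit : IsUnit (b - σ b)

namespace UnramifiedInvolution

variable {σ : B ≃ₐ[A] B} {b : B} (hσ : UnramifiedInvolution σ b)
include hσ

lemma exists_trace (x : B) : ∃ a, algebraMap A B a = x + σ x :=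
  hσ.fixed _ (by rw [map_add, hσ.involutive, add_comm])

lemma map_comap_of_stable (J : Ideal B) (hJ : ∀ x ∈ J, σ x ∈ J) :
    (J.comap (algebraMap A B)).map (algebraMap A B) = J := by
  refine le_antisymm Ideal.map_comap_le fun z hz => ?_
  obtain ⟨a₁, h₁⟩ := hσ.exists_trace (b * z)
  obtain ⟨a₂, h₂⟩ := hσ.exists_trace z
  have m₁ : a₁ ∈ J.comap (algebraMap A B) := by
    rw [Ideal.mem_comap, h₁]
    exact J.add_mem (J.mul_mem_left _ hz) (hJ _ (J.mul_mem_left _ hz))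
  have m₂ : a₂ ∈ J.comap (algebraMap A B) := by
    rw [Ideal.mem_comap, h₂]
    exact J.add_mem hz (hJ _ hz)
  have key : (b - σ b) * z = algebraMap A B a₁ - σ b * algebraMap A B a₂ := by
    rw [h₁, h₂, map_mul]; ring
  have : (b - σ b) * z ∈ (J.comap (algebraMap A B)).map (algebraMap A B) := by
    rw [key]
    exact Ideal.sub_mem _ (Ideal.mem_map_of_mem _ m₁)
      (Ideal.mul_mem_left _ _ (Ideal.mem_map_of_mem _ m₂))
  exact (Ideal.unit_mul_mem_iff_mem _ hσ.isUnit).1 this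

lemma comap_map (hinj : Function.Injective (algebraMap A B)) (I : Ideal A) :
    (I.map (algebraMap A B)).comap (algebraMap A B) = I := by
  refine le_antisymm (fun a ha => ?_) Ideal.le_comap_map
  obtain ⟨r, hr⟩ := hσ.isUnit
  have hr' : σ (r⁻¹ : Bˣ) = -((r⁻¹ : Bˣ) : B) := by
    have h1 : σ (r : B) = -r := by rw [hr, map_sub, hσ.involutive]; ring
    have h2 : σ (r : B) * σ (r⁻¹ : Bˣ) = 1 := by rw [← map_mul, Units.mul_inv, map_one]
    rw [h1] at h2
    calc σ (r⁻¹ : Bˣ) = (r⁻¹ : Bˣ) * r * σ (r⁻¹ : Bˣ) := by rw [Units.inv_mul, one_mul]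
      _ = -((r⁻¹ : Bˣ) * (-r * σ (r⁻¹ : Bˣ))) := by ring
      _ = _ := by rw [h2, mul_one]
  have tr : ∀ x ∈ I.map (algebraMap A B), ∃ a ∈ I, algebraMap A B a = x + σ x := by
    intro x hx
    refine Submodule.span_induction ?_ ?_ ?_ ?_ hx (p := fun x _ => ∀ y : B,
      ∃ a ∈ I, algebraMap A B a = y * x + σ (y * x)) 1 |>.imp fun a h => by simpa using h
    · rintro _ ⟨i, hi, rfl⟩ y
      obtain ⟨a, ha⟩ := hσ.exists_trace y
      refine ⟨a * i, I.mul_mem_left _ hi, ?_⟩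
      rw [map_mul, ha, map_mul, AlgEquiv.commutes]; ring
    · exact fun y => ⟨0, I.zero_mem, by simp⟩
    · intro x₁ x₂ _ _ h₁ h₂ y
      obtain ⟨a₁, m₁, e₁⟩ := h₁ y
      obtain ⟨a₂, m₂, e₂⟩ := h₂ y
      refine ⟨a₁ + a₂, I.add_mem m₁ m₂, ?_⟩
      rw [map_add, e₁, e₂, mul_add, map_add]; ring
    · intro c x _ h y
      obtain ⟨a, m, e⟩ := h (y * c)
      exact ⟨a, m, by rw [e, smul_eq_mul, mul_assoc]⟩
  obtain ⟨a', ha', e⟩ := tr _ (Ideal.mul_mem_left _ (b * (r⁻¹ : Bˣ)) (Ideal.mem_comap.1 ha))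
  have : algebraMap A B a' = algebraMap A B a := by
    rw [e, map_mul, map_mul, AlgEquiv.commutes, hr']
    calc _ = ((b - σ b) * (r⁻¹ : Bˣ)) * algebraMap A B a := by ring
      _ = _ := by rw [← hr, Units.mul_inv, one_mul]
  rwa [← hinj this]

variable [IsDomain B]

/-- Units of relative norm one are of the form `η / σ η` when the ideal class group of `A` has no
2-torsion. -/
lemma exists_unit_div (hinj : Function.Injective (algebraMap A B))
    (hcl : ∀ I : Ideal A, (I ^ 2).IsPrincipal → I.IsPrincipal)
    (ε : Bˣ) (hε : (ε : B) * σ ε = 1) : ∃ η : Bˣ, (ε : B) * σ η = η := by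
  obtain ⟨x, hx0, hx⟩ : ∃ x : B, x ≠ 0 ∧ (ε : B) * σ x = x := by
    by_cases h : (1 : B) + ε = 0
    · refine ⟨b - σ b, hσ.isUnit.ne_zero, ?_⟩
      have : (ε : B) = -1 := by linear_combination h
      rw [this, map_sub, hσ.involutive]; ring
    · refine ⟨1 + ε, h, ?_⟩
      rw [map_add, map_one, mul_add, hε]; ring
  set J : Ideal B := Ideal.span {x}
  have hJ : ∀ y ∈ J, σ y ∈ J := by
    intro y hy
    obtain ⟨c, rfl⟩ := Ideal.mem_span_singleton'.1 hy
    refine Ideal.mem_span_singleton'.2 ⟨σ c * (ε⁻¹ : Bˣ), ?_⟩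
    rw [map_mul]
    calc _ = σ c * ((ε⁻¹ : Bˣ) * x) := by ring
      _ = σ c * ((ε⁻¹ : Bˣ) * (ε * σ x)) := by rw [hx]
      _ = _ := by rw [Units.inv_mul_cancel_left]
  have hmap := hσ.map_comap_of_stable J hJ
  set I := J.comap (algebraMap A B)
  obtain ⟨n, hn⟩ := hσ.fixed (x * σ x) (by rw [map_mul, hσ.involutive, mul_comm])
  have hI : I ^ 2 = Ideal.span {n} := by
    rw [← hσ.comap_map hinj (I ^ 2), ← hσ.comap_map hinj (Ideal.span {n}), Ideal.map_pow, hmap,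
      Ideal.map_span, Set.image_singleton, hn]
    congr 1
    rw [Ideal.span_singleton_pow, Ideal.span_singleton_eq_span_singleton]
    refine ⟨ε⁻¹, ?_⟩
    calc x ^ 2 * (ε⁻¹ : Bˣ) = x * ((ε⁻¹ : Bˣ) * x) := by ring
      _ = x * ((ε⁻¹ : Bˣ) * (ε * σ x)) := by rw [hx]
      _ = _ := by rw [Units.inv_mul_cancel_left]
  obtain ⟨a, ha⟩ := (hcl I (hI ▸ ⟨n, rfl⟩)).principal
  have hxa : Ideal.span {algebraMap A B a} = Ideal.span {x} := by
    change _ = J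
    rw [← hmap, ha, Ideal.submodule_span_eq, Ideal.map_span, Set.image_singleton]
  obtain ⟨η, hη⟩ := Ideal.span_singleton_eq_span_singleton.1 hxa
  refine ⟨η, ?_⟩
  have ha0 : algebraMap A B a ≠ 0 := by
    intro h; rw [h, zero_mul] at hη; exact hx0 hη.symm
  apply mul_left_cancel₀ ha0
  rw [← hη, map_mul, AlgEquiv.commutes] at hx
  linear_combination hx

/-- The index bound behind Hilbert's Theorem 94. -/
lemma index_squares_le (hinj : Function.Injective (algebraMap A B))
    (hcl : ∀ I : Ideal A, (I ^ 2).IsPrincipal → I.IsPrincipal)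
    (hfin : (powMonoidHom 2 : Aˣ →* Aˣ).range.index ≠ 0)
    (u : Aˣ) (hu : ¬ IsSquare u) (hu' : IsSquare (Units.map (algebraMap A B).toMonoidHom u)) :
    2 * (powMonoidHom 2 : Bˣ →* Bˣ).range.index ≤
      (powMonoidHom 2 : Aˣ →* Aˣ).range.index ^ 2 := by
  set j : Aˣ →* Bˣ := Units.map (algebraMap A B).toMonoidHom
  set H := (powMonoidHom 2 : Bˣ →* Bˣ).range
  set S := (powMonoidHom 2 : Aˣ →* Aˣ).range
  set s : Bˣ →* Bˣ := Units.map (σ : B →* B)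
  have hjs : ∀ a, s (j a) = j a := fun a => Units.ext (σ.commutes _)
  have hss : ∀ x, s (s x) = x := fun x => Units.ext (hσ.involutive _)
  have hjinj : Function.Injective j := Units.map_injective hinj
  have hfix : ∀ x : Bˣ, s x = x → ∃ a, j a = x := by
    intro x hx
    obtain ⟨a, ha⟩ := hσ.fixed x (congrArg Units.val hx)
    obtain ⟨a', ha'⟩ := hσ.fixed (x⁻¹ : Bˣ) (congrArg Units.val
      (show s x⁻¹ = x⁻¹ by rw [map_inv, hx]))
    have h1 : a * a' = 1 := hinj (by rw [map_mul, ha, ha', Units.mul_inv, map_one])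
    exact ⟨⟨a, a', h1, by rw [mul_comm, h1]⟩, Units.ext ha⟩
  choose N hN using fun x : Bˣ => hfix (x * s x) (by rw [map_mul, hss, mul_comm])
  let Nm : Bˣ →* Aˣ :=
    { toFun := N
      map_one' := hjinj (by rw [hN, map_one, map_one, mul_one])
      map_mul' := fun x y => hjinj (by rw [hN, map_mul, map_mul, hN, hN, mul_mul_mul_comm]) }
  have hle : S.comap Nm ≤ H ⊔ j.range := by
    rintro x ⟨a, ha⟩
    have hx : j a ^ 2 = x * s x := by rw [← hN, ← map_pow]; exact congrArg j ha
    set ε := x * (j a)⁻¹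
    have hε : ε * s ε = 1 := by
      rw [map_mul, map_inv, hjs, mul_mul_mul_comm, ← hx]; group
    obtain ⟨η, hη⟩ := hσ.exists_unit_div hinj hcl ε (congrArg Units.val hε)
    have hη' : ε * s η = η := Units.ext hη
    have : x = ((s η)⁻¹) ^ 2 * j (N η * a) := by
      rw [map_mul, hN]
      have : x = ε * j a := by simp [ε]
      rw [this, eq_mul_inv_of_mul_eq hη']
      simp only [pow_two]
      rw [show (s η)⁻¹ * (s η)⁻¹ * (η * s η * j a) = (s η)⁻¹ * s η * ((s η)⁻¹ * (η * j a)) by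
        simp only [mul_assoc, mul_left_comm, mul_comm], inv_mul_cancel, one_mul]
      simp only [mul_assoc, mul_left_comm]
    rw [this]
    exact Subgroup.mul_mem_sup ⟨_, rfl⟩ ⟨_, rfl⟩
  have hK : (H ⊔ j.range).index ≤ S.index := by
    have h1 : (S.comap Nm).index ≤ S.index := by
      rw [Subgroup.index_comap]
      exact Subgroup.relIndex_le_of_le_right le_top (by rwa [Subgroup.relIndex_top_right]) |>.trans
        (by rw [Subgroup.relIndex_top_right])
    have h0 : (S.comap Nm).index ≠ 0 := by
      rw [Subgroup.index_comap]
      exact fun h => hfin (Nat.eq_zero_of_zero_dvd (h ▸ Subgroup.relIndex_dvd_index_of_normal S _))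
    exact (Nat.le_of_dvd (Nat.pos_of_ne_zero h0) (Subgroup.index_dvd_of_le hle)).trans h1
  have hHK : H.relIndex (H ⊔ j.range) = (H.comap j).index := by
    rw [Subgroup.relIndex_sup_left, Subgroup.index_comap]
  have hSle : S ≤ H.comap j := by
    rintro _ ⟨a, rfl⟩
    exact ⟨j a, by simp⟩
  have h2 : 2 ≤ S.relIndex (H.comap j) := by
    have h0 : S.relIndex (H.comap j) ≠ 0 := fun h => hfin (Nat.eq_zero_of_zero_dvd
      (h ▸ Subgroup.relIndex_dvd_index_of_normal S _))
    have h1 : S.relIndex (H.comap j) ≠ 1 := by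
      rw [Ne, Subgroup.relIndex_eq_one]
      intro h
      obtain ⟨y, hy⟩ := hu'
      obtain ⟨a, ha⟩ := h (show u ∈ H.comap j from ⟨y, by rw [hy, powMonoidHom_apply, pow_two]⟩)
      exact hu ⟨a, by rw [← ha, powMonoidHom_apply, pow_two]⟩
    omega
  have h3 := Subgroup.relIndex_mul_index hSle
  have h4 := Subgroup.relIndex_mul_index (le_sup_left : H ≤ H ⊔ j.range)
  rw [hHK] at h4
  rw [← h4, ← mul_assoc, pow_two]
  refine Nat.mul_le_mul ?_ hK
  rw [← h3]
  exact Nat.mul_le_mul_right _ h2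

end UnramifiedInvolution

end InvolutionUnits

section UnitSquares

open NumberField.Units

variable (K : Type*) [Field K] [NumberField K]

lemma even_torsionOrder : 2 ∣ Nat.card (torsion K) := by
  have h : (-1 : (𝓞 K)ˣ) ∈ torsion K := by
    rw [torsion, CommGroup.mem_torsion, isOfFinOrder_iff_pow_eq_one]
    exact ⟨2, by norm_num, by norm_num⟩
  have h2 : orderOf (⟨-1, h⟩ : torsion K) = 2 := by
    refine orderOf_eq_prime (Subtype.ext (by simp)) fun h' => ?_
    have h3 : ((-1 : (𝓞 K)ˣ) : 𝓞 K) = (1 : (𝓞 K)ˣ) := congrArg Units.val (congrArg Subtype.val h')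
    rw [Units.val_neg, Units.val_one] at h3
    have h4 : (2 : 𝓞 K) = 0 := by linear_combination -h3
    exact two_ne_zero h4
  rw [← h2]
  exact orderOf_dvd_natCard _

/-- The exponents of a unit with respect to the fundamental system of units. -/
noncomputable def unitExponents : (𝓞 K)ˣ →* Multiplicative (Fin (rank K) → ℤ) where
  toFun x := Multiplicative.ofAdd (exist_unique_eq_mul_prod K x).choose.2
  map_one' := by
    rw [← (exist_unique_eq_mul_prod K 1).choose_spec.2 (1, 0) (by simp)]
    rfl
  map_mul' x y := by
    have hx := (exist_unique_eq_mul_prod K x).choose_spec.1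
    have hy := (exist_unique_eq_mul_prod K y).choose_spec.1
    rw [← (exist_unique_eq_mul_prod K (x * y)).choose_spec.2
      ((exist_unique_eq_mul_prod K x).choose.1 * (exist_unique_eq_mul_prod K y).choose.1,
        (exist_unique_eq_mul_prod K x).choose.2 + (exist_unique_eq_mul_prod K y).choose.2) ?_]
    · rfl
    · refine (congrArg₂ (· * ·) hx hy).trans ?_
      simp only [Pi.add_apply, zpow_add, Finset.prod_mul_distrib, Subgroup.coe_mul]
      rw [mul_mul_mul_comm]

lemma unitExponents_eq (x : (𝓞 K)ˣ) (ζ : torsion K) (e : Fin (rank K) → ℤ)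
    (h : x = ζ * ∏ i, fundSystem K i ^ e i) : unitExponents K x = Multiplicative.ofAdd e := by
  change Multiplicative.ofAdd (exist_unique_eq_mul_prod K x).choose.2 = _
  rw [← (exist_unique_eq_mul_prod K x).choose_spec.2 (ζ, e) h]

lemma unitExponents_surjective : Function.Surjective (unitExponents K) := fun e =>
  ⟨∏ i, fundSystem K i ^ e.toAdd i, unitExponents_eq K _ 1 e.toAdd (by simp)⟩

lemma unitExponents_ker : (unitExponents K).ker = torsion K := by
  ext x
  constructor
  · intro hx
    have h1 := (exist_unique_eq_mul_prod K x).choose_spec.1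
    have h2 : (exist_unique_eq_mul_prod K x).choose.2 = 0 :=
      Multiplicative.ofAdd.injective (MonoidHom.mem_ker.1 hx)
    simp only [h2, Pi.zero_apply, zpow_zero, Finset.prod_const_one, mul_one] at h1
    exact h1 ▸ SetLike.coe_mem _
  · intro hx
    rw [MonoidHom.mem_ker, unitExponents_eq K x ⟨x, hx⟩ 0 (by simp)]
    rfl

lemma index_unit_squares :
    (powMonoidHom 2 : (𝓞 K)ˣ →* (𝓞 K)ˣ).range.index = 2 ^ (rank K + 1) := by
  set H := (powMonoidHom 2 : (𝓞 K)ˣ →* (𝓞 K)ˣ).range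
  have h1 : H.relIndex (torsion K) = 2 := by
    have : H.subgroupOf (torsion K) = (powMonoidHom 2 : torsion K →* torsion K).range := by
      ext t
      rw [Subgroup.mem_subgroupOf]
      constructor
      · rintro ⟨y, hy⟩
        have hyT : y ∈ torsion K := by
          have ht : IsOfFinOrder (t : (𝓞 K)ˣ) := (CommGroup.mem_torsion _).1 t.2
          rw [← hy, powMonoidHom_apply] at ht
          exact (CommGroup.mem_torsion _).2 ((isOfFinOrder_pow.1 ht).resolve_right (by norm_num))
        exact ⟨⟨y, hyT⟩, Subtype.ext hy⟩
      · rintro ⟨y, rfl⟩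
        exact ⟨y, rfl⟩
    rw [Subgroup.relIndex, this, IsCyclic.index_powMonoidHom_range,
      Nat.gcd_eq_right (even_torsionOrder K)]
  let red : Multiplicative (Fin (rank K) → ℤ) →* Multiplicative (Fin (rank K) → ZMod 2) :=
    AddMonoidHom.toMultiplicative ((Int.castAddHom (ZMod 2)).compLeft (Fin (rank K)))
  have hred : ∀ e i, (red e).toAdd i = ((e.toAdd i : ℤ) : ZMod 2) := fun e i => rfl
  set c := red.comp (unitExponents K)
  have hsurj : Function.Surjective c := by
    rw [MonoidHom.coe_comp]
    refine Function.Surjective.comp (fun f => ?_) (unitExponents_surjective K)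
    choose e he using fun i => ZMod.intCast_surjective (f.toAdd i)
    exact ⟨Multiplicative.ofAdd e, Multiplicative.toAdd.injective (funext fun i => he i)⟩
  have hker : c.ker = H ⊔ torsion K := by
    apply le_antisymm
    · intro x hx
      have h0 : ∀ i, ∃ m : ℤ, (unitExponents K x).toAdd i = 2 * m := by
        intro i
        have : (c x).toAdd i = 0 := by rw [MonoidHom.mem_ker.1 hx]; rfl
        exact_mod_cast (ZMod.intCast_zmod_eq_zero_iff_dvd _ 2).1 this
      choose m hm using h0
      obtain ⟨y, hy⟩ := unitExponents_surjective K (Multiplicative.ofAdd m)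
      have : (y ^ 2)⁻¹ * x ∈ torsion K := by
        rw [← unitExponents_ker, MonoidHom.mem_ker, map_mul, map_inv, map_pow, hy,
          inv_mul_eq_one]
        refine Multiplicative.toAdd.injective (funext fun i => ?_)
        rw [hm, toAdd_pow, Pi.smul_apply]
        simp
      rw [show x = y ^ 2 * ((y ^ 2)⁻¹ * x) by group]
      exact Subgroup.mul_mem_sup ⟨y, rfl⟩ this
    · rw [sup_le_iff]
      constructor
      · rintro _ ⟨y, rfl⟩
        rw [MonoidHom.mem_ker, powMonoidHom_apply, map_pow]
        apply Multiplicative.toAdd.injective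
        ext i
        rw [toAdd_pow, Pi.smul_apply, nsmul_eq_mul]
        have : ((2 : ℕ) : ZMod 2) = 0 := by decide
        rw [this, zero_mul]; rfl
      · intro t ht
        rw [← unitExponents_ker, MonoidHom.mem_ker] at ht
        rw [MonoidHom.mem_ker, MonoidHom.comp_apply, ht, map_one]
  have h2 : (H ⊔ torsion K).index = 2 ^ rank K := by
    rw [← hker, Subgroup.index_ker, MonoidHom.range_eq_top.2 hsurj, Subgroup.card_top]
    simp [Nat.card_eq_fintype_card]
  rw [← Subgroup.relIndex_mul_index (le_sup_left : H ≤ H ⊔ torsion K), Subgroup.relIndex_sup_left,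
    h1, h2, pow_succ, mul_comm]

end UnitSquares

section Unramified

open NumberField.Units

variable {L M : Type*} [Field L] [NumberField L] [Field M] [NumberField M] [Algebra L M]

/-- **Hilbert's Theorem 94**, in the case of a quadratic extension generated by the square root of
a unit. -/
theorem isSquare_of_quadratic_unramified [IsGalois L M] (hdeg : Module.finrank L M = 2)
    [IsUnramifiedAtInfinitePlaces L M] (hodd : Odd (NumberField.classNumber L))
    (τ : Gal(M/L)) (hτ : τ ≠ 1) (b : M) (hb : IsIntegral ℤ b) (hu : IsIntegral ℤ (b - τ b)⁻¹)
    (hne : b ≠ τ b)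
    (u : (𝓞 L)ˣ) (hsq : ∃ r : M, r ^ 2 = algebraMap L M (u : 𝓞 L)) : IsSquare u := by
  classical
  by_contra hns
  have hall : ∀ τ' : Gal(M/L), τ' = 1 ∨ τ' = τ := by
    have hcard : Nat.card Gal(M/L) = 2 := by rw [IsGalois.card_aut_eq_finrank, hdeg]
    intro τ'
    by_contra! h
    have h3 : ({1, τ, τ'} : Finset Gal(M/L)).card = 3 := by
      rw [Finset.card_eq_three]
      exact ⟨1, τ, τ', hτ.symm, h.1.symm, h.2.symm, rfl⟩
    have := Finset.card_le_univ ({1, τ, τ'} : Finset Gal(M/L))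
    rw [← Nat.card_eq_fintype_card, hcard, h3] at this
    omega
  have hττ : ∀ x, τ (τ x) = x := by
    intro x
    have : τ * τ = 1 := (hall (τ * τ)).resolve_right fun h => hτ (by simpa using h)
    exact DFunLike.congr_fun this x
  let σ : 𝓞 M ≃ₐ[𝓞 L] 𝓞 M := AlgEquiv.ofRingEquiv (f := RingOfIntegers.mapRingEquiv τ.toRingEquiv)
    (fun x => RingOfIntegers.ext (τ.commutes _))
  have hσ : UnramifiedInvolution σ (⟨b, hb⟩ : 𝓞 M) :=
    { involutive := fun x => RingOfIntegers.ext (hττ _)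
      fixed := by
        intro x hx
        have hx' : τ (x : M) = x := congrArg (algebraMap (𝓞 M) M) hx
        have hmem : ∀ τ' : Gal(M/L), τ' (x : M) = x := by
          intro τ'
          rcases hall τ' with rfl | rfl
          · rfl
          · exact hx'
        obtain ⟨a, ha⟩ := (IsGalois.mem_range_algebraMap_iff_fixed (x : M)).2 hmem
        have hai : IsIntegral ℤ a := by
          have : IsIntegral ℤ (algebraMap L M a) := ha ▸ x.2
          exact (isIntegral_algebraMap_iff (algebraMap L M).injective).1 this
        exact ⟨⟨a, hai⟩, RingOfIntegers.ext ha⟩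
      isUnit := by
        refine IsUnit.of_mul_eq_one ⟨_, hu⟩ (RingOfIntegers.ext ?_)
        exact mul_inv_cancel₀ (sub_ne_zero.2 hne) }
  have hcl : ∀ I : Ideal (𝓞 L), (I ^ 2).IsPrincipal → I.IsPrincipal := by
    intro I hI
    by_cases h0 : I = 0
    · rw [h0]; exact ⟨⟨0, by simp⟩⟩
    have hmem : I ∈ nonZeroDivisors (Ideal (𝓞 L)) := mem_nonZeroDivisors_of_ne_zero h0
    have h1 : ClassGroup.mk0 ⟨I, hmem⟩ ^ 2 = 1 := by
      rw [← map_pow, ClassGroup.mk0_eq_one_iff]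
      exact hI
    have h2 : orderOf (ClassGroup.mk0 ⟨I, hmem⟩) ∣ 2 := orderOf_dvd_of_pow_eq_one h1
    have h3 : orderOf (ClassGroup.mk0 ⟨I, hmem⟩) ∣ NumberField.classNumber L := orderOf_dvd_card
    have h4 := Nat.dvd_gcd h3 h2
    rw [Nat.coprime_two_right.2 hodd, Nat.dvd_one, orderOf_eq_one_iff] at h4
    exact (ClassGroup.mk0_eq_one_iff hmem).1 h4
  have hinj : Function.Injective (algebraMap (𝓞 L) (𝓞 M)) :=
    FaithfulSMul.algebraMap_injective _ _
  obtain ⟨r, hr⟩ := hsq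
  have hsq' : IsSquare (Units.map (algebraMap (𝓞 L) (𝓞 M)).toMonoidHom u) := by
    have hri : IsIntegral ℤ r := by
      refine IsIntegral.of_pow (n := 2) (by norm_num) ?_
      rw [hr]
      exact (RingOfIntegers.isIntegral_coe _).algebraMap
    obtain ⟨R, hR⟩ : ∃ R : 𝓞 M, (R : M) = r := ⟨⟨r, hri⟩, rfl⟩
    have hr2 : R ^ 2 = algebraMap (𝓞 L) (𝓞 M) u :=
      by
      apply RingOfIntegers.ext
      change (R : M) ^ 2 = _
      rw [hR]; exact hr
    have : IsUnit R := by
      rw [← isUnit_pow_iff two_ne_zero, hr2]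
      exact u.isUnit.map _
    obtain ⟨v, hv⟩ := this
    refine ⟨v, Units.ext ?_⟩
    rw [Units.val_mul, hv, ← pow_two, hr2]
    rfl
  have key := hσ.index_squares_le hinj hcl (by rw [index_unit_squares]; positivity) u hns hsq'
  rw [index_unit_squares, index_unit_squares, ← pow_succ', ← pow_mul,
    Nat.pow_le_pow_iff_right (by norm_num)] at key
  have hc := IsUnramifiedAtInfinitePlaces.card_infinitePlace L M
  rw [hdeg] at hc
  have : 0 < Fintype.card (InfinitePlace L) := Fintype.card_pos
  simp only [rank] at key
  omega

end Unramified

section SquareUnit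

lemma Complex.im_eq_zero_of_sq_eq_pos {z : ℂ} {r : ℝ} (hr : 0 < r) (h : z ^ 2 = r) : z.im = 0 := by
  have h1 := congrArg Complex.re h
  have h2 := congrArg Complex.im h
  simp [pow_two] at h1 h2
  rcases mul_eq_zero.1 (show z.re * z.im = 0 by linarith) with h0 | h0
  · rw [h0] at h1; nlinarith [mul_self_nonneg z.im]
  · exact h0

variable {L : Type*} [Field L] [NumberField L]

/-- A unit of a number field of odd class number which is totally positive at the real places
and congruent to a square modulo `4` becomes a square in no quadratic extension generated by its
square root unless it already is one. -/
lemma isSquare_of_sq_mod_four_aux (hodd : Odd (NumberField.classNumber L)) (u : (𝓞 L)ˣ)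
    (s : 𝓞 L) (hs : (4 : 𝓞 L) ∣ s ^ 2 - u)
    (hpos : ∀ φ : L →+* ℝ, 0 < φ (u : 𝓞 L))
    {M : Type*} [Field M] [NumberField M] [Algebra L M] (hdeg : Module.finrank L M = 2) (w : M)
    (hw : w ^ 2 = algebraMap L M (u : 𝓞 L))
    (hdec : ∀ m : M, ∃ a c : L, m = algebraMap L M a + algebraMap L M c * w)
    (τ : Gal(M/L)) (hτw : τ w = -w) : IsSquare u := by
  obtain ⟨v, hv⟩ : ∃ v : L, v = (u : 𝓞 L) := ⟨_, rfl⟩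
  have hv0 : v ≠ 0 := by simp [hv]
  rw [← hv] at hw
  have : Algebra.IsQuadraticExtension L M := ⟨hdeg⟩
  have : IsGalois L M := ⟨⟩
  have : IsUnramifiedAtInfinitePlaces L M := by
    refine ⟨fun P => ?_⟩
    rw [InfinitePlace.isUnramified_iff, or_iff_not_imp_right, InfinitePlace.not_isComplex_iff_isReal]
    intro hreal
    obtain ⟨ψ, hψ⟩ : ∃ ψ : L →+* ℝ, ∀ x, (ψ x : ℂ) = P.embedding (algebraMap L M x) := by
      rw [← InfinitePlace.mk_embedding P, InfinitePlace.comap_mk,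
        InfinitePlace.isReal_mk_iff] at hreal
      exact ⟨hreal.embedding, fun x => ComplexEmbedding.IsReal.coe_embedding_apply hreal x⟩
    have him : (P.embedding w).im = 0 := by
      apply Complex.im_eq_zero_of_sq_eq_pos (hpos ψ)
      rw [← map_pow, hw, ← hψ, hv]
    rw [← InfinitePlace.mk_embedding P, InfinitePlace.isReal_mk_iff]
    refine RingHom.ext fun m => ?_
    obtain ⟨a, c, rfl⟩ := hdec m
    rw [ComplexEmbedding.conjugate_coe_eq, Complex.conj_eq_iff_im, map_add, map_mul, ← hψ, ← hψ]
    simp [him]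
  obtain ⟨q, hq⟩ := hs
  have hw0 : w ≠ 0 := by
    intro h; rw [h, zero_pow two_ne_zero] at hw
    exact hv0 ((algebraMap L M).injective (by rw [← hw, map_zero]))
  obtain ⟨b, hb⟩ : ∃ b : M, b = (algebraMap L M s + w) / 2 := ⟨_, rfl⟩
  have hbτ : b - τ b = w := by
    rw [hb, map_div₀, map_add, AlgEquiv.commutes, hτw, map_ofNat]; ring
  have hqs : (s : L) ^ 2 - v = 4 * q := by
    have := congrArg (algebraMap (𝓞 L) L) hq
    rw [map_sub, map_pow, map_mul, map_ofNat] at this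
    rw [hv]
    exact this
  have hinteg : ∀ x : 𝓞 L, IsIntegral ℤ (algebraMap L M x) := fun x =>
    (RingOfIntegers.isIntegral_coe x).algebraMap
  have hbi : IsIntegral ℤ b := by
    have h0 : b ^ 2 - algebraMap L M s * b + algebraMap L M q = 0 := by
      have h4 : (algebraMap L M s) ^ 2 - w ^ 2 = 4 * algebraMap L M q := by
        rw [hw, ← map_pow, ← map_sub, hqs, map_mul, map_ofNat]
      rw [hb]
      linear_combination (-1/4 : M) * h4
    refine isIntegral_trans (R := ℤ) (A := 𝓞 M) b ?_
    obtain ⟨S, hS⟩ : ∃ S : 𝓞 M, algebraMap (𝓞 M) M S = algebraMap L M s := ⟨⟨_, hinteg s⟩, rfl⟩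
    obtain ⟨Q, hQ⟩ : ∃ Q : 𝓞 M, algebraMap (𝓞 M) M Q = algebraMap L M q := ⟨⟨_, hinteg q⟩, rfl⟩
    refine ⟨X ^ 2 - C S * X + C Q, ?_, ?_⟩
    · monicity!
    · simp only [eval₂_add, eval₂_sub, eval₂_pow, eval₂_X, eval₂_mul, eval₂_C, hS, hQ]
      exact h0
  have hwi' : IsIntegral ℤ w⁻¹ := by
    have hwi : IsIntegral ℤ w := by
      refine IsIntegral.of_pow (n := 2) (by norm_num) ?_
      rw [hw, hv]
      exact hinteg _
    have hvu : v * ((u⁻¹ : (𝓞 L)ˣ) : 𝓞 L) = 1 := by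
      rw [hv, ← map_mul (algebraMap (𝓞 L) L), Units.mul_inv, map_one]
    have : w⁻¹ = w * algebraMap L M ((u⁻¹ : (𝓞 L)ˣ) : 𝓞 L) := by
      apply mul_left_cancel₀ hw0
      rw [mul_inv_cancel₀ hw0, ← mul_assoc, ← pow_two, hw, ← map_mul, hvu, map_one]
    rw [this]
    exact hwi.mul (hinteg _)
  refine isSquare_of_quadratic_unramified hdeg hodd τ ?_ b hbi (hbτ ▸ hwi') ?_ u ⟨w, hv ▸ hw⟩
  · intro h
    rw [h, AlgEquiv.one_apply] at hτw
    exact hw0 (by linear_combination (1/2 : M) * hτw)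
  · intro h
    rw [← h, sub_self] at hbτ
    exact hw0 hbτ.symm

namespace QuadraticAlgebra

variable {R : Type*} [CommRing R] (a : R)

lemma mk_zero_one_sq : (⟨0, 1⟩ : QuadraticAlgebra R a 0) ^ 2 = algebraMap R _ a := by
  rw [pow_two]
  ext <;> simp

lemma eq_add_mul_mk_zero_one (m : QuadraticAlgebra R a 0) :
    m = algebraMap R _ m.re + algebraMap R _ m.im * ⟨0, 1⟩ := by
  ext <;> simp

/-- The nontrivial automorphism of `R[√a]`. -/
def starAlgEquiv : QuadraticAlgebra R a 0 ≃ₐ[R] QuadraticAlgebra R a 0 :=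
  AlgEquiv.ofAlgHom
    { toRingHom := starRingEnd _
      commutes' := fun r => by
        change star _ = _
        ext <;> simp }
    { toRingHom := starRingEnd _
      commutes' := fun r => by
        change star _ = _
        ext <;> simp }
    (by ext <;> simp) (by ext <;> simp)

lemma starAlgEquiv_mk_zero_one :
    starAlgEquiv a ⟨0, 1⟩ = -⟨0, 1⟩ := by
  change star _ = _
  ext <;> simp

end QuadraticAlgebra

lemma isSquare_unit_of_sq_eq {u : (𝓞 L)ˣ} {r : L} (hr : r ^ 2 = (u : 𝓞 L)) : IsSquare u := by
  have hri : IsIntegral ℤ r := by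
    refine IsIntegral.of_pow (n := 2) (by norm_num) ?_
    rw [hr]; exact RingOfIntegers.isIntegral_coe _
  obtain ⟨R, hR⟩ : ∃ R : 𝓞 L, (R : L) = r := ⟨⟨r, hri⟩, rfl⟩
  have hr2 : R ^ 2 = u := by
    apply RingOfIntegers.ext
    change (R : L) ^ 2 = _
    rw [hR]; exact hr
  have : IsUnit R := by
    rw [← isUnit_pow_iff two_ne_zero, hr2]
    exact u.isUnit
  obtain ⟨w, hw⟩ := this
  exact ⟨w, Units.ext (by rw [Units.val_mul, hw, ← pow_two, hr2])⟩

/-- A unit of a number field of odd class number which is totally positive at the real places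
and congruent to a square modulo `4` is a square. -/
theorem isSquare_of_sq_mod_four (hodd : Odd (NumberField.classNumber L)) (u : (𝓞 L)ˣ)
    (s : 𝓞 L) (hs : (4 : 𝓞 L) ∣ s ^ 2 - u)
    (hpos : ∀ φ : L →+* ℝ, 0 < φ (u : 𝓞 L)) : IsSquare u := by
  by_contra hns
  obtain ⟨v, hv⟩ : ∃ v : L, v = (u : 𝓞 L) := ⟨_, rfl⟩
  have : Fact (∀ r : L, r ^ 2 ≠ v + 0 * r) := by
    refine ⟨fun r hr => hns (isSquare_unit_of_sq_eq (r := r) ?_)⟩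
    rw [hr, hv, zero_mul, add_zero]
  have hdeg : Module.finrank L (QuadraticAlgebra L v 0) = 2 := QuadraticAlgebra.finrank_eq_two _ _
  have : FiniteDimensional L (QuadraticAlgebra L v 0) :=
    Module.finite_of_finrank_pos (by rw [hdeg]; norm_num)
  have : CharZero (QuadraticAlgebra L v 0) :=
    charZero_of_injective_algebraMap (algebraMap L _).injective
  have : FiniteDimensional ℚ (QuadraticAlgebra L v 0) := Module.Finite.trans L _
  have : NumberField (QuadraticAlgebra L v 0) := ⟨⟩
  exact hns (isSquare_of_sq_mod_four_aux hodd u s hs hpos hdeg ⟨0, 1⟩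
    ((QuadraticAlgebra.mk_zero_one_sq v).trans (congrArg _ hv))
    (fun m => ⟨m.re, m.im, QuadraticAlgebra.eq_add_mul_mk_zero_one v m⟩)
    (QuadraticAlgebra.starAlgEquiv v) (QuadraticAlgebra.starAlgEquiv_mk_zero_one v))

end SquareUnit

theorem Padic.pow_ne_two {p : ℕ} (hp : p ≠ 1) (b : ℚ_[2]) : b ^ p ≠ 2 := by
  intro h
  have hb : b ≠ 0 := by
    rintro rfl
    rcases eq_or_ne p 0 with rfl | h0
    · norm_num at h
    · rw [zero_pow h0] at h
      exact two_ne_zero h.symm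
  have h2 : ‖(2 : ℚ_[2])‖ = (2 : ℝ)⁻¹ := by simpa using Padic.norm_p (p := 2)
  have hn := congrArg norm h
  rw [norm_pow, h2, Padic.norm_eq_zpow_neg_valuation hb, ← zpow_natCast, ← zpow_mul,
    ← zpow_neg_one] at hn
  have hv := zpow_right_injective₀ (a := ((2 : ℕ) : ℝ)) (by norm_num) (by norm_num)
    (by simpa using hn : ((2 : ℕ) : ℝ) ^ (-b.valuation * p) = ((2 : ℕ) : ℝ) ^ (-1 : ℤ))
  have hd : (p : ℤ) ∣ 1 := ⟨b.valuation, by linarith⟩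
  have := Int.natCast_dvd_natCast.mp (by simpa using hd : (p : ℤ) ∣ ((1 : ℕ) : ℤ))
  exact hp (Nat.dvd_one.mp this)

theorem Padic.irreducible_X_pow_sub_two {p : ℕ} (hp : p.Prime) :
    Irreducible (X ^ p - C 2 : ℚ_[2][X]) :=
  X_pow_sub_C_irreducible_of_prime hp (Padic.pow_ne_two hp.ne_one)

theorem Rat.irreducible_X_pow_sub_two {p : ℕ} (hp : p.Prime) :
    Irreducible (X ^ p - C 2 : ℚ[X]) :=
  X_pow_sub_C_irreducible_of_prime hp fun b hb =>
    Padic.pow_ne_two hp.ne_one (b : ℚ_[2]) (by exact_mod_cast congrArg (Rat.cast (K := ℚ_[2])) hb)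

section PureExtension

variable {K L : Type*} [Field K] [Field L] [Algebra K L] {p : ℕ} {α : L}

theorem minpoly_eq_X_pow_sub_C (hp : p ≠ 0) {a : K} (hirr : Irreducible (X ^ p - C a : K[X]))
    (hα : α ^ p = algebraMap K L a) : minpoly K α = X ^ p - C a :=
  (minpoly.eq_of_irreducible_of_monic hirr (by simp [hα]) (monic_X_pow_sub_C _ hp)).symm

theorem eq_zero_of_aeval_eq_zero_of_degree_lt (hp : p ≠ 0) {a : K}
    (hirr : Irreducible (X ^ p - C a : K[X])) (hα : α ^ p = algebraMap K L a)
    {q : K[X]} (hq : q.degree < p) (h : aeval α q = 0) : q = 0 := by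
  by_contra h0
  have := minpoly.degree_le_of_ne_zero K α h0 h
  rw [minpoly_eq_X_pow_sub_C hp hirr hα, degree_X_pow_sub_C (Nat.pos_of_ne_zero hp)] at this
  exact absurd hq (not_lt.mpr this)

theorem adjoin_eq_top_of_pow_eq [FiniteDimensional K L] (hp : p ≠ 0) {a : K}
    (hirr : Irreducible (X ^ p - C a : K[X])) (hα : α ^ p = algebraMap K L a)
    (hdeg : Module.finrank K L = p) : Algebra.adjoin K {α} = ⊤ := by
  have h : IntermediateField.adjoin K {α} = ⊤ := by
    rw [Field.primitive_element_iff_minpoly_natDegree_eq, minpoly_eq_X_pow_sub_C hp hirr hα,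
      natDegree_X_pow_sub_C, hdeg]
  rw [← IntermediateField.adjoin_simple_toSubalgebra_of_isAlgebraic
    (Algebra.IsAlgebraic.isAlgebraic α), h, IntermediateField.top_toSubalgebra]

theorem exists_powerBasis_of_pow_eq [FiniteDimensional K L] (hp : p ≠ 0) {a : K}
    (hirr : Irreducible (X ^ p - C a : K[X])) (hα : α ^ p = algebraMap K L a)
    (hdeg : Module.finrank K L = p) : ∃ B : PowerBasis K L, B.gen = α :=
  ⟨PowerBasis.ofAdjoinEqTop (IsIntegral.of_finite K α) (adjoin_eq_top_of_pow_eq hp hirr hα hdeg),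
    PowerBasis.ofAdjoinEqTop_gen _ _⟩

theorem exists_aeval_of_mem_adjoin {R : Type*} [CommRing R] [Nontrivial R] [Algebra R L]
    (hp : p ≠ 0) {a : R}
    (hα : α ^ p = algebraMap R L a) {x : L} (hx : x ∈ Algebra.adjoin R {α}) :
    ∃ q : R[X], q.degree < p ∧ aeval α q = x := by
  rw [Algebra.adjoin_singleton_eq_range_aeval] at hx
  obtain ⟨q, rfl⟩ := hx
  have hm : (X ^ p - C a : R[X]).Monic := monic_X_pow_sub_C _ hp
  refine ⟨q %ₘ (X ^ p - C a), ?_, ?_⟩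
  · have := degree_modByMonic_lt q hm
    rwa [degree_X_pow_sub_C (Nat.pos_of_ne_zero hp)] at this
  · exact aeval_modByMonic_eq_self_of_root (by simp [hα])

theorem mem_adjoin_of_two_pow_smul {R : Type*} [CommRing R] [IsDomain R] [IsIntegrallyClosed R]
    [Algebra R K] [IsFractionRing R K] [Algebra R L] [IsScalarTower R K L]
    [FiniteDimensional K L] [Algebra.IsSeparable K L] (hp : p ≠ 0) (h2 : Prime (2 : R))
    (hirr : Irreducible (X ^ p - C 2 : K[X])) (hα : α ^ p = 2)
    (hdeg : Module.finrank K L = p) {z : L} (hz : IsIntegral R z) {n : ℕ}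
    (hn : (2 : R) ^ n • z ∈ Algebra.adjoin R {α}) : z ∈ Algebra.adjoin R {α} := by
  have hαK : α ^ p = algebraMap K L 2 := by rw [hα, map_ofNat]
  have hαR : α ^ p = algebraMap R L 2 := by rw [hα, map_ofNat]
  have hinteg : IsIntegral R α := ⟨X ^ p - C 2, monic_X_pow_sub_C _ hp, by simp [← hαR]⟩
  have hmin : minpoly R α = X ^ p - C 2 := by
    have h := minpoly.isIntegrallyClosed_eq_field_fractions K L hinteg
    rw [Algebra.algebraMap_self_apply, minpoly_eq_X_pow_sub_C hp hirr hαK] at h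
    apply Polynomial.map_injective (algebraMap R K) (IsFractionRing.injective R K)
    rw [← h]
    simpa using (map_ofNat (algebraMap R K) 2).symm
  obtain ⟨B, rfl⟩ := exists_powerBasis_of_pow_eq hp hirr hαK hdeg
  refine mem_adjoin_of_smul_prime_pow_smul_of_minpoly_isEisensteinAt (K := K) h2 hinteg hz hn ?_
  rw [hmin]
  refine ⟨?_, ?_, ?_⟩
  · rw [(monic_X_pow_sub_C (2 : R) hp).leadingCoeff, Ideal.submodule_span_eq,
      Ideal.mem_span_singleton]
    exact fun h => h2.not_isUnit (isUnit_of_dvd_one h)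
  · intro n hn
    rw [natDegree_X_pow_sub_C] at hn
    rw [coeff_sub, coeff_X_pow, if_neg hn.ne, coeff_C, Ideal.submodule_span_eq,
      Ideal.mem_span_singleton]
    split_ifs <;> simp
  · rw [coeff_sub, coeff_X_pow, if_neg hp.symm, coeff_C_zero, zero_sub,
      Ideal.submodule_span_eq, Ideal.span_singleton_pow,
      Ideal.mem_span_singleton, dvd_neg, pow_two]
    intro h
    have := (mul_dvd_mul_iff_left h2.ne_zero).mp (by simpa using h : (2 : R) * 2 ∣ 2 * 1)
    exact h2.not_isUnit (isUnit_of_dvd_one this)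

theorem mem_adjoin_of_isIntegral_padicInt [Algebra ℚ_[2] L] [Algebra ℤ_[2] L]
    [IsScalarTower ℤ_[2] ℚ_[2] L] [FiniteDimensional ℚ_[2] L]
    (hp : p.Prime) (hα : α ^ p = 2)
    (hdeg : Module.finrank ℚ_[2] L = p) {z : L} (hz : IsIntegral ℤ_[2] z) :
    z ∈ Algebra.adjoin ℤ_[2] {α} := by
  have h2 : Prime (2 : ℤ_[2]) := by simpa using PadicInt.prime_p (p := 2)
  have hirr := Padic.irreducible_X_pow_sub_two hp
  have hαK : α ^ p = algebraMap ℚ_[2] L 2 := by rw [hα, map_ofNat]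
  have hαR : α ^ p = algebraMap ℤ_[2] L 2 := by rw [hα, map_ofNat]
  have hinteg : IsIntegral ℤ_[2] α := ⟨X ^ p - C 2, monic_X_pow_sub_C _ hp.ne_zero, by simp [← hαR]⟩
  obtain ⟨B, hB⟩ := exists_powerBasis_of_pow_eq hp.ne_zero hirr hαK hdeg
  have hd := Algebra.discr_mul_isIntegral_mem_adjoin ℚ_[2] (R := ℤ_[2]) (B := B)
    (by rwa [hB]) hz
  have hd0 := Algebra.discr_not_zero_of_basis ℚ_[2] B.basis
  rw [hB] at hd
  obtain ⟨⟨r, s⟩, hrs⟩ := IsLocalization.surj (nonZeroDivisors ℤ_[2])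
    (Algebra.discr ℚ_[2] B.basis)
  simp only at hrs
  have hr0 : r ≠ 0 := by
    rintro rfl
    rw [map_zero, mul_eq_zero] at hrs
    rcases hrs with h | h
    · exact hd0 h
    · exact nonZeroDivisors.coe_ne_zero s
        ((IsFractionRing.injective ℤ_[2] ℚ_[2]) (by rw [h, map_zero]))
  have hrz : r • z ∈ Algebra.adjoin ℤ_[2] {α} := by
    have := Subalgebra.smul_mem _ hd (s : ℤ_[2])
    rwa [← IsScalarTower.algebraMap_smul ℚ_[2] (s : ℤ_[2]), smul_smul, mul_comm, hrs,
      IsScalarTower.algebraMap_smul] at this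
  obtain ⟨u, hu⟩ : ∃ u : ℤ_[2]ˣ, r = u * (2 : ℤ_[2]) ^ r.valuation :=
    ⟨PadicInt.unitCoeff hr0, by simpa using PadicInt.unitCoeff_spec hr0⟩
  refine mem_adjoin_of_two_pow_smul (K := ℚ_[2]) hp.ne_zero h2 hirr hα hdeg hz
    (n := r.valuation) ?_
  have := Subalgebra.smul_mem _ hrz (↑u⁻¹ : ℤ_[2])
  rwa [smul_smul, hu, ← mul_assoc, Units.inv_mul, one_mul] at this

theorem exists_odd_smul_mem_adjoin [NumberField L] (hp : p.Prime) (hα : α ^ p = 2)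
    (hdeg : Module.finrank ℚ L = p) {z : L} (hz : IsIntegral ℤ z) :
    ∃ d : ℤ, Odd d ∧ d • z ∈ Algebra.adjoin ℤ {α} := by
  have hirr := Rat.irreducible_X_pow_sub_two hp
  have hαK : α ^ p = algebraMap ℚ L 2 := by rw [hα, map_ofNat]
  have hinteg : IsIntegral ℤ α := ⟨X ^ p - C 2, monic_X_pow_sub_C _ hp.ne_zero, by simp [hα]⟩
  obtain ⟨B, hB⟩ := exists_powerBasis_of_pow_eq hp.ne_zero hirr hαK hdeg
  have hd := Algebra.discr_mul_isIntegral_mem_adjoin ℚ (R := ℤ) (B := B) (by rwa [hB]) hz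
  have hd0 := Algebra.discr_not_zero_of_basis ℚ B.basis
  rw [hB] at hd
  set D := Algebra.discr ℚ B.basis
  have hrz : D.num • z ∈ Algebra.adjoin ℤ {α} := by
    have := Subalgebra.smul_mem _ hd (D.den : ℤ)
    rwa [← Int.cast_smul_eq_zsmul ℚ (D.den : ℤ), smul_smul, Int.cast_natCast, Rat.den_mul_eq_num,
      Int.cast_smul_eq_zsmul] at this
  obtain ⟨d, hk, hd⟩ := (Int.finiteMultiplicity_iff (a := 2).mpr
    ⟨by norm_num, Rat.num_ne_zero.mpr hd0⟩).exists_eq_pow_mul_and_not_dvd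
  refine ⟨d, by rwa [← Int.not_even_iff_odd, even_iff_two_dvd], ?_⟩
  exact mem_adjoin_of_two_pow_smul (K := ℚ) hp.ne_zero Int.prime_two hirr hα hdeg (hz.smul d)
    (n := multiplicity 2 D.num) (by rwa [smul_smul, ← hk])

end PureExtension

theorem Algebra.norm_map_of_basis {K L K' L' : Type*} [Field K] [Field L] [Algebra K L]
    [Field K'] [Field L'] [Algebra K' L'] (j : K →+* K') (ι : L →+* L')
    (hc : ∀ r : K, ι (algebraMap K L r) = algebraMap K' L' (j r))
    {m : Type*} [Fintype m] [DecidableEq m]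
    (b : Module.Basis m K L) (b' : Module.Basis m K' L') (hb : ∀ i, b' i = ι (b i)) (x : L) :
    Algebra.norm K' (ι x) = j (Algebra.norm K x) := by
  rw [Algebra.norm_eq_matrix_det b', Algebra.norm_eq_matrix_det b, RingHom.map_det]
  congr 1
  ext i k
  rw [Algebra.leftMulMatrix_eq_repr_mul, RingHom.mapMatrix_apply, Matrix.map_apply,
    Algebra.leftMulMatrix_eq_repr_mul]
  have h : ι x * b' k = ∑ i, j (b.repr (x * b k) i) • b' i := by
    rw [hb, ← map_mul]
    conv_lhs => rw [← b.sum_repr (x * b k)]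
    simp [map_sum, Algebra.smul_def, hc, hb]
  rw [h, b'.repr_sum_self]

section

variable {L L₂ : Type*} [Field L] [NumberField L] [Field L₂] [Algebra ℚ_[2] L₂]
  [FiniteDimensional ℚ_[2] L₂] {p : ℕ} {α : L} {lam : L₂} {ι : L →+* L₂}

theorem exists_basis_pow {K F : Type*} [Field K] [Field F] [Algebra K F] [FiniteDimensional K F]
    {a : F} (hp : p ≠ 0) {c : K}
    (hirr : Irreducible (X ^ p - C c : K[X])) (ha : a ^ p = algebraMap K F c)
    (hdeg : Module.finrank K F = p) : ∃ b : Module.Basis (Fin p) K F, ∀ i, b i = a ^ (i : ℕ) := by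
  obtain ⟨B, rfl⟩ := exists_powerBasis_of_pow_eq hp hirr ha hdeg
  have hB : B.dim = p := by rw [← B.finrank, hdeg]
  exact ⟨B.basis.reindex (finCongr hB), fun i => by simp⟩

theorem norm_padic_eq_norm (hp : p.Prime) (hα : α ^ p = 2) (hdeg : Module.finrank ℚ L = p)
    (hlam : lam ^ p = 2) (hdeg2 : Module.finrank ℚ_[2] L₂ = p) (hι : ι α = lam) (x : L) :
    Algebra.norm ℚ_[2] (ι x) = (Algebra.norm ℚ x : ℚ_[2]) := by
  obtain ⟨b, hb⟩ := exists_basis_pow hp.ne_zero (Rat.irreducible_X_pow_sub_two hp)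
    (by rw [hα, map_ofNat]) hdeg
  obtain ⟨b', hb'⟩ := exists_basis_pow hp.ne_zero (Padic.irreducible_X_pow_sub_two hp)
    (by rw [hlam, map_ofNat]) hdeg2
  refine Algebra.norm_map_of_basis (Rat.castHom ℚ_[2]) ι (fun r => ?_) b b' (fun i => ?_) x
  · simp
  · rw [hb, hb', map_pow, hι]

theorem Padic.not_isSquare_neg_one : ¬ IsSquare (-1 : ℚ_[2]) := by
  rintro ⟨x, hx⟩
  have h1 : ‖x‖ = 1 := by
    have := congrArg norm hx
    rw [norm_neg, norm_one, norm_mul] at this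
    nlinarith [norm_nonneg x]
  obtain ⟨y, rfl⟩ : ∃ y : ℤ_[2], (y : ℚ_[2]) = x := ⟨⟨x, h1.le⟩, rfl⟩
  have hy : (-1 : ℤ_[2]) = y * y := by
    apply Subtype.coe_injective
    simpa using hx
  have h := congrArg (PadicInt.toZModPow (p := 2) 2) hy
  simp only [map_neg, map_one, map_mul] at h
  generalize PadicInt.toZModPow (p := 2) 2 y = z at h
  revert h z
  decide

theorem realEmbedding_unique (hp : Odd p) (hα : α ^ p = 2) (hgen : Algebra.adjoin ℚ {α} = ⊤)
    (φ ψ : L →+* ℝ) : φ = ψ := by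
  have h : φ.toRatAlgHom = ψ.toRatAlgHom := by
    refine AlgHom.ext_of_adjoin_eq_top hgen ?_
    rintro x rfl
    refine hp.pow_injective ?_
    change φ x ^ p = ψ x ^ p
    rw [← map_pow, ← map_pow, hα, map_ofNat, map_ofNat]
  ext x
  exact congrArg (fun f => f x) h

theorem pos_of_norm_eq_one (hp : p.Prime) (hp2 : p ≠ 2) (hα : α ^ p = 2)
    (hdeg : Module.finrank ℚ L = p) {u : L} (hu : Algebra.norm ℚ u = 1) (φ : L →+* ℝ) :
    0 < φ u := by
  have hodd : Odd p := hp.odd_of_ne_two hp2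
  have hgen := adjoin_eq_top_of_pow_eq hp.ne_zero (Rat.irreducible_X_pow_sub_two hp)
    (by rw [hα, map_ofNat]) hdeg
  have hinteg : IsIntegral ℚ u := IsIntegral.of_finite ℚ u
  have hdvd := minpoly.degree_dvd hinteg
  rw [hdeg] at hdvd
  rcases (Nat.dvd_prime hp).mp hdvd with h1 | h1
  · rw [minpoly.natDegree_eq_one_iff] at h1
    obtain ⟨r, rfl⟩ := h1
    rw [Algebra.norm_algebraMap, hdeg] at hu
    have : r = 1 := hodd.pow_injective (by simpa using hu)
    simp [this]
  · have htop : Algebra.adjoin ℚ {u} = ⊤ := by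
      have h : IntermediateField.adjoin ℚ {u} = ⊤ := by
        rw [Field.primitive_element_iff_minpoly_natDegree_eq, h1, hdeg]
      rw [← IntermediateField.adjoin_simple_toSubalgebra_of_isAlgebraic
        (Algebra.IsAlgebraic.isAlgebraic u), h, IntermediateField.top_toSubalgebra]
    set B := PowerBasis.ofAdjoinEqTop hinteg htop with hB
    have hBg : B.gen = u := PowerBasis.ofAdjoinEqTop_gen _ _
    have hn := Algebra.PowerBasis.norm_gen_eq_coeff_zero_minpoly B
    rw [hBg, hu, ← B.finrank, hdeg, hodd.neg_one_pow] at hn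
    obtain ⟨ρ, hρ0, hρ⟩ : ∃ ρ : ℝ, 0 < ρ ∧ aeval ρ (minpoly ℚ u) = 0 := by
      set f := (minpoly ℚ u).map (algebraMap ℚ ℝ) with hf
      have hm : f.Monic := (minpoly.monic hinteg).map _
      have hdf : 0 < f.degree := by
        rw [← natDegree_pos_iff_degree_pos, hf, natDegree_map, h1]
        exact hp.pos
      have htend := f.tendsto_atTop_of_leadingCoeff_nonneg hdf (by rw [hm.leadingCoeff]; norm_num)
      obtain ⟨M, hM0, hM⟩ :=
        ((htend.eventually_ge_atTop 0).and (Filter.eventually_ge_atTop 0)).exists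
      have h0 : f.eval 0 ≤ 0 := by
        rw [← coeff_zero_eq_eval_zero, hf, coeff_map]
        have : (minpoly ℚ u).coeff 0 = -1 := by linarith
        simp [this]
      obtain ⟨ρ, hρ, hρe⟩ := intermediate_value_Icc hM (f.continuous.continuousOn) ⟨h0, hM0⟩
      have hae : aeval ρ (minpoly ℚ u) = 0 := by
        rw [aeval_def, ← eval_map]; exact hρe
      refine ⟨ρ, lt_of_le_of_ne hρ.1 ?_, hae⟩
      rintro rfl
      change f.eval 0 = 0 at hρe
      rw [← coeff_zero_eq_eval_zero, hf, coeff_map] at hρe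
      have : (minpoly ℚ u).coeff 0 = -1 := by linarith
      simp [this] at hρe
    have hρB : aeval ρ (minpoly ℚ B.gen) = 0 := by rw [hBg]; exact hρ
    obtain ⟨ψ, hψ⟩ : ∃ ψ : L →ₐ[ℚ] ℝ, ψ B.gen = ρ := ⟨B.lift ρ hρB, B.lift_gen ρ hρB⟩
    rw [realEmbedding_unique hodd hα hgen φ ψ.toRingHom]
    change 0 < ψ u
    rwa [← hBg, hψ]

end

theorem PadicInt.exists_int_add_four_mul (x : ℤ_[2]) : ∃ (n : ℤ) (y : ℤ_[2]), x = n + 4 * y := by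
  have h := PadicInt.appr_spec 2 x
  rw [Ideal.mem_span_singleton] at h
  obtain ⟨y, hy⟩ := h
  refine ⟨x.appr 2, y, ?_⟩
  push_cast at hy ⊢
  linear_combination hy

theorem PadicInt.exists_int_polynomial_add_four_mul (T : ℤ_[2][X]) :
    ∃ (S : ℤ[X]) (Y : ℤ_[2][X]), T = S.map (Int.castRingHom _) + 4 * Y := by
  induction T using Polynomial.induction_on' with
  | add P Q hP hQ =>
    obtain ⟨S, Y, rfl⟩ := hP
    obtain ⟨S', Y', rfl⟩ := hQ
    exact ⟨S + S', Y + Y', by rw [Polynomial.map_add]; ring⟩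
  | monomial n a =>
    obtain ⟨m, y, rfl⟩ := PadicInt.exists_int_add_four_mul a
    refine ⟨monomial n m, monomial n y, ?_⟩
    rw [map_add, Polynomial.map_monomial, ← C_mul_monomial]
    rfl

theorem PadicInt.four_dvd_intCast {n : ℤ} (h : (4 : ℤ_[2]) ∣ n) : 4 ∣ n := by
  have := (PadicInt.pow_p_dvd_int_iff (p := 2) 2 n).mp (by norm_num; exact h)
  simpa using this

section

variable {L L₂ : Type*} [Field L] [NumberField L] [Field L₂] [Algebra ℚ_[2] L₂]
  [FiniteDimensional ℚ_[2] L₂] {p : ℕ} {α : L} {lam : L₂} {ι : L →+* L₂}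

theorem norm_unit_eq_one_of_local_square (hp : p.Prime) (hα : α ^ p = 2)
    (hdeg : Module.finrank ℚ L = p) (hlam : lam ^ p = 2)
    (hdeg2 : Module.finrank ℚ_[2] L₂ = p) (hι : ι α = lam) (u : (𝓞 L)ˣ) {t : L₂}
    (ht : t ^ 2 = ι (algebraMap (𝓞 L) L u)) :
    Algebra.norm ℚ (algebraMap (𝓞 L) L u) = 1 := by
  have hn := norm_padic_eq_norm hp hα hdeg hlam hdeg2 hι (algebraMap (𝓞 L) L u)
  rw [← ht, map_pow] at hn
  have hu := NumberField.isUnit_iff_norm.mp u.isUnit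
  rw [RingOfIntegers.coe_norm] at hu
  rcases (abs_eq zero_le_one).mp hu with h | h
  · exact h
  · refine absurd ⟨Algebra.norm ℚ_[2] t, ?_⟩ Padic.not_isSquare_neg_one
    rw [← pow_two, hn]
    have h' : Algebra.norm ℚ (algebraMap (𝓞 L) L u) = -1 := h
    rw [h']
    simp

theorem exists_sq_mod_four_of_local_square (hp : p.Prime) (hα : α ^ p = 2)
    (hdeg : Module.finrank ℚ L = p) (hlam : lam ^ p = 2)
    (hdeg2 : Module.finrank ℚ_[2] L₂ = p) (hι : ι α = lam) (u : 𝓞 L) {t : L₂}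
    (ht : t ^ 2 = ι (algebraMap (𝓞 L) L u)) : ∃ s : 𝓞 L, (4 : 𝓞 L) ∣ s ^ 2 - u := by
  let : Algebra ℤ_[2] L₂ := ((algebraMap ℚ_[2] L₂).comp (algebraMap ℤ_[2] ℚ_[2])).toAlgebra
  have : IsScalarTower ℤ_[2] ℚ_[2] L₂ := IsScalarTower.of_algebraMap_eq' rfl
  have hαR : α ^ p = algebraMap ℤ L 2 := by rw [hα, map_ofNat]
  have hlR : lam ^ p = algebraMap ℤ_[2] L₂ 2 := by rw [hlam, map_ofNat]
  have hαint : IsIntegral ℤ α := ⟨X ^ p - C 2, monic_X_pow_sub_C _ hp.ne_zero, by simp [hα]⟩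
  have hιa (q : ℤ[X]) : ι (aeval α q) = aeval lam (q.map (Int.castRingHom ℤ_[2])) := by
    rw [aeval_def, aeval_def, hom_eval₂, hι, eval₂_map]
    congr 1
    exact RingHom.ext_int _ _
  have htint : IsIntegral ℤ_[2] t := by
    refine IsIntegral.of_pow two_pos ?_
    rw [ht]
    exact ((RingOfIntegers.isIntegral_coe u).map (ι.toIntAlgHom)).tower_top
  obtain ⟨T, -, rfl⟩ := exists_aeval_of_mem_adjoin hp.ne_zero hlR
    (mem_adjoin_of_isIntegral_padicInt hp hlam hdeg2 htint)
  obtain ⟨S, Y, rfl⟩ := PadicInt.exists_int_polynomial_add_four_mul T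
  obtain ⟨a, rfl⟩ : ∃ a : 𝓞 L, algebraMap (𝓞 L) L a = α := ⟨⟨α, hαint⟩, rfl⟩
  obtain ⟨d, hdodd, hd⟩ := exists_odd_smul_mem_adjoin hp hα hdeg (RingOfIntegers.isIntegral_coe u)
  obtain ⟨D, -, hD⟩ := exists_aeval_of_mem_adjoin hp.ne_zero hαR hd
  obtain ⟨Q, hQdeg, hQ⟩ := exists_aeval_of_mem_adjoin (R := ℤ) hp.ne_zero hαR
    (x := aeval (algebraMap (𝓞 L) L a) (C d * S ^ 2 - D)) (aeval_mem_adjoin_singleton ℤ _)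
  obtain ⟨W, hWdeg, hW⟩ := exists_aeval_of_mem_adjoin hp.ne_zero hlR
    (x := aeval lam (C (d : ℤ_[2]) * (4 * Y ^ 2 - 2 * (S.map (Int.castRingHom _) + 4 * Y) * Y)))
    (aeval_mem_adjoin_singleton ℤ_[2] _)
  have key : aeval lam (Q.map (Int.castRingHom ℤ_[2]) - 4 * W) = 0 := by
    rw [map_sub, ← hιa, hQ, map_mul, hW, map_sub, hD, map_sub, zsmul_eq_mul, map_mul, map_mul,
      map_mul ι, ← ht, map_mul, map_pow, map_pow, hιa, hιa]
    simp only [map_mul, map_sub, map_add, map_pow, Polynomial.map_intCast, eq_intCast, map_intCast,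
      map_ofNat]
    ring
  have hz : (Q.map (Int.castRingHom ℤ_[2]) - 4 * W).map (algebraMap ℤ_[2] ℚ_[2]) = 0 := by
    refine eq_zero_of_aeval_eq_zero_of_degree_lt hp.ne_zero (Padic.irreducible_X_pow_sub_two hp)
      (by rw [hlam, map_ofNat]) (lt_of_le_of_lt degree_map_le ?_) (by rwa [aeval_map_algebraMap])
    refine lt_of_le_of_lt (degree_sub_le _ _) (max_lt (degree_map_le.trans_lt hQdeg) ?_)
    refine lt_of_le_of_lt ?_ hWdeg
    have : (4 * W : ℤ_[2][X]) = C 4 * W := rfl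
    rw [this]
    rw [degree_C_mul (by norm_num)]
  rw [Polynomial.map_eq_zero_iff (IsFractionRing.injective ℤ_[2] ℚ_[2]), sub_eq_zero] at hz
  obtain ⟨E, rfl⟩ : C 4 ∣ Q := by
    rw [C_dvd_iff_dvd_coeff]
    refine fun i => PadicInt.four_dvd_intCast ⟨W.coeff i, ?_⟩
    have := congrArg (coeff · i) hz
    have h4 : (4 * W : ℤ_[2][X]) = C 4 * W := rfl
    simpa [h4] using this
  have hds : (d : 𝓞 L) * (aeval a S ^ 2 - u) = 4 * aeval a E := by
    apply RingOfIntegers.coe_injective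
    rw [map_mul, aeval_C] at hQ
    simp only [map_mul, map_sub, map_pow, ← aeval_algebraMap_apply, map_intCast, map_ofNat,
      aeval_C, hD] at hQ ⊢
    simp only [algebraMap_int_eq, eq_intCast, zsmul_eq_mul] at hQ
    rw [hQ]
    ring
  refine ⟨aeval a S, ?_⟩
  obtain ⟨x, y, hxy⟩ : IsCoprime d 4 := by
    obtain ⟨k, rfl⟩ := hdodd
    exact ⟨2 * k + 1, -(k ^ 2 + k), by ring⟩
  have hxy' : (x : 𝓞 L) * d + y * 4 = 1 := by exact_mod_cast congrArg (Int.cast (R := 𝓞 L)) hxy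
  refine ⟨x * aeval a E + y * (aeval a S ^ 2 - u), ?_⟩
  linear_combination (-(aeval a S ^ 2 - (u : 𝓞 L))) * hxy' + x * hds

theorem isSquare_of_local_square (h2 : Odd (NumberField.classNumber L)) (hp : p.Prime)
    (hp2 : p ≠ 2) (hα : α ^ p = 2)
    (hdeg : Module.finrank ℚ L = p) (hlam : lam ^ p = 2)
    (hdeg2 : Module.finrank ℚ_[2] L₂ = p) (hι : ι α = lam) (u : (𝓞 L)ˣ) {t : L₂}
    (ht : t ^ 2 = ι (algebraMap (𝓞 L) L u)) : IsSquare u := by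
  obtain ⟨s, hs⟩ := exists_sq_mod_four_of_local_square hp hα hdeg hlam hdeg2 hι u ht
  exact isSquare_of_sq_mod_four h2 u s hs fun φ => pos_of_norm_eq_one hp hp2 hα hdeg
    (norm_unit_eq_one_of_local_square hp hα hdeg hlam hdeg2 hι u ht) φ

end

open UniqueFactorizationMonoid in
theorem Ideal.exists_sq_eq_span_of_locally_sq {R : Type*} [CommRing R] [IsDedekindDomain R]
    {η : R} (h0 : η ≠ 0)
    (h : ∀ q : Ideal R, q.IsPrime → q ≠ ⊥ → ∃ c x y : R, c ∉ q ∧ x ≠ 0 ∧ η * c * x ^ 2 = y ^ 2) :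
    ∃ b : Ideal R, b ^ 2 = Ideal.span {η} := by
  classical
  have hI : Ideal.span {η} ≠ 0 := by simpa using h0
  have hev : ∀ q ∈ (normalizedFactors (Ideal.span {η})).toFinset,
      Even ((normalizedFactors (Ideal.span {η})).count q) := by
    intro q hq
    rw [Multiset.mem_toFinset] at hq
    have hqp := Ideal.isPrime_of_prime (prime_of_normalized_factor q hq)
    have hq0 : q ≠ ⊥ := (prime_of_normalized_factor q hq).ne_zero
    obtain ⟨c, x, y, hc, hx, hxy⟩ := h q hqp hq0
    have hc0 : c ≠ 0 := by rintro rfl; exact hc q.zero_mem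
    have hy0 : y ≠ 0 := by
      rintro rfl
      rw [zero_pow two_ne_zero] at hxy
      exact mul_ne_zero (mul_ne_zero h0 hc0) (pow_ne_zero 2 hx) hxy
    have hid : Ideal.span {η} * Ideal.span {c} * Ideal.span {x} ^ 2 = Ideal.span {y} ^ 2 := by
      simp only [Ideal.span_singleton_mul_span_singleton, Ideal.span_singleton_pow, hxy]
    have hs (z : R) (hz : z ≠ 0) : Ideal.span {z} ≠ 0 := by simpa using hz
    have hcnt := congrArg (fun I => (normalizedFactors I).count q) hid
    rw [normalizedFactors_mul (mul_ne_zero hI (hs c hc0)) (pow_ne_zero 2 (hs x hx)),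
      normalizedFactors_mul hI (hs c hc0), normalizedFactors_pow, normalizedFactors_pow,
      Multiset.count_add, Multiset.count_add, Multiset.count_nsmul, Multiset.count_nsmul] at hcnt
    have hz : (normalizedFactors (Ideal.span {c})).count q = 0 := by
      rw [Multiset.count_eq_zero]
      intro hmem
      exact hc ((Ideal.dvd_span_singleton).mp (dvd_of_mem_normalizedFactors hmem))
    rw [hz] at hcnt
    rw [Nat.even_iff]
    lia
  choose! k hk using hev
  refine ⟨∏ q ∈ (normalizedFactors (Ideal.span {η})).toFinset, q ^ k q, ?_⟩
  have hprod : (normalizedFactors (Ideal.span {η})).prod = Ideal.span {η} :=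
    associated_iff_eq.mp (prod_normalizedFactors hI)
  refine Eq.trans ?_ hprod
  rw [← Finset.prod_pow, Finset.prod_multiset_count]
  refine Finset.prod_congr rfl fun q hq => ?_
  conv_rhs => rw [hk q hq]
  rw [← pow_mul, mul_two]

theorem exists_unit_mul_sq_of_span_eq_sq {L : Type*} [Field L] [NumberField L]
    (hodd : Odd (NumberField.classNumber L)) {η : 𝓞 L} (h0 : η ≠ 0) {b : Ideal (𝓞 L)}
    (h : b ^ 2 = Ideal.span {η}) : ∃ (u : (𝓞 L)ˣ) (β : 𝓞 L), η = u * β ^ 2 := by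
  have hb0 : b ≠ 0 := by
    rintro rfl
    rw [zero_pow two_ne_zero] at h
    exact h0 (Ideal.span_singleton_eq_bot.mp h.symm)
  have hbp : b.IsPrincipal := by
    have hb : b ∈ nonZeroDivisors (Ideal (𝓞 L)) := mem_nonZeroDivisors_of_ne_zero hb0
    have hone : ClassGroup.mk0 ⟨b, hb⟩ = 1 := by
      have h2 : ClassGroup.mk0 ⟨b, hb⟩ ^ 2 = 1 := by
        rw [← map_pow, ClassGroup.mk0_eq_one_iff]
        change (b ^ 2).IsPrincipal
        rw [h]
        exact ⟨η, rfl⟩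
      have hcard : ClassGroup.mk0 ⟨b, hb⟩ ^ NumberField.classNumber L = 1 := pow_card_eq_one
      obtain ⟨k, hk⟩ := hodd
      rwa [hk, pow_succ, pow_mul, h2, one_pow, one_mul] at hcard
    exact (ClassGroup.mk0_eq_one_iff hb).mp hone
  obtain ⟨β, rfl⟩ := hbp
  rw [Ideal.submodule_span_eq, Ideal.span_singleton_pow, Ideal.span_singleton_eq_span_singleton]
    at h
  obtain ⟨u, hu⟩ := h
  exact ⟨u, β, by rw [← hu, mul_comm]⟩

theorem exists_sq_eq_one_add_four_mul {F : Type*} [NormedField F] [IsUltrametricDist F]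
    [CompleteSpace F] {y : F} (hy : ‖y‖ < 1) : ∃ s : F, s ^ 2 = 1 + 4 * y := by
  set S : Set F := Metric.closedBall 0 ‖y‖ with hS
  have hmaps : Set.MapsTo (fun r => y - r ^ 2) S S := by
    intro r hr
    rw [hS, mem_closedBall_zero_iff] at hr ⊢
    change ‖y - r ^ 2‖ ≤ ‖y‖
    rw [sub_eq_add_neg]
    refine (IsUltrametricDist.norm_add_le_max _ _).trans (max_le le_rfl ?_)
    rw [norm_neg, norm_pow]
    nlinarith [norm_nonneg r, norm_nonneg y]
  have hc : ContractingWith ⟨‖y‖, norm_nonneg y⟩ (hmaps.restrict (fun r => y - r ^ 2) S S) := by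
    refine ⟨by exact_mod_cast hy, LipschitzWith.of_dist_le_mul fun a b => ?_⟩
    obtain ⟨a, ha⟩ := a
    obtain ⟨b, hb⟩ := b
    rw [hS, mem_closedBall_zero_iff] at ha hb
    change dist (y - a ^ 2) (y - b ^ 2) ≤ ‖y‖ * dist a b
    rw [dist_eq_norm, dist_eq_norm, show y - a ^ 2 - (y - b ^ 2) = -((a + b) * (a - b)) by ring,
      norm_neg, norm_mul]
    gcongr
    exact (IsUltrametricDist.norm_add_le_max _ _).trans (max_le ha hb)
  have hcomp : IsComplete S := Metric.isClosed_closedBall.isComplete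
  obtain ⟨r, -, hr, -⟩ := hc.exists_fixedPoint' hcomp hmaps (x := 0)
    (by simp [hS]) (edist_ne_top _ _)
  refine ⟨1 + 2 * r, ?_⟩
  have hr' : y - r ^ 2 = r := hr
  linear_combination (-4 : F) * hr'

theorem Padic.exists_sq_eq_one_add_eight_mul (k : ℤ) : ∃ s : ℚ_[2], s ^ 2 = 1 + 8 * k := by
  obtain ⟨s, hs⟩ := exists_sq_eq_one_add_four_mul (y := (2 * k : ℚ_[2])) (by
    rw [norm_mul]
    have h2 : ‖(2 : ℚ_[2])‖ = (2 : ℝ)⁻¹ := by simpa using Padic.norm_p (p := 2)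
    have := Padic.norm_int_le_one (p := 2) k
    rw [h2]
    linarith)
  exact ⟨s, by rw [hs]; ring⟩

section

variable {L₂ : Type*} [Field L₂] [Algebra ℚ_[2] L₂] [FiniteDimensional ℚ_[2] L₂] {p : ℕ} {lam : L₂}

theorem exists_sq_mul_eq (hlam : lam ^ p = 2) {m : ℤ} (hm : Odd m) (P Q : ℤ[X]) :
    m + lam * aeval lam Q ≠ 0 ∧ ∃ s : L₂, s ≠ 0 ∧
      m + lam * aeval lam Q + 4 * (lam * aeval lam P) = (m + lam * aeval lam Q) * s ^ 2 := by
  let : NormedField L₂ := spectralNorm.normedField ℚ_[2] L₂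
  let : NormedAlgebra ℚ_[2] L₂ := spectralNorm.normedAlgebra ℚ_[2] L₂
  have : IsUltrametricDist L₂ :=
    IsUltrametricDist.isUltrametricDist_of_isNonarchimedean_norm
      (isNonarchimedean_spectralNorm (K := ℚ_[2]) (L := L₂))
  have : CompleteSpace L₂ := spectralNorm.completeSpace ℚ_[2] L₂
  have hnorm (x : ℚ_[2]) : ‖algebraMap ℚ_[2] L₂ x‖ = ‖x‖ := spectralNorm_extends x
  have hinteg (k : ℤ) : ‖(k : L₂)‖ = ‖(k : ℚ_[2])‖ := by rw [← hnorm, map_intCast]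
  have h2 : ‖(2 : L₂)‖ < 1 := by
    have h := hinteg 2
    have h2 : ‖(2 : ℚ_[2])‖ = (2 : ℝ)⁻¹ := by simpa using Padic.norm_p (p := 2)
    push_cast at h
    rw [h, h2]
    norm_num
  have hl : ‖lam‖ < 1 := by
    by_contra! h
    have := one_le_pow₀ h (n := p)
    rw [← norm_pow, hlam] at this
    linarith
  have hP (P : ℤ[X]) : ‖aeval lam P‖ ≤ 1 := by
    rw [aeval_eq_sum_range]
    refine IsUltrametricDist.norm_sum_le_of_forall_le_of_nonneg zero_le_one fun i _ => ?_
    rw [zsmul_eq_mul, norm_mul, norm_pow, hinteg]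
    exact mul_le_one₀ (Padic.norm_int_le_one _) (by positivity)
      (pow_le_one₀ (norm_nonneg _) hl.le)
  have hlP (P : ℤ[X]) : ‖lam * aeval lam P‖ < 1 := by
    rw [norm_mul]
    nlinarith [hP P, norm_nonneg lam, norm_nonneg (aeval lam P)]
  have hm1 : ‖(m : L₂)‖ = 1 := by
    rw [hinteg]
    refine le_antisymm (Padic.norm_int_le_one _) ?_
    by_contra! h
    have := (PadicInt.norm_int_lt_one_iff_dvd (p := 2) m).mp (by
      rwa [← PadicInt.padic_norm_e_of_padicInt, PadicInt.coe_intCast])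
    rw [← Int.not_even_iff_odd] at hm
    exact hm (even_iff_two_dvd.mpr this)
  have he : ‖m + lam * aeval lam Q‖ = 1 := by
    rw [IsUltrametricDist.norm_add_eq_max_of_norm_ne_norm, hm1, max_eq_left (hlP Q).le]
    rw [hm1]
    exact (hlP Q).ne'
  have he0 : (m : L₂) + lam * aeval lam Q ≠ 0 := by
    intro h
    rw [h, norm_zero] at he
    exact zero_ne_one he
  obtain ⟨s, hs⟩ := exists_sq_eq_one_add_four_mul
    (y := lam * aeval lam P / (m + lam * aeval lam Q)) (by
      rw [norm_div, he, div_one]; exact hlP P)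
  refine ⟨he0, s, ?_, ?_⟩
  · rintro rfl
    have h4 : ‖4 * (lam * aeval lam P / (m + lam * aeval lam Q))‖ < 1 := by
      rw [norm_mul, norm_div, he, div_one, show (4 : L₂) = 2 * 2 by norm_num, norm_mul]
      exact mul_lt_one_of_nonneg_of_lt_one_right (mul_le_one₀ h2.le (norm_nonneg _) h2.le)
        (norm_nonneg _) (hlP P)
    rw [zero_pow two_ne_zero] at hs
    have : 4 * (lam * aeval lam P / (m + lam * aeval lam Q)) = -1 := by linear_combination -hs
    rw [this, norm_neg, norm_one] at h4
    exact lt_irrefl _ h4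
  · rw [hs]
    field_simp

variable {L : Type*} [Field L] [NumberField L] {α : L} {ι : L →+* L₂}

theorem norm_one_add_two_mul_pow (hp : p.Prime) (hp2 : p ≠ 2) (hα : α ^ p = 2)
    (hdeg : Module.finrank ℚ L = p) :
    Algebra.norm ℚ (1 + 2 * α ^ (p - 1)) = 1 + 2 ^ (2 * p - 1) := by
  have hodd := hp.odd_of_ne_two hp2
  have h2p : (2 : ℚ) ^ (2 * p - 1) = 4 ^ p / 2 := by
    rw [show (4 : ℚ) = 2 ^ 2 by norm_num, ← pow_mul, eq_div_iff two_ne_zero, ← pow_succ,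
      Nat.sub_add_cancel (by have := hp.pos; lia)]
  have hirr : Irreducible (X ^ p - C (2 ^ (2 * p - 1)) : ℚ[X]) := by
    refine X_pow_sub_C_irreducible_of_prime hp fun b hb => ?_
    refine Padic.pow_ne_two hp.ne_one ((4 / b : ℚ) : ℚ_[2]) ?_
    have : (4 / b) ^ p = (2 : ℚ) := by
      rw [div_pow, hb, h2p, div_div_eq_mul_div, mul_comm, mul_div_assoc,
        div_self (pow_ne_zero _ four_ne_zero), mul_one]
    exact_mod_cast congrArg (Rat.cast (K := ℚ_[2])) this
  have hmu : (2 * α ^ (p - 1)) ^ p = algebraMap ℚ L (2 ^ (2 * p - 1)) := by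
    rw [mul_pow, ← pow_mul, mul_comm (p - 1), pow_mul, hα, ← pow_add, map_pow, map_ofNat]
    congr 1
    have := hp.pos
    lia
  set μ := 2 * α ^ (p - 1) with hμ
  have hmin := minpoly_eq_X_pow_sub_C hp.ne_zero hirr hmu
  have htop : Algebra.adjoin ℚ {μ + algebraMap ℚ L 1} = ⊤ := by
    rw [eq_top_iff, ← adjoin_eq_top_of_pow_eq hp.ne_zero hirr hmu hdeg]
    refine Algebra.adjoin_le ?_
    rintro _ rfl
    have := Subalgebra.sub_mem _ (Algebra.self_mem_adjoin_singleton ℚ (μ + algebraMap ℚ L 1))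
      (Subalgebra.algebraMap_mem _ (1 : ℚ))
    simpa using this
  set B := PowerBasis.ofAdjoinEqTop (IsIntegral.of_finite ℚ _) htop with hB
  have hBg : B.gen = μ + algebraMap ℚ L 1 := PowerBasis.ofAdjoinEqTop_gen _ _
  have hn := Algebra.PowerBasis.norm_gen_eq_coeff_zero_minpoly B
  rw [hBg, ← B.finrank, hdeg, hodd.neg_one_pow, minpoly.add_algebraMap, hmin,
    coeff_zero_eq_eval_zero] at hn
  rw [map_one, add_comm] at hn
  rw [hn]
  simp only [eval_comp, eval_sub, eval_pow, eval_X, eval_C, zero_sub, hodd.neg_one_pow]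
  ring

theorem exists_signed_unit_local_square (hp : p.Prime) (hp2 : p ≠ 2) (hα : α ^ p = 2)
    (hdeg : Module.finrank ℚ L = p) (hlam : lam ^ p = 2)
    (hdeg2 : Module.finrank ℚ_[2] L₂ = p) (hι : ι α = lam) {c k : ℤ} (hc : Odd c) (P Q : ℤ[X])
    (hN : Algebra.norm ℚ (1 + α * aeval α Q) = 1 + 8 * k)
    {u : (𝓞 L)ˣ} {β : 𝓞 L}
    (h : algebraMap (𝓞 L) L (u * β ^ 2) = c * (1 + α * aeval α Q) + 4 * (α * aeval α P)) :
    ∃ v : (𝓞 L)ˣ, (v = u ∨ v = -u) ∧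
      ∃ s : L₂, s ^ 2 = ι (algebraMap (𝓞 L) L v) * ι (1 + α * aeval α Q) := by
  have hιa (q : ℤ[X]) : ι (aeval α q) = aeval lam q := by
    rw [aeval_def, aeval_def, hom_eval₂, hι]
    congr 1
    exact RingHom.ext_int _ _
  have hodd := hp.odd_of_ne_two hp2
  obtain ⟨he0, s, hs0, hs⟩ := exists_sq_mul_eq (L₂ := L₂) hlam hc P (C c * Q)
  have hz : (c : L₂) + lam * aeval lam (C c * Q) = c * ι (1 + α * aeval α Q) := by
    rw [map_add ι, map_one ι, map_mul ι, hι, hιa, map_mul (aeval lam), aeval_C, algebraMap_int_eq,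
      eq_intCast]
    ring
  rw [hz] at he0 hs
  set z := 1 + α * aeval α Q with hzdef
  have hs' : ι (algebraMap (𝓞 L) L u) * ι (algebraMap (𝓞 L) L β) ^ 2 = c * ι z * s ^ 2 := by
    rw [← hs, ← map_pow, ← map_mul, ← map_pow, ← map_mul, h, map_add, map_mul, map_mul, hzdef]
    simp only [map_mul, hι, hιa, map_intCast, map_ofNat]
  have hβ0 : ι (algebraMap (𝓞 L) L β) ≠ 0 := by
    intro h0
    rw [h0, zero_pow two_ne_zero, mul_zero] at hs'
    exact mul_ne_zero he0 (pow_ne_zero 2 hs0) hs'.symm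
  have hc0 : (c : ℚ_[2]) ≠ 0 := by
    intro h0
    refine he0 ?_
    rw [Int.cast_eq_zero.mp h0]
    simp
  have hnorm := congrArg (Algebra.norm ℚ_[2]) hs'
  have hcn : Algebra.norm ℚ_[2] (c : L₂) = (c : ℚ_[2]) ^ p := by
    rw [← hdeg2, ← Algebra.norm_algebraMap, map_intCast (algebraMap ℚ_[2] L₂)]
  rw [map_mul, map_mul, map_mul, map_pow, map_pow,
    norm_padic_eq_norm hp hα hdeg hlam hdeg2 hι, norm_padic_eq_norm hp hα hdeg hlam hdeg2 hι, hcn,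
    norm_padic_eq_norm hp hα hdeg hlam hdeg2 hι, hN] at hnorm
  obtain ⟨r, hr⟩ := Padic.exists_sq_eq_one_add_eight_mul k
  push_cast at hnorm
  rw [← hr] at hnorm
  have hr0 : r ≠ 0 := by
    rintro rfl
    have hz0 : ι z ≠ 0 := fun h0 => he0 (by rw [h0, mul_zero])
    have := norm_padic_eq_norm hp hα hdeg hlam hdeg2 hι z
    rw [hN] at this
    push_cast at this
    rw [← hr, zero_pow two_ne_zero, Algebra.norm_eq_zero_iff] at this
    exact hz0 this
  have hNs0 : Algebra.norm ℚ_[2] s ≠ 0 := fun h0 => hs0 (Algebra.norm_eq_zero_iff.mp h0)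
  obtain ⟨j, hj⟩ := hodd
  have hsq : ∃ ε : ℤˣ, ∃ x : ℚ_[2], ((ε : ℤ) : ℚ_[2]) * c = x ^ 2 := by
    have hu := NumberField.isUnit_iff_norm.mp u.isUnit
    rw [RingOfIntegers.coe_norm] at hu
    set b : ℚ_[2] := ((Algebra.norm ℚ (algebraMap (𝓞 L) L β) : ℚ) : ℚ_[2])
    have hε : ∃ ε : ℤˣ, Algebra.norm ℚ (algebraMap (𝓞 L) L u) = ((ε : ℤ) : ℚ) := by
      rcases (abs_eq zero_le_one).mp hu with h | h
      · exact ⟨1, by simpa using h⟩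
      · exact ⟨-1, by simpa using h⟩
    obtain ⟨ε, hε⟩ := hε
    refine ⟨ε, b / (c ^ j * r * Algebra.norm ℚ_[2] s), ?_⟩
    have hε2 : ((ε : ℤ) : ℚ_[2]) * ((ε : ℤ) : ℚ_[2]) = 1 := by
      norm_cast
      simp
    rw [hε, hj] at hnorm
    push_cast at hnorm
    rw [div_pow, eq_div_iff (pow_ne_zero 2 (mul_ne_zero (mul_ne_zero (pow_ne_zero j hc0) hr0)
      hNs0))]
    linear_combination (-((ε : ℤ) : ℚ_[2])) * hnorm + b ^ 2 * hε2
  obtain ⟨ε, x, hx⟩ := hsq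
  have hx' : ((ε : ℤ) : L₂) * c = algebraMap ℚ_[2] L₂ x ^ 2 := by
    rw [← map_pow, ← hx, map_mul, map_intCast, map_intCast]
  have key (v : (𝓞 L)ˣ)
      (hv : algebraMap (𝓞 L) L v = ((ε : ℤ) : L) * algebraMap (𝓞 L) L u) :
      ∃ s : L₂, s ^ 2 = ι (algebraMap (𝓞 L) L v) * ι z := by
    refine ⟨algebraMap ℚ_[2] L₂ x * ι z * s / ι (algebraMap (𝓞 L) L β), ?_⟩
    rw [div_pow, div_eq_iff (pow_ne_zero 2 hβ0), hv, map_mul, map_intCast]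
    linear_combination (-(ι z) ^ 2 * s ^ 2) * hx' - ((ε : ℤ) : L₂) * ι z * hs'
  rcases Int.units_eq_one_or ε with rfl | rfl
  · exact ⟨u, Or.inl rfl, key u (by simp)⟩
  · exact ⟨-u, Or.inr rfl, key (-u) (by simp)⟩

end

/-- The order `k[x, w] / (w² + w - x^p)`, the coordinate ring of the hyperelliptic curve
`w² + w = x^p`. -/
abbrev HyperRing (k : Type*) [CommRing k] (p : ℕ) := QuadraticAlgebra k[X] (X ^ p) (-1)

namespace HyperRing

open QuadraticAlgebra

variable {k l : Type*} [CommRing k] [CommRing l] {p : ℕ}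

theorem norm_apply (F : HyperRing k p) :
    norm F = F.re ^ 2 - F.re * F.im - X ^ p * F.im ^ 2 := by
  rw [norm_def]
  ring

theorem mul_star_re (F G : HyperRing k p) :
    (F * star G).re = F.re * (G.re - G.im) - X ^ p * (F.im * G.im) := by
  simp only [re_mul, re_star, im_star]
  ring

theorem mul_star_im (F G : HyperRing k p) :
    (F * star G).im = F.im * G.re - F.re * G.im := by
  simp only [im_mul, re_star, im_star]
  ring

theorem mul_star_self (F : HyperRing k p) : F * star F = algebraMap k[X] _ (norm F) :=
  (algebraMap_norm_eq_mul_star F).symm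

theorem norm_smul (r : k[X]) (F : HyperRing k p) : norm (r • F) = r ^ 2 * norm F := by
  rw [Algebra.smul_def, map_mul, QuadraticAlgebra.norm_algebraMap]

/-- Base change of coefficients. -/
noncomputable def map (f : k →+* l) : HyperRing k p →+* HyperRing l p where
  toFun F := ⟨F.re.map f, F.im.map f⟩
  map_one' := by ext <;> simp
  map_zero' := by ext <;> simp
  map_add' F G := by ext <;> simp
  map_mul' F G := by ext <;> simp

theorem map_re (f : k →+* l) (F : HyperRing k p) : (map f F).re = F.re.map f := rfl

theorem map_im (f : k →+* l) (F : HyperRing k p) : (map f F).im = F.im.map f := rfl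

theorem norm_map (f : k →+* l) (F : HyperRing k p) : norm (map f F) = (norm F).map f := by
  simp only [norm_apply, map_re, map_im, Polynomial.map_sub, Polynomial.map_mul,
    Polynomial.map_pow, map_X]

theorem map_star (f : k →+* l) (F : HyperRing k p) : map f (star F) = star (map f F) := by
  ext <;> simp [map_re, map_im]

theorem map_smul (f : k →+* l) (r : k[X]) (F : HyperRing k p) :
    map f (r • F) = r.map f • map f F := by
  ext <;> simp [map_re, map_im]

theorem map_injective {f : k →+* l} (hf : Function.Injective f) :
    Function.Injective (map f : HyperRing k p → HyperRing l p) := fun F G h => by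
  ext1
  · exact Polynomial.map_injective f hf (congrArg QuadraticAlgebra.re h)
  · exact Polynomial.map_injective f hf (congrArg QuadraticAlgebra.im h)

theorem map_surjective {f : k →+* l} (hf : Function.Surjective f) :
    Function.Surjective (map f : HyperRing k p → HyperRing l p) := fun F => by
  obtain ⟨u, hu⟩ := Polynomial.map_surjective f hf F.re
  obtain ⟨v, hv⟩ := Polynomial.map_surjective f hf F.im
  exact ⟨⟨u, v⟩, by ext1 <;> simp only [map_re, map_im, hu, hv]⟩

theorem natDegree_norm_le {F : HyperRing k p} {m : ℕ} (hre : 2 * F.re.natDegree ≤ m)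
    (him : F.im ≠ 0 → p + 2 * F.im.natDegree ≤ m) : (norm F).natDegree ≤ m := by
  rw [norm_apply]
  by_cases hV : F.im = 0
  · rw [hV]
    simp only [mul_zero, sub_zero, ne_eq, OfNat.ofNat_ne_zero, not_false_eq_true, zero_pow]
    exact natDegree_pow_le.trans hre
  have him := him hV
  refine (natDegree_sub_le _ _).trans (max_le ((natDegree_sub_le _ _).trans (max_le ?_ ?_)) ?_)
  · exact natDegree_pow_le.trans hre
  · exact natDegree_mul_le.trans (by lia)
  · refine natDegree_mul_le.trans ?_
    have h1 : ((X : k[X]) ^ p).natDegree ≤ p := natDegree_X_pow_le p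
    have h2 := natDegree_pow_le (p := F.im) (n := 2)
    lia

section IsDomain

variable [IsDomain k]

theorem natDegree_norm_of_lt {F : HyperRing k p} (hV : F.im ≠ 0)
    (h : 2 * F.re.natDegree < p + 2 * F.im.natDegree) :
    (norm F).natDegree = p + 2 * F.im.natDegree := by
  have h3 : (X ^ p * F.im ^ 2).natDegree = p + 2 * F.im.natDegree := by
    rw [natDegree_mul (pow_ne_zero _ X_ne_zero) (pow_ne_zero _ hV), natDegree_pow, natDegree_pow,
      natDegree_X, mul_one]
  rw [norm_apply, natDegree_sub_eq_right_of_natDegree_lt, h3]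
  rw [h3]
  refine (natDegree_sub_le _ _).trans_lt (max_lt ?_ ?_)
  · exact natDegree_pow_le.trans_lt h
  · exact natDegree_mul_le.trans_lt (by lia)

theorem natDegree_norm_of_gt {F : HyperRing k p}
    (h : F.im ≠ 0 → p + 2 * F.im.natDegree < 2 * F.re.natDegree) :
    (norm F).natDegree = 2 * F.re.natDegree := by
  by_cases hV : F.im = 0
  · rw [norm_apply, hV]
    simp only [mul_zero, sub_zero, ne_eq, OfNat.ofNat_ne_zero, not_false_eq_true, zero_pow]
    exact natDegree_pow _ _
  have h := h hV
  have h1 : (F.re ^ 2 - F.re * F.im).natDegree = 2 * F.re.natDegree := by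
    rw [natDegree_sub_eq_left_of_natDegree_lt, natDegree_pow]
    rw [natDegree_pow]
    exact natDegree_mul_le.trans_lt (by lia)
  rw [norm_apply, natDegree_sub_eq_left_of_natDegree_lt, h1]
  rw [h1]
  refine natDegree_mul_le.trans_lt ?_
  have h1 : ((X : k[X]) ^ p).natDegree ≤ p := natDegree_X_pow_le p
  have h2 := natDegree_pow_le (p := F.im) (n := 2)
  lia

theorem natDegree_norm_le_iff (hp : Odd p) {F : HyperRing k p} {m : ℕ} :
    (norm F).natDegree ≤ m ↔
      2 * F.re.natDegree ≤ m ∧ (F.im ≠ 0 → p + 2 * F.im.natDegree ≤ m) := by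
  refine ⟨fun h => ?_, fun h => natDegree_norm_le h.1 h.2⟩
  by_cases hV : F.im = 0
  · rw [natDegree_norm_of_gt fun h => absurd hV h] at h
    exact ⟨h, fun h => absurd hV h⟩
  rcases lt_or_ge (2 * F.re.natDegree) (p + 2 * F.im.natDegree) with h1 | h1
  · rw [natDegree_norm_of_lt hV h1] at h
    exact ⟨h1.le.trans h, fun _ => h⟩
  · have h1 : p + 2 * F.im.natDegree < 2 * F.re.natDegree := by
      obtain ⟨j, hj⟩ := hp
      lia
    rw [natDegree_norm_of_gt fun _ => h1] at h
    exact ⟨h, fun _ => h1.le.trans h⟩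

theorem norm_eq_zero (hp : Odd p) {F : HyperRing k p} : norm F = 0 ↔ F = 0 := by
  refine ⟨fun h => ?_, fun h => by rw [h, QuadraticAlgebra.norm_zero]⟩
  have hV : F.im = 0 := by
    by_contra hV
    have := ((natDegree_norm_le_iff hp (F := F) (m := 0)).mp (by rw [h, natDegree_zero])).2 hV
    have := hp.pos
    lia
  rw [norm_apply, hV] at h
  ext1
  · simpa using h
  · exact hV

theorem isDomain (hp : Odd p) : IsDomain (HyperRing k p) := by
  have : NoZeroDivisors (HyperRing k p) := ⟨fun {F G} h => by
    have := congrArg QuadraticAlgebra.norm h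
    rw [map_mul, QuadraticAlgebra.norm_zero, mul_eq_zero, norm_eq_zero hp, norm_eq_zero hp] at this
    exact this⟩
  exact NoZeroDivisors.to_isDomain _

end IsDomain

/-- The ideal `(κ, w - b)`. -/
def idl (κ b : k[X]) (h : κ ∣ b ^ 2 + b - X ^ p) : Ideal (HyperRing k p) where
  carrier := {F | κ ∣ F.re + b * F.im}
  zero_mem' := by simp
  add_mem' {F G} hF hG := by
    have := dvd_add hF hG
    rw [Set.mem_ofPred_eq, re_add, im_add]
    convert this using 1
    ring
  smul_mem' F G hG := by
    rw [Set.mem_ofPred_eq] at hG ⊢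
    have h1 : (F • G).re + b * (F • G).im =
        (F.re + b * F.im) * (G.re + b * G.im) - (b ^ 2 + b - X ^ p) * (F.im * G.im) := by
      rw [smul_eq_mul, re_mul, im_mul]
      ring
    rw [h1]
    exact dvd_sub (hG.mul_left _) (h.mul_right _)

variable {κ b : k[X]} {h : κ ∣ b ^ 2 + b - X ^ p}

theorem mem_idl {F : HyperRing k p} : F ∈ idl κ b h ↔ κ ∣ F.re + b * F.im := Iff.rfl

theorem exists_mul_star_eq_smul {F G : HyperRing k p} (hF : F ∈ idl κ b h)
    (hG : G ∈ idl κ b h) : ∃ P : HyperRing k p, F * star G = κ • P := by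
  obtain ⟨r, hr⟩ := hF
  obtain ⟨s, hs⟩ := hG
  obtain ⟨e, he⟩ := h
  refine ⟨⟨κ * r * s - b * r * G.im - r * G.im - s * b * F.im + e * F.im * G.im,
    F.im * s - r * G.im⟩, ?_⟩
  ext1
  · rw [mul_star_re, re_smul, smul_eq_mul]
    linear_combination (G.re - G.im) * hr + (κ * r - b * F.im) * hs + F.im * G.im * he
  · rw [mul_star_im, im_smul, smul_eq_mul]
    linear_combination F.im * hs - G.im * hr

theorem dvd_norm {F : HyperRing k p} (hF : F ∈ idl κ b h) : κ ∣ norm F := by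
  obtain ⟨P, hP⟩ := exists_mul_star_eq_smul hF hF
  rw [mul_star_self] at hP
  have := congrArg QuadraticAlgebra.re hP
  rw [algebraMap_re, re_smul] at this
  exact ⟨_, this⟩

theorem algebraMap_mem_idl : algebraMap k[X] (HyperRing k p) κ ∈ idl κ b h := by
  rw [mem_idl, algebraMap_re, algebraMap_im, mul_zero, add_zero]

/-- Evaluation of `x` at `θ` and of `w` at `-1/2`. -/
noncomputable def evalHalf {K : Type*} [Field K] [Algebra k K] (θ : K) (h2 : (2 : K) ≠ 0)
    (hθ : 4 * θ ^ p = -1) : HyperRing k p →+* K where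
  toFun F := aeval θ F.re - aeval θ F.im / 2
  map_one' := by simp
  map_zero' := by simp
  map_add' F G := by
    simp only [re_add, im_add, map_add]
    ring
  map_mul' F G := by
    simp only [re_mul, im_mul, map_add, map_mul, map_pow, aeval_X, map_neg, map_one]
    field_simp
    linear_combination (aeval θ F.im * aeval θ G.im) * hθ

section evalHalf

variable {K : Type*} [Field K] [Algebra k K] {θ : K} {h2 : (2 : K) ≠ 0} {hθ : 4 * θ ^ p = -1}

theorem evalHalf_apply (F : HyperRing k p) :
    evalHalf θ h2 hθ F = aeval θ F.re - aeval θ F.im / 2 := rfl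

theorem evalHalf_sq (F : HyperRing k p) :
    evalHalf θ h2 hθ F ^ 2 = aeval θ (norm F) := by
  rw [evalHalf_apply, norm_apply]
  simp only [map_sub, map_mul, map_pow, aeval_X]
  field_simp
  linear_combination (aeval θ F.im) ^ 2 * hθ

end evalHalf

end HyperRing

/-- Reduction of an integer polynomial modulo `q`. -/
noncomputable abbrev redPoly (q : ℕ) : ℤ[X] →+* (ZMod q)[X] := mapRingHom (Int.castRingHom (ZMod q))

theorem redPoly_eq_zero_iff {q : ℕ} {r : ℤ[X]} : redPoly q r = 0 ↔ C (q : ℤ) ∣ r := by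
  rw [C_dvd_iff_dvd_coeff, Polynomial.ext_iff]
  refine forall_congr' fun i => ?_
  rw [coe_mapRingHom, coeff_map, coeff_zero, eq_intCast, ZMod.intCast_zmod_eq_zero_iff_dvd]

theorem redPoly_surjective (q : ℕ) : Function.Surjective (redPoly q) :=
  Polynomial.map_surjective _ (ZMod.ringHom_surjective _)

theorem two_dvd_iff_redPoly {r : ℤ[X]} : 2 ∣ r ↔ redPoly 2 r = 0 := redPoly_eq_zero_iff.symm

theorem redPoly_two_two : redPoly 2 2 = 0 := two_dvd_iff_redPoly.mp dvd_rfl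

/-- Degree comparison over a field of characteristic two. -/
theorem eq_zero_of_X_pow_mul_eq {k : Type*} [CommRing k] [IsDomain k] {g : ℕ} {a : k}
    {y z r e : k[X]} (hyz : z ≠ 0 → y.natDegree ≤ z.natDegree) (hy : y.natDegree < g)
    (hz : z.natDegree < g) (hr : r.natDegree < 2 * g)
    (h : X ^ (2 * g) * z + C a * X ^ g * y ^ 2 = r + X ^ (3 * g) * e) : z = 0 := by
  by_contra hz0
  have hyz := hyz hz0
  have hdvd : X ^ g ∣ r := by
    refine ⟨X ^ g * z + C a * y ^ 2 - X ^ (2 * g) * e, ?_⟩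
    linear_combination (exp := 1) -h + (by ring : (X : k[X]) ^ (3 * g) = X ^ g * X ^ (2 * g)) * e
      - (by ring : (X : k[X]) ^ (2 * g) = X ^ g * X ^ g) * z
  obtain ⟨s, rfl⟩ := hdvd
  have hs : s.natDegree < g := by
    by_cases hs0 : s = 0
    · rw [hs0, natDegree_zero]
      lia
    · rw [natDegree_mul (pow_ne_zero _ X_ne_zero) hs0, natDegree_X_pow] at hr
      lia
  have h' : X ^ g * z + C a * y ^ 2 = s + X ^ (2 * g) * e := by
    refine mul_left_cancel₀ (pow_ne_zero g (X_ne_zero (R := k))) ?_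
    linear_combination h + (by ring : (X : k[X]) ^ (3 * g) = X ^ g * X ^ (2 * g)) * e
      - (by ring : (X : k[X]) ^ (2 * g) = X ^ g * X ^ g) * z
  have hay : (C a * y ^ 2).natDegree ≤ 2 * y.natDegree :=
    (natDegree_C_mul_le _ _).trans natDegree_pow_le
  have hzg : (X ^ g * z).natDegree = g + z.natDegree := by
    rw [natDegree_mul (pow_ne_zero _ X_ne_zero) hz0, natDegree_X_pow]
  have he : e = 0 := by
    by_contra he
    have h1 : (X ^ (2 * g) * e).natDegree = 2 * g + e.natDegree := by
      rw [natDegree_mul (pow_ne_zero _ X_ne_zero) he, natDegree_X_pow]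
    have h2 : X ^ (2 * g) * e = X ^ g * z + C a * y ^ 2 - s := by rw [h']; ring
    have h3 : (X ^ g * z + C a * y ^ 2 - s).natDegree < 2 * g := by
      refine (natDegree_sub_le _ _).trans_lt (max_lt ((natDegree_add_le _ _).trans_lt
        (max_lt ?_ ?_)) ?_) <;> lia
    rw [← h2, h1] at h3
    lia
  rw [he, mul_zero, add_zero] at h'
  have h2 : X ^ g * z = s - C a * y ^ 2 := by rw [← h']; ring
  have h3 : (s - C a * y ^ 2).natDegree < g + z.natDegree :=
    (natDegree_sub_le _ _).trans_lt (max_lt (by lia) (by lia))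
  rw [← h2, hzg] at h3
  exact lt_irrefl _ h3

namespace HyperRing

open QuadraticAlgebra

variable {p : ℕ}

/-- Reduction modulo `q`. -/
noncomputable abbrev red (q : ℕ) : HyperRing ℤ p →+* HyperRing (ZMod q) p :=
  map (Int.castRingHom (ZMod q))

theorem natDegree_redPoly_lt {y r : ℤ[X]} {e m : ℕ} (h : r = 2 ^ e * y) (hr : r.natDegree < m) :
    (redPoly 2 y).natDegree < m := by
  refine natDegree_map_le.trans_lt ?_
  have h2 : (2 : ℤ[X]) ^ e * y = C (2 ^ e) * y := by rw [Polynomial.C_pow]; rfl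
  rwa [h, h2, natDegree_C_mul (pow_ne_zero e two_ne_zero)] at hr

theorem descent_step {g e : ℕ} (hg : 0 < g) (he : 1 ≤ e) {u₁ u₂ K₀ E₀ k₁ e₁ t y : ℤ[X]} {ν : ℤ}
    (hν : Odd ν)
    (heq : C ν * (2 ^ e * k₁ * E₀ - K₀ * (2 ^ e * e₁)) =
      (u₂ ^ 2 + X ^ (2 * g + 1) * (2 ^ e * y) ^ 2) * (2 ^ (e + 1) * t) +
        (2 * u₂ * (2 ^ e * y) - (2 ^ e * y) ^ 2) * (u₁ - 2 ^ (e + 1) * t))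
    (hE₀ : redPoly 2 E₀ = 1) (hK₀ : redPoly 2 K₀ = X ^ (3 * g))
    (hu₁ : redPoly 2 u₁ = X ^ g) (hu₂ : redPoly 2 u₂ = X ^ g)
    (hk : (redPoly 2 k₁).natDegree < 2 * g) (hk' : ∀ r, k₁ = 2 * r → (redPoly 2 r).natDegree < 2 * g)
    (hy : (redPoly 2 y).natDegree < g)
    (ht : redPoly 2 t = 0 ∨ redPoly 2 t = 1) :
    2 ∣ k₁ ∧ 2 ∣ e₁ ∧ redPoly 2 (y + t) = 0 := by
  have h20 := redPoly_two_two
  have hν1 : redPoly 2 (C ν) = 1 := by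
    obtain ⟨j, rfl⟩ := hν
    rw [Polynomial.C_add, Polynomial.C_mul, map_add, map_mul]
    have : (C 2 : ℤ[X]) = 2 := rfl
    rw [this, h20, zero_mul, zero_add, Polynomial.C_1, map_one]
  obtain ⟨f, rfl⟩ := Nat.exists_eq_add_of_le he
  have heq1 : C ν * (k₁ * E₀ - K₀ * e₁) = 2 * ((u₂ ^ 2 + X ^ (2 * g + 1) * (2 ^ (1 + f) * y) ^ 2) * t
      + (u₂ * y - 2 ^ f * y ^ 2) * (u₁ - 2 ^ (1 + f + 1) * t)) := by
    refine mul_left_cancel₀ (pow_ne_zero (1 + f) (two_ne_zero (α := ℤ[X]))) ?_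
    linear_combination (exp := 1) heq
  have hkz : redPoly 2 k₁ = X ^ (3 * g) * redPoly 2 e₁ := by
    have := congrArg (redPoly 2) heq1
    rw [map_mul, hν1, map_mul, h20, zero_mul, one_mul, map_sub, map_mul, map_mul, hE₀, hK₀,
      mul_one, sub_eq_zero] at this
    exact this
  have he1 : redPoly 2 e₁ = 0 := by
    by_contra h0
    rw [hkz, natDegree_mul (pow_ne_zero _ X_ne_zero) h0, natDegree_X_pow] at hk
    lia
  rw [he1, mul_zero] at hkz
  obtain ⟨k₂, rfl⟩ := two_dvd_iff_redPoly.mpr hkz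
  obtain ⟨e₂, rfl⟩ := two_dvd_iff_redPoly.mpr he1
  refine ⟨dvd_mul_right _ _, dvd_mul_right _ _, ?_⟩
  have heq2 : C ν * (k₂ * E₀ - K₀ * e₂) = (u₂ ^ 2 + X ^ (2 * g + 1) * (2 ^ (1 + f) * y) ^ 2) * t
      + (u₂ * y - 2 ^ f * y ^ 2) * (u₁ - 2 ^ (1 + f + 1) * t) := by
    refine mul_left_cancel₀ (two_ne_zero (α := ℤ[X])) ?_
    linear_combination heq1
  have h := congrArg (redPoly 2) heq2
  simp only [map_mul, map_sub, map_add, map_pow, hν1, h20, hE₀, hK₀, hu₁, hu₂] at h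
  rw [pow_add, pow_add] at h
  simp only [pow_one, zero_mul, mul_zero, one_mul, mul_one, ne_eq, OfNat.ofNat_ne_zero,
    not_false_eq_true, zero_pow, add_zero] at h
  have h2 : (2 : (ZMod 2)[X]) = 0 := by rw [← h20, map_ofNat]
  have hε : (0 : (ZMod 2)[X]) ^ f = C (0 ^ f) := by rw [Polynomial.C_pow, Polynomial.C_0]
  refine eq_zero_of_X_pow_mul_eq (g := g) (a := 0 ^ f) (y := redPoly 2 y) (r := redPoly 2 k₂)
    (e := redPoly 2 e₂) ?_ hy ?_ (hk' k₂ rfl) ?_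
  · intro h0
    rw [map_add] at h0 ⊢
    rcases ht with ht | ht
    · rw [ht, add_zero]
    · rw [ht, ← C_1, natDegree_add_C]
  · rw [map_add]
    refine (natDegree_add_le _ _).trans_lt (max_lt hy ?_)
    rcases ht with ht | ht
    · rw [ht, natDegree_zero]
      exact hg
    · rw [ht, natDegree_one]
      exact hg
  · rw [← hε, map_add]
    linear_combination (exp := 1) -h + ((X : (ZMod 2)[X]) ^ (3 * g) * redPoly 2 e₂ * (-1)
      + 0 ^ f * X ^ g * redPoly 2 y ^ 2) * h2

end HyperRing

namespace HyperRing

open QuadraticAlgebra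

theorem exists_im_eq_two_pow_mul {g n : ℕ} (hg : 0 < g) (hn : 2 ≤ n)
    {Ψ Φ E K : HyperRing ℤ (2 * g + 1)} {ν : ℤ} (hν : Odd ν)
    (heq : (C ν : ℤ[X]) • (K * star E) = Φ ^ 2 * Ψ)
    (hE : red 2 E = 1) (hK : red 2 K = algebraMap (ZMod 2)[X] _ (X ^ (3 * g)))
    (hKd : K.im.natDegree < 2 * g)
    (hΨ : redPoly 2 Ψ.re = X ^ g) {v : ℤ[X]} (hv : Ψ.im = 2 ^ n * v) (hv1 : redPoly 2 v = 1)
    (hΦ : red 2 Φ = algebraMap (ZMod 2)[X] _ (X ^ g)) (hΦd : Φ.im.natDegree < g) :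
    ∃ y, Φ.im = 2 ^ (n - 1) * y ∧ redPoly 2 y = 1 := by
  have heqim := congrArg QuadraticAlgebra.im heq
  rw [im_smul, mul_star_im, smul_eq_mul] at heqim
  have hE₀ : redPoly 2 E.re = 1 := congrArg QuadraticAlgebra.re hE
  have hE₁ : redPoly 2 E.im = 0 := congrArg QuadraticAlgebra.im hE
  have hK₀ : redPoly 2 K.re = X ^ (3 * g) := congrArg QuadraticAlgebra.re hK
  have hK₁ : redPoly 2 K.im = 0 := congrArg QuadraticAlgebra.im hK
  have hΦ₀ : redPoly 2 Φ.re = X ^ g := congrArg QuadraticAlgebra.re hΦ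
  have hΦ₁ : redPoly 2 Φ.im = 0 := congrArg QuadraticAlgebra.im hΦ
  have h20 := redPoly_two_two
  have step (e : ℕ) (he : 1 ≤ e) (hen : e + 1 ≤ n) (k₁ e₁ y : ℤ[X]) (hk : K.im = 2 ^ e * k₁)
      (hEe : E.im = 2 ^ e * e₁) (hy : Φ.im = 2 ^ e * y) :
      2 ∣ k₁ ∧ 2 ∣ e₁ ∧ redPoly 2 (y + 2 ^ (n - (e + 1)) * v) = 0 := by
    have hV : Ψ.im = 2 ^ (e + 1) * (2 ^ (n - (e + 1)) * v) := by
      rw [hv, ← mul_assoc, ← pow_add, Nat.add_sub_cancel' hen]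
    refine descent_step (e := e) (u₁ := Ψ.re) (u₂ := Φ.re) (K₀ := K.re) (E₀ := E.re) (ν := ν)
      hg he hν ?_ hE₀ hK₀ hΨ hΦ₀ (natDegree_redPoly_lt hk hKd) ?_
      (natDegree_redPoly_lt hy hΦd) ?_
    · rw [← hk, ← hEe, ← hy, ← hV, heqim, pow_two Φ, im_mul, im_mul, re_mul]
      ring
    · intro r hr
      exact natDegree_redPoly_lt (e := e + 1) (hk.trans (by rw [hr]; ring)) hKd
    · rw [map_mul, map_pow, h20, hv1, mul_one]
      rcases Nat.eq_zero_or_pos (n - (e + 1)) with h0 | h0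
      · exact Or.inr (by rw [h0, pow_zero])
      · exact Or.inl (zero_pow h0.ne')
  have claim (e : ℕ) (he : 1 ≤ e) : e + 1 ≤ n →
      ∃ k₁ e₁ y : ℤ[X], K.im = 2 ^ e * k₁ ∧ E.im = 2 ^ e * e₁ ∧ Φ.im = 2 ^ e * y := by
    induction e, he using Nat.le_induction with
    | base =>
      intro _
      obtain ⟨a, ha⟩ := two_dvd_iff_redPoly.mpr hK₁
      obtain ⟨b, hb⟩ := two_dvd_iff_redPoly.mpr hE₁
      obtain ⟨c, hc⟩ := two_dvd_iff_redPoly.mpr hΦ₁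
      exact ⟨a, b, c, by rw [pow_one, ha], by rw [pow_one, hb], by rw [pow_one, hc]⟩
    | succ e he ih =>
      intro hen
      obtain ⟨k₁, e₁, y, hk, hEe, hy⟩ := ih (by lia)
      obtain ⟨⟨k₂, hk₂⟩, ⟨e₂, he₂⟩, hyt⟩ := step e he (by lia) k₁ e₁ y hk hEe hy
      rw [map_add, map_mul, map_pow, h20, zero_pow (by lia), zero_mul, add_zero] at hyt
      obtain ⟨y₂, hy₂⟩ := two_dvd_iff_redPoly.mpr hyt
      exact ⟨k₂, e₂, y₂, by rw [hk, hk₂]; ring, by rw [hEe, he₂]; ring, by rw [hy, hy₂]; ring⟩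
  obtain ⟨k₁, e₁, y, hk, hEe, hy⟩ := claim (n - 1) (by lia) (by lia)
  obtain ⟨-, -, hyt⟩ := step (n - 1) (by lia) (by lia) k₁ e₁ y hk hEe hy
  refine ⟨y, hy, ?_⟩
  rw [Nat.sub_add_cancel (by lia), Nat.sub_self, pow_zero, one_mul, map_add, hv1] at hyt
  have h2 : (2 : (ZMod 2)[X]) = 0 := by rw [← h20, map_ofNat]
  linear_combination (exp := 1) hyt - h2

end HyperRing

theorem exists_int_smul_eq_map (b : ℚ[X]) :
    ∃ (d : ℤ) (β : ℤ[X]), d ≠ 0 ∧ β.map (Int.castRingHom ℚ) = C (d : ℚ) * b := by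
  obtain ⟨d, hd, h⟩ := IsLocalization.integerNormalization_spec (nonZeroDivisors ℤ) b
  refine ⟨d, _, nonZeroDivisors.ne_zero hd, h.trans ?_⟩
  ext i
  rw [coeff_smul, coeff_C_mul]
  exact zsmul_eq_mul _ _

theorem redPoly_ne_zero {κ : ℤ[X]} (hκ : κ.IsPrimitive) (q : ℕ) [hq : Fact q.Prime] :
    redPoly q κ ≠ 0 := by
  rw [Ne, redPoly_eq_zero_iff]
  intro h
  exact (Nat.prime_iff_prime_int.mp hq.out).not_isUnit (hκ _ h)

namespace HyperRing

open QuadraticAlgebra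

variable {p : ℕ}

/-- Extension of scalars from `ℤ` to `ℚ`. -/
noncomputable abbrev toRat : HyperRing ℤ p →+* HyperRing ℚ p := map (Int.castRingHom ℚ)

theorem red_eq_zero_iff {q : ℕ} {F : HyperRing ℤ p} :
    red q F = 0 ↔ ∃ G, F = (C (q : ℤ) : ℤ[X]) • G := by
  constructor
  · intro h
    obtain ⟨u, hu⟩ := redPoly_eq_zero_iff.mp (congrArg QuadraticAlgebra.re h)
    obtain ⟨v, hv⟩ := redPoly_eq_zero_iff.mp (congrArg QuadraticAlgebra.im h)
    exact ⟨⟨u, v⟩, QuadraticAlgebra.ext hu hv⟩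
  · rintro ⟨G, rfl⟩
    rw [red, map_smul]
    have : (C (q : ℤ)).map (Int.castRingHom (ZMod q)) = 0 := redPoly_eq_zero_iff.mpr dvd_rfl
    rw [this, zero_smul]

/-- The integral elements of the ideal `(κ, w - b)`. -/
noncomputable def idlInt (κ : ℤ[X]) (b : ℚ[X])
    (h : κ.map (Int.castRingHom ℚ) ∣ b ^ 2 + b - X ^ p) : Ideal (HyperRing ℤ p) :=
  (idl (κ.map (Int.castRingHom ℚ)) b h).comap toRat

variable {κ : ℤ[X]} {b : ℚ[X]} {h : κ.map (Int.castRingHom ℚ) ∣ b ^ 2 + b - X ^ p}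

theorem mem_idlInt {F : HyperRing ℤ p} : F ∈ idlInt κ b h ↔ κ.map (Int.castRingHom ℚ) ∣
    F.re.map (Int.castRingHom ℚ) + b * F.im.map (Int.castRingHom ℚ) := Iff.rfl

theorem exists_mul_star_eq_smul_int (hκ : κ.IsPrimitive) {F G : HyperRing ℤ p}
    (hF : F ∈ idlInt κ b h) (hG : G ∈ idlInt κ b h) :
    ∃ P : HyperRing ℤ p, F * star G = κ • P := by
  obtain ⟨P, hP⟩ := exists_mul_star_eq_smul (Ideal.mem_comap.mp hF) (Ideal.mem_comap.mp hG)
  rw [← map_star, ← map_mul] at hP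
  obtain ⟨u, hu⟩ : κ ∣ (F * star G).re :=
    (IsPrimitive.Int.dvd_iff_map_cast_dvd_map_cast _ _ hκ).mpr ⟨_, congrArg QuadraticAlgebra.re hP⟩
  obtain ⟨v, hv⟩ : κ ∣ (F * star G).im :=
    (IsPrimitive.Int.dvd_iff_map_cast_dvd_map_cast _ _ hκ).mpr ⟨_, congrArg QuadraticAlgebra.im hP⟩
  exact ⟨⟨u, v⟩, QuadraticAlgebra.ext hu hv⟩

theorem dvd_norm_int (hκ : κ.IsPrimitive) {F : HyperRing ℤ p} (hF : F ∈ idlInt κ b h) :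
    κ ∣ norm F := by
  obtain ⟨P, hP⟩ := exists_mul_star_eq_smul_int hκ hF hF
  rw [mul_star_self] at hP
  have := congrArg QuadraticAlgebra.re hP
  rw [algebraMap_re, re_smul] at this
  exact ⟨_, this⟩

theorem smul_mem_idlInt (r : ℤ[X]) {F : HyperRing ℤ p} (hF : F ∈ idlInt κ b h) :
    r • F ∈ idlInt κ b h := by
  rw [Algebra.smul_def]
  exact Ideal.mul_mem_left _ _ hF

theorem mem_idlInt_of_C_smul_mem {m : ℤ} (hm : m ≠ 0) {F : HyperRing ℤ p}
    (hF : (C m : ℤ[X]) • F ∈ idlInt κ b h) : F ∈ idlInt κ b h := by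
  rw [mem_idlInt] at hF ⊢
  have hu : IsUnit (C (m : ℚ)) := isUnit_C.mpr (isUnit_iff_ne_zero.mpr (Int.cast_ne_zero.mpr hm))
  rw [← hu.dvd_mul_left]
  convert hF using 1
  have hC : (C m).map (Int.castRingHom ℚ) = C (m : ℚ) := map_C _
  rw [re_smul, im_smul, smul_eq_mul, smul_eq_mul, Polynomial.map_mul, Polynomial.map_mul, hC]
  ring

/-- A pair of elements of the ideal whose reductions form a basis of its reduction. -/
theorem exists_basis_mod (hκ : κ.IsPrimitive) (q : ℕ) [hq : Fact q.Prime] :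
    ∃ G₁ ∈ idlInt κ b h, ∃ G₂ ∈ idlInt κ b h, redPoly q ((G₂ * star G₁).im) ≠ 0 ∧
      ∀ G ∈ idlInt κ b h, ∃ a₁ a₂ : ℤ[X], ∃ H ∈ idlInt κ b h,
        G = a₁ • G₁ + a₂ • G₂ + (C (q : ℤ) : ℤ[X]) • H := by
  set J := idlInt κ b h with hJ
  have hsurj : Function.Surjective (red (p := p) q) :=
    map_surjective (ZMod.ringHom_surjective _)
  set Jq := J.map (red q) with hJq
  have hsmul (r : (ZMod q)[X]) {F : HyperRing (ZMod q) p} (hF : F ∈ Jq) : r • F ∈ Jq := by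
    rw [Algebra.smul_def]
    exact Ideal.mul_mem_left _ _ hF
  have hκJ : algebraMap _ _ κ ∈ J := by
    rw [hJ, mem_idlInt, algebraMap_re, algebraMap_im, Polynomial.map_zero, mul_zero, add_zero]
  have hκq : algebraMap _ _ (redPoly q κ) ∈ Jq := by
    have := Ideal.mem_map_of_mem (red q) hκJ
    convert this using 1
    ext1 <;> simp [map_re, map_im]
  let N₁ : Ideal (ZMod q)[X] := Jq.comap (algebraMap _ _)
  let N₂ : Ideal (ZMod q)[X] :=
    { carrier := {v | ∃ F ∈ Jq, F.im = v}
      zero_mem' := ⟨0, Jq.zero_mem, rfl⟩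
      add_mem' := by
        rintro _ _ ⟨F, hF, rfl⟩ ⟨G, hG, rfl⟩
        exact ⟨F + G, Jq.add_mem hF hG, rfl⟩
      smul_mem' := by
        rintro r _ ⟨F, hF, rfl⟩
        exact ⟨r • F, hsmul r hF, rfl⟩ }
  obtain ⟨h₁, hN₁⟩ := IsPrincipalIdealRing.principal N₁
  obtain ⟨h₂, hN₂⟩ := IsPrincipalIdealRing.principal N₂
  have hm₁ : algebraMap _ _ h₁ ∈ Jq := by
    have : h₁ ∈ N₁ := by rw [hN₁]; exact Submodule.mem_span_singleton_self _
    exact this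
  obtain ⟨F₂, hF₂, hF₂i⟩ : h₂ ∈ N₂ := by rw [hN₂]; exact Submodule.mem_span_singleton_self _
  have hκ0 := redPoly_ne_zero hκ q
  have hh₁ : h₁ ≠ 0 := by
    rintro rfl
    have : redPoly q κ ∈ N₁ := hκq
    rw [hN₁, Submodule.mem_span_singleton] at this
    obtain ⟨a, ha⟩ := this
    exact hκ0 (by rw [← ha, smul_zero])
  have hh₂ : h₂ ≠ 0 := by
    rintro rfl
    have : redPoly q κ ∈ N₂ := by
      refine ⟨_, Ideal.mul_mem_left Jq ⟨0, 1⟩ hκq, ?_⟩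
      simp
    rw [hN₂, Submodule.mem_span_singleton] at this
    obtain ⟨a, ha⟩ := this
    exact hκ0 (by rw [← ha, smul_zero])
  obtain ⟨G₁, hG₁, hG₁'⟩ := (Ideal.mem_map_iff_of_surjective _ hsurj).mp hm₁
  obtain ⟨G₂, hG₂, hG₂'⟩ := (Ideal.mem_map_iff_of_surjective _ hsurj).mp hF₂
  refine ⟨G₁, hG₁, G₂, hG₂, ?_, fun G hG => ?_⟩
  · have : redPoly q ((G₂ * star G₁).im) = (red q G₂ * star (red q G₁)).im := by
      rw [← map_star, ← map_mul]
      rfl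
    rw [this, hG₁', hG₂', mul_star_im, algebraMap_re, algebraMap_im, mul_zero, sub_zero, hF₂i]
    exact mul_ne_zero hh₂ hh₁
  · have hGq := Ideal.mem_map_of_mem (red q) hG
    have h2 : (red q G).im ∈ N₂ := ⟨_, hGq, rfl⟩
    rw [hN₂, Submodule.mem_span_singleton] at h2
    obtain ⟨c₂, hc₂⟩ := h2
    have h1 : (red q G - c₂ • F₂).re ∈ N₁ := by
      have := Jq.sub_mem hGq (hsmul c₂ hF₂)
      change algebraMap _ _ _ ∈ Jq
      convert this using 1
      ext1
      · rfl
      · rw [algebraMap_im, im_sub, im_smul, hF₂i, hc₂, sub_self]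
    rw [hN₁, Submodule.mem_span_singleton] at h1
    obtain ⟨c₁, hc₁⟩ := h1
    obtain ⟨a₁, rfl⟩ := redPoly_surjective q c₁
    obtain ⟨a₂, rfl⟩ := redPoly_surjective q c₂
    have hz : red q (G - (a₁ • G₁ + a₂ • G₂)) = 0 := by
      rw [map_sub, map_add, red, map_smul, map_smul, ← red, hG₁', hG₂']
      ext1
      · have : a₁.map (Int.castRingHom (ZMod q)) * h₁ =
            (red q G).re - a₂.map (Int.castRingHom (ZMod q)) * F₂.re := hc₁
        rw [re_sub, re_add, re_smul, re_smul, algebraMap_re, re_zero]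
        linear_combination (exp := 1) -this
      · have : a₂.map (Int.castRingHom (ZMod q)) * h₂ = (red q G).im := hc₂
        rw [im_sub, im_add, im_smul, im_smul, algebraMap_im, im_zero, hF₂i]
        linear_combination (exp := 1) -this
    obtain ⟨H, hH⟩ := red_eq_zero_iff.mp hz
    refine ⟨a₁, a₂, H, ?_, ?_⟩
    · refine mem_idlInt_of_C_smul_mem (Int.natCast_ne_zero.mpr hq.out.ne_zero) ?_
      rw [← hH]
      exact J.sub_mem hG (J.add_mem (smul_mem_idlInt _ hG₁) (smul_mem_idlInt _ hG₂))
    · rw [← hH]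
      ring

theorem exists_basis_mod_pow {J : Ideal (HyperRing ℤ p)} {q : ℤ[X]} {G₁ G₂ : HyperRing ℤ p}
    (hG : ∀ G ∈ J, ∃ a₁ a₂ : ℤ[X], ∃ H ∈ J, G = a₁ • G₁ + a₂ • G₂ + q • H) (n : ℕ) :
    ∀ G ∈ J, ∃ a₁ a₂ : ℤ[X], ∃ H ∈ J, G = a₁ • G₁ + a₂ • G₂ + q ^ n • H := by
  induction n with
  | zero => exact fun G hG => ⟨0, 0, G, hG, by simp⟩
  | succ n ih =>
    intro G hGJ
    obtain ⟨a₁, a₂, H, hH, rfl⟩ := ih G hGJ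
    obtain ⟨c₁, c₂, H', hH', rfl⟩ := hG H hH
    refine ⟨a₁ + q ^ n * c₁, a₂ + q ^ n * c₂, H', hH', ?_⟩
    rw [smul_add, smul_add, smul_smul, smul_smul, smul_smul, add_smul, add_smul, pow_succ]
    abel

end HyperRing

theorem Ideal.isUnit_of_coprime_int_mem {𝔪 : Ideal ℤ[X]} (h𝔪 : 𝔪 ≠ ⊤) {a b : ℤ} (ha : C a ∈ 𝔪)
    (hb : C b ∈ 𝔪) : ¬ IsCoprime a b := by
  rintro ⟨u, v, huv⟩
  refine h𝔪 ((Ideal.eq_top_iff_one _).mpr ?_)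
  rw [← C_1, ← huv, C_add, C_mul, C_mul]
  exact 𝔪.add_mem (𝔪.mul_mem_left _ ha) (𝔪.mul_mem_left _ hb)

namespace HyperRing

open QuadraticAlgebra

variable {p : ℕ} {κ : ℤ[X]} {b : ℚ[X]} {h : κ.map (Int.castRingHom ℚ) ∣ b ^ 2 + b - X ^ p}

theorem exists_mul_star_im_not_mem (hκ : κ.IsPrimitive) (q : ℕ) [hq : Fact q.Prime]
    (𝔪 : Ideal ℤ[X]) [h𝔪 : 𝔪.IsPrime] (hq𝔪 : C (q : ℤ) ∈ 𝔪) :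
    ∃ G₁ ∈ idlInt κ b h, ∃ G₂ ∈ idlInt κ b h, ∃ P : HyperRing ℤ p,
      G₂ * star G₁ = κ • P ∧ P.im ∉ 𝔪 := by
  obtain ⟨G₁, hG₁, G₂, hG₂, hdet, hspan⟩ := exists_basis_mod (h := h) hκ q
  obtain ⟨P, hP⟩ := exists_mul_star_eq_smul_int hκ hG₂ hG₁
  refine ⟨G₁, hG₁, G₂, hG₂, P, hP, fun hPm => ?_⟩
  have hκ0 : κ ≠ 0 := hκ.ne_zero
  obtain ⟨D, β, hD, hβ⟩ := exists_int_smul_eq_map b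
  have hfin : FiniteMultiplicity (q : ℤ) D :=
    Int.finiteMultiplicity_iff.mpr ⟨by rw [Int.natAbs_natCast]; exact hq.out.ne_one, hD⟩
  obtain ⟨D', hD', hqD'⟩ := hfin.exists_eq_pow_mul_and_not_dvd
  set j := multiplicity (q : ℤ) D
  have hE₁ : (⟨κ, 0⟩ : HyperRing ℤ p) ∈ idlInt κ b h := by
    rw [mem_idlInt, Polynomial.map_zero, mul_zero, add_zero]
  have hE₂ : (⟨-β, C D⟩ : HyperRing ℤ p) ∈ idlInt κ b h := by
    have hC : (C D).map (Int.castRingHom ℚ) = C (D : ℚ) := map_C _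
    rw [mem_idlInt, Polynomial.map_neg, hβ, hC, mul_comm b, neg_add_cancel]
    exact dvd_zero _
  obtain ⟨a₁, a₂, H₁, hH₁, hE₁'⟩ := exists_basis_mod_pow hspan (j + 1) _ hE₁
  obtain ⟨c₁, c₂, H₂, hH₂, hE₂'⟩ := exists_basis_mod_pow hspan (j + 1) _ hE₂
  obtain ⟨P₁, hP₁⟩ := exists_mul_star_eq_smul_int hκ hH₂ hE₁
  have hL : c₁ • G₁ + c₂ • G₂ ∈ idlInt κ b h :=
    Ideal.add_mem _ (smul_mem_idlInt _ hG₁) (smul_mem_idlInt _ hG₂)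
  obtain ⟨P₂, hP₂⟩ := exists_mul_star_eq_smul_int hκ hL hH₁
  have hPi : G₂.im * G₁.re - G₂.re * G₁.im = κ * P.im := by
    rw [← mul_star_im, hP, im_smul, smul_eq_mul]
  have hP₁i := congrArg QuadraticAlgebra.im hP₁
  have hP₂i := congrArg QuadraticAlgebra.im hP₂
  rw [mul_star_im, im_smul, smul_eq_mul] at hP₁i hP₂i
  have e1r := congrArg QuadraticAlgebra.re hE₁'
  have e1i := congrArg QuadraticAlgebra.im hE₁'
  have e2r := congrArg QuadraticAlgebra.re hE₂'
  have e2i := congrArg QuadraticAlgebra.im hE₂'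
  simp only [re_add, im_add, re_smul, im_smul, smul_eq_mul] at e1r e1i e2r e2i hP₁i hP₂i
  have hst : (C D : ℤ[X]) = (c₂ * a₁ - c₁ * a₂) * P.im +
      C (q : ℤ) ^ (j + 1) * (P₁.im + P₂.im) := by
    refine mul_left_cancel₀ hκ0 ?_
    linear_combination (c₂ * a₁ - c₁ * a₂) * hPi + C (q : ℤ) ^ (j + 1) * (hP₁i + hP₂i) +
      κ * e2i + (c₁ * G₁.im + c₂ * G₂.im) * e1r - (c₁ * G₁.re + c₂ * G₂.re) * e1i
  have hqp : Prime (C (q : ℤ) : ℤ[X]) := Polynomial.prime_C_iff.mpr (Nat.prime_iff_prime_int.mp hq.out)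
  have hPq : ¬ C (q : ℤ) ∣ P.im := by
    intro hd
    refine hdet ?_
    rw [redPoly_eq_zero_iff, mul_star_im, hPi]
    exact hd.mul_left _
  rw [hD', Polynomial.C_mul, Polynomial.C_pow] at hst
  obtain ⟨t, ht⟩ : C (q : ℤ) ^ j ∣ c₂ * a₁ - c₁ * a₂ := by
    refine hqp.pow_dvd_of_dvd_mul_left (a := P.im) j hPq ?_
    refine ⟨C D' - C (q : ℤ) * (P₁.im + P₂.im), ?_⟩
    linear_combination -hst
  rw [ht] at hst
  have hfin : C D' = t * P.im + C (q : ℤ) * (P₁.im + P₂.im) := by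
    refine mul_left_cancel₀ (pow_ne_zero j hqp.ne_zero) ?_
    linear_combination hst
  have hD'm : C D' ∈ 𝔪 := by
    rw [hfin]
    exact 𝔪.add_mem (𝔪.mul_mem_left _ hPm) (𝔪.mul_mem_right _ hq𝔪)
  refine Ideal.isUnit_of_coprime_int_mem h𝔪.ne_top hq𝔪 hD'm ?_
  exact (Nat.prime_iff_prime_int.mp hq.out).coprime_iff_not_dvd.mpr hqD'

theorem four_mul_norm (F : HyperRing ℤ p) :
    4 * norm F = (2 * F.re - F.im) ^ 2 - (4 * X ^ p + 1) * F.im ^ 2 := by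
  rw [norm_apply]
  ring

theorem sq_dvd_two_pow_sub_one {p : ℕ} (hp : p.Prime) (hp2 : p ≠ 2)
    (h : (p : ℤ) ^ 2 ∣ 4 ^ (p - 1) - 1) : p ^ 2 ∣ 2 ^ (p - 1) - 1 := by
  have : Fact p.Prime := ⟨hp⟩
  have hpz := Nat.prime_iff_prime_int.mp hp
  have h2 : (p : ℤ) ∣ 2 ^ (p - 1) - 1 := by
    rw [← ZMod.intCast_zmod_eq_zero_iff_dvd]
    push_cast
    rw [ZMod.pow_card_sub_one_eq_one, sub_self]
    intro h0
    have : ((2 : ℕ) : ZMod p) = 0 := h0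
    rw [ZMod.natCast_eq_zero_iff, Nat.prime_dvd_prime_iff_eq hp Nat.prime_two] at this
    exact hp2 this
  have h3 : ¬ (p : ℤ) ∣ 2 ^ (p - 1) + 1 := by
    intro h3
    have : (p : ℤ) ∣ 2 := by
      have h4 := dvd_sub h3 h2
      rwa [show (2 : ℤ) ^ (p - 1) + 1 - (2 ^ (p - 1) - 1) = 2 by ring] at h4
    have := Int.natCast_dvd_natCast.mp this
    rw [Nat.prime_dvd_prime_iff_eq hp Nat.prime_two] at this
    exact hp2 this
  have h4 : (p : ℤ) ^ 2 ∣ (2 ^ (p - 1) + 1) * (2 ^ (p - 1) - 1) := by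
    convert h using 1
    rw [show (4 : ℤ) = 2 ^ 2 by norm_num, ← pow_mul, mul_comm 2, pow_mul]
    ring
  have h5 := hpz.pow_dvd_of_dvd_mul_left 2 h3 h4
  have h6 : 1 ≤ 2 ^ (p - 1) := Nat.one_le_two_pow
  zify [h6]
  exact h5

/-- At an odd prime, the values of the form `norm G / κ` on the ideal generate the unit ideal. -/
theorem exists_norm_eq_mul_not_mem (hκ : κ.IsPrimitive) (hp : p.Prime) (hp2 : p ≠ 2)
    (h1 : ¬ p ^ 2 ∣ 2 ^ (p - 1) - 1) (q : ℕ) [hq : Fact q.Prime] (hq2 : q ≠ 2)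
    (𝔪 : Ideal ℤ[X]) [h𝔪 : 𝔪.IsPrime] (hq𝔪 : C (q : ℤ) ∈ 𝔪) (hf : 4 * X ^ p + 1 ∈ 𝔪) :
    ∃ G ∈ idlInt κ b h, ∃ c, norm G = κ * c ∧ c ∉ 𝔪 := by
  by_contra! hcon
  obtain ⟨G₁, hG₁, G₂, hG₂, P, hP, hPm⟩ :=
    exists_mul_star_im_not_mem (h := h) hκ q 𝔪 hq𝔪
  have hκ0 : κ ≠ 0 := hκ.ne_zero
  obtain ⟨c₁, hc₁⟩ := dvd_norm_int hκ hG₁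
  obtain ⟨c₂, hc₂⟩ := dvd_norm_int hκ hG₂
  obtain ⟨c₃, hc₃⟩ := dvd_norm_int hκ (Ideal.add_mem _ hG₁ hG₂)
  have hm₁ := hcon _ hG₁ _ hc₁
  have hm₂ := hcon _ hG₂ _ hc₂
  have hm₃ := hcon _ (Ideal.add_mem _ hG₁ hG₂) _ hc₃
  have htr : 2 * P.re - P.im = c₃ - c₁ - c₂ := by
    refine mul_left_cancel₀ hκ0 ?_
    have hre := congrArg QuadraticAlgebra.re hP
    have him := congrArg QuadraticAlgebra.im hP
    rw [mul_star_re, re_smul, smul_eq_mul] at hre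
    rw [mul_star_im, im_smul, smul_eq_mul] at him
    rw [norm_apply] at hc₁ hc₂ hc₃
    rw [re_add, im_add] at hc₃
    linear_combination -2 * hre + him + hc₃ - hc₁ - hc₂
  have hnP : norm P = c₁ * c₂ := by
    refine mul_left_cancel₀ (pow_ne_zero 2 hκ0) ?_
    rw [← norm_smul, ← hP, map_mul, QuadraticAlgebra.norm_star, hc₁, hc₂]
    ring
  have hB : c₃ - c₁ - c₂ ∈ 𝔪 := 𝔪.sub_mem (𝔪.sub_mem hm₃ hm₁) hm₂
  set B := c₃ - c₁ - c₂ with hBdef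
  have hmain : (4 * X ^ p + 1) * P.im ^ 2 = B ^ 2 - 4 * (c₁ * c₂) := by
    rw [← hnP, four_mul_norm, htr]
    ring
  have hder := congrArg derivative hmain
  simp only [derivative_mul, derivative_pow, derivative_add, derivative_sub, derivative_one,
    derivative_X, derivative_ofNat, Nat.cast_ofNat, Nat.add_one_sub_one, pow_one, mul_one,
    zero_mul, zero_add, add_zero] at hder
  have h4 : (4 : ℤ[X]) ∉ 𝔪 := by
    intro h4
    refine Ideal.isUnit_of_coprime_int_mem h𝔪.ne_top hq𝔪 (b := 4) h4 ?_
    refine (Nat.prime_iff_prime_int.mp hq.out).coprime_iff_not_dvd.mpr fun h4 => ?_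
    have h5 := hq.out.dvd_of_dvd_pow (n := 2) (Int.natCast_dvd_natCast (n := 2 ^ 2).mp h4)
    exact hq2 ((Nat.prime_dvd_prime_iff_eq hq.out Nat.prime_two).mp h5)
  have hX : (X : ℤ[X]) ∉ 𝔪 := by
    intro hX
    refine h𝔪.ne_top ((Ideal.eq_top_iff_one _).mpr ?_)
    have : (1 : ℤ[X]) = (4 * X ^ p + 1) - 4 * X ^ (p - 1) * X := by
      rw [mul_assoc, ← pow_succ, Nat.sub_add_cancel hp.one_le]
      ring
    rw [this]
    exact 𝔪.sub_mem hf (𝔪.mul_mem_left _ hX)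
  have hpm : C (p : ℤ) ∈ 𝔪 := by
    have : 4 * (C (p : ℤ) * X ^ (p - 1)) * P.im ^ 2 ∈ 𝔪 := by
      have e : 4 * (C (p : ℤ) * X ^ (p - 1)) * P.im ^ 2 = (2 * derivative B) * B
          - (4 * derivative c₂) * c₁ - (4 * derivative c₁) * c₂ -
          (2 * P.im * derivative P.im) * (4 * X ^ p + 1) := by
        have hC2 : (C 2 : ℤ[X]) = 2 := rfl
        rw [hC2] at hder
        linear_combination hder
      rw [e]
      exact 𝔪.sub_mem (𝔪.sub_mem (𝔪.sub_mem (𝔪.mul_mem_left _ hB) (𝔪.mul_mem_left _ hm₁))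
        (𝔪.mul_mem_left _ hm₂)) (𝔪.mul_mem_left _ hf)
    rcases h𝔪.mem_or_mem this with h5 | h5
    · rcases h𝔪.mem_or_mem h5 with h5 | h5
      · exact absurd h5 h4
      · rcases h𝔪.mem_or_mem h5 with h5 | h5
        · exact h5
        · exact absurd (h𝔪.mem_of_pow_mem _ h5) hX
    · exact absurd (h𝔪.mem_of_pow_mem _ h5) hPm
  have : Fact p.Prime := ⟨hp⟩
  have hpz := Nat.prime_iff_prime_int.mp hp
  obtain ⟨a, m, ham⟩ : ∃ a m : ℤ, 4 * a = (p : ℤ) ^ 2 * m - 1 := by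
    have : IsCoprime (4 : ℤ) ((p : ℤ) ^ 2) := by
      have h2 : IsCoprime (2 : ℤ) p := by
        have := (Nat.coprime_primes Nat.prime_two hp).mpr (Ne.symm hp2)
        exact_mod_cast Nat.isCoprime_iff_coprime.mpr this
      have := (h2.pow (m := 2) (n := 2))
      norm_num at this
      exact this
    obtain ⟨u, v, huv⟩ := this
    exact ⟨-u, v, by linear_combination -huv⟩
  have h4p : (C (p : ℤ) : ℤ[X]) ∣ (4 * X + 1) ^ p - (4 * X ^ p + 1) := by
    rw [show (C (p : ℤ) : ℤ[X]) = C ((p : ℕ) : ℤ) from rfl, ← redPoly_eq_zero_iff, map_sub, map_pow,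
      map_add, add_pow_char, map_add, map_mul, mul_pow, map_mul, map_pow, ← map_pow _ (4 : ℤ[X])]
    have : redPoly p ((4 : ℤ[X]) ^ p) = redPoly p 4 := by
      rw [map_pow, map_ofNat, ← Polynomial.C_ofNat, ← Polynomial.C_pow, ZMod.pow_card]
    rw [this, map_one, one_pow, sub_self]
  have hXa : X - C a ∈ 𝔪 := by
    have h41 : 4 * X + 1 ∈ 𝔪 := by
      refine h𝔪.mem_of_pow_mem p ?_
      obtain ⟨r, hr⟩ := h4p
      rw [show ((4 : ℤ[X]) * X + 1) ^ p = C (p : ℤ) * r + (4 * X ^ p + 1) by rw [← hr]; ring]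
      exact 𝔪.add_mem (𝔪.mul_mem_right _ hpm) hf
    have : 4 * (X - C a) ∈ 𝔪 := by
      have e : 4 * (X - C a) = 4 * X + 1 - C ((p : ℤ) * m) * C (p : ℤ) := by
        have := congrArg (C : ℤ → ℤ[X]) ham
        simp only [Polynomial.C_mul, Polynomial.C_pow, Polynomial.C_sub] at this ⊢
        have h4C : (C 4 : ℤ[X]) = 4 := rfl
        rw [h4C, Polynomial.C_1] at this
        linear_combination -this
      rw [e]
      exact 𝔪.sub_mem h41 (𝔪.mul_mem_left _ hpm)
    exact (h𝔪.mem_or_mem this).resolve_left h4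
  have hev {r : ℤ[X]} : r ∈ 𝔪 ↔ (p : ℤ) ∣ r.eval a := by
    obtain ⟨s, hs⟩ := X_sub_C_dvd_sub_C_eval (a := a) (p := r)
    have hsm : r - C (r.eval a) ∈ 𝔪 := by
      rw [hs]
      exact 𝔪.mul_mem_right _ hXa
    constructor
    · intro hr
      by_contra hd
      have : C (r.eval a) ∈ 𝔪 := by
        have := 𝔪.sub_mem hr hsm
        rwa [sub_sub_cancel] at this
      exact Ideal.isUnit_of_coprime_int_mem h𝔪.ne_top hpm this (hpz.coprime_iff_not_dvd.mpr hd)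
    · rintro ⟨t, ht⟩
      rw [ht, Polynomial.C_mul] at hsm
      have := 𝔪.add_mem hsm (𝔪.mul_mem_right (C t) hpm)
      rwa [sub_add_cancel] at this
  have hmev := congrArg (Polynomial.eval a) hmain
  simp only [eval_mul, eval_add, eval_sub, eval_pow, eval_X, eval_ofNat, eval_one] at hmev
  have hd : (p : ℤ) ^ 2 ∣ (P.im.eval a) ^ 2 * (4 * a ^ p + 1) := by
    rw [mul_comm, hmev]
    obtain ⟨x, hx⟩ := hev.mp hB
    obtain ⟨y, hy⟩ := hev.mp hm₁
    obtain ⟨z, hz⟩ := hev.mp hm₂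
    rw [hx, hy, hz]
    exact ⟨x ^ 2 - 4 * y * z, by ring⟩
  have hd' := hpz.pow_dvd_of_dvd_mul_left 2 (fun hd => hPm (hev.mpr (hpz.dvd_of_dvd_pow hd))) hd
  refine h1 (sq_dvd_two_pow_sub_one hp hp2 ?_)
  have hodd := hp.odd_of_ne_two hp2
  have e1 : (p : ℤ) ^ 2 ∣ (4 * a) ^ p - (-1) ^ p :=
    dvd_trans ⟨m, by rw [ham]; ring⟩ (sub_dvd_pow_sub_pow (4 * a) (-1) p)
  have e2 : (4 : ℤ) ^ (p - 1) - 1 = 4 ^ (p - 1) * (4 * a ^ p + 1) - ((4 * a) ^ p - (-1) ^ p) := by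
    obtain ⟨r, hr⟩ := Nat.exists_eq_add_of_le' hp.one_le
    rw [hodd.neg_one_pow, hr, Nat.add_sub_cancel]
    ring
  rw [e2]
  exact dvd_sub (hd'.mul_left _) e1

end HyperRing

theorem exists_eq_add_two_mul_of_redPoly_eq {r s : ℤ[X]} (h : redPoly 2 r = redPoly 2 s) :
    ∃ t, r = s + 2 * t := by
  obtain ⟨t, ht⟩ := two_dvd_iff_redPoly.mpr (by rw [map_sub, h, sub_self] : redPoly 2 (r - s) = 0)
  exact ⟨t, by rw [← ht]; ring⟩

/-- The data carried along the descent: a class `κ` on the curve `w² + w = x ^ (2 * g + 1)`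
together with two integral elements whose reductions modulo `2` are controlled. -/
structure DescentDatum (g n : ℕ) where
  κ : ℤ[X]
  b : ℚ[X]
  prim : κ.IsPrimitive
  natDegree_κ : κ.natDegree ≤ g
  dvd : κ.map (Int.castRingHom ℚ) ∣ b ^ 2 + b - X ^ (2 * g + 1)
  G₀ : HyperRing ℤ (2 * g + 1)
  G₁ : HyperRing ℤ (2 * g + 1)
  mem₀ : G₀ ∈ HyperRing.idlInt κ b dvd
  mem₁ : G₁ ∈ HyperRing.idlInt κ b dvd
  A₀ : ℤ[X]
  A₁ : ℤ[X]
  norm₀ : QuadraticAlgebra.norm G₀ = κ * A₀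
  norm₁ : QuadraticAlgebra.norm G₁ = κ * A₁
  natDegree₀ : A₀.natDegree ≤ 2 * g
  natDegree₁ : A₁.natDegree ≤ 2 * g
  Ψ : HyperRing ℤ (2 * g + 1)
  mul_star : G₁ * star G₀ = κ • Ψ
  red₀ : redPoly 2 A₀ = 1
  red₁ : redPoly 2 A₁ = X ^ (2 * g)
  red_re : redPoly 2 Ψ.re = X ^ g
  v : ℤ[X]
  im_eq : Ψ.im = 2 ^ n * v
  red_v : redPoly 2 v = 1

namespace DescentDatum

open QuadraticAlgebra HyperRing

variable {g n : ℕ} (D : DescentDatum g n)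

theorem norm_Ψ : norm D.Ψ = D.A₀ * D.A₁ := by
  refine mul_left_cancel₀ (pow_ne_zero 2 D.prim.ne_zero) ?_
  rw [← HyperRing.norm_smul, ← D.mul_star, map_mul, QuadraticAlgebra.norm_star, D.norm₀, D.norm₁]
  ring

theorem exists_odd_coeff (D : DescentDatum g n) : ∃ a : ℤ[X], D.A₁ = X ^ (2 * g) + 2 * a :=
  exists_eq_add_two_mul_of_redPoly_eq (by rw [D.red₁, map_pow, coe_mapRingHom, map_X])

theorem odd_leading : Odd (D.A₁.coeff (2 * g)) := by
  obtain ⟨a, ha⟩ := D.exists_odd_coeff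
  have h2 : (2 : ℤ[X]) * a = C 2 * a := rfl
  rw [ha, coeff_add, coeff_X_pow_self, h2, coeff_C_mul]
  exact ⟨_, add_comm _ _⟩

theorem four_dvd_coeff (hn : 1 ≤ n) {i : ℕ} (hi : i < 2 * g) :
    (4 : ℤ) ∣ D.A₁.coeff i - if i = g then 2 ^ n else 0 := by
  obtain ⟨d, hd⟩ := D.exists_odd_coeff
  obtain ⟨a, ha⟩ := exists_eq_add_two_mul_of_redPoly_eq (s := 1) (D.red₀.trans (map_one _).symm)
  obtain ⟨u, hu⟩ := exists_eq_add_two_mul_of_redPoly_eq (s := X ^ g)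
    (D.red_re.trans (by rw [map_pow, coe_mapRingHom, map_X]))
  obtain ⟨v, hv⟩ := exists_eq_add_two_mul_of_redPoly_eq (s := 1) (D.red_v.trans (map_one _).symm)
  obtain ⟨m, rfl⟩ := Nat.exists_eq_add_of_le' hn
  have hN := D.norm_Ψ
  rw [norm_apply, D.im_eq] at hN
  have hkey : a * X ^ (2 * g) + d + 2 * (a * d) = 2 * (X ^ g * u + u ^ 2) -
      2 ^ m * (D.Ψ.re * D.v) - 2 * (4 ^ m * X ^ (2 * g + 1) * D.v ^ 2) := by
    refine mul_left_cancel₀ (two_ne_zero (α := ℤ[X])) ?_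
    have h4 : (4 : ℤ[X]) ^ m = 2 ^ m * 2 ^ m := by rw [← mul_pow]; norm_num
    rw [h4]
    have hN' : (1 + 2 * a) * (X ^ (2 * g) + 2 * d) = (X ^ g + 2 * u) ^ 2 -
        D.Ψ.re * (2 ^ (m + 1) * D.v) - X ^ (2 * g + 1) * (2 ^ (m + 1) * D.v) ^ 2 := by
      rw [← ha, ← hd, ← hu]
      exact hN.symm
    linear_combination hN'
  have h := congrArg (redPoly 2) hkey
  simp only [map_add, map_sub, map_mul, redPoly_two_two, zero_mul, add_zero, sub_zero, zero_sub,
    D.red_re, D.red_v, mul_one] at h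
  have hXr (j : ℕ) : redPoly 2 (X ^ j) = X ^ j := by rw [map_pow, coe_mapRingHom, map_X]
  have hdi : redPoly 2 (d + 2 ^ m * X ^ g) = - (X ^ (2 * g) * redPoly 2 a) := by
    rw [map_add, map_mul, hXr]
    rw [hXr] at h
    linear_combination h
  have hc := congrArg (fun r => coeff r i) hdi
  simp only [coeff_neg, coeff_X_pow_mul', if_neg (not_le.mpr hi), neg_zero] at hc
  rw [coe_mapRingHom, coeff_map, eq_intCast, ZMod.intCast_zmod_eq_zero_iff_dvd] at hc
  have h2m : (2 : ℤ[X]) ^ m * X ^ g = C (2 ^ m) * X ^ g := by rw [Polynomial.C_pow]; rfl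
  rw [h2m, coeff_add, coeff_C_mul_X_pow] at hc
  have h2 : (2 : ℤ[X]) * d = C 2 * d := rfl
  rw [hd, coeff_add, coeff_X_pow, if_neg hi.ne, h2, coeff_C_mul, zero_add, pow_succ]
  obtain ⟨t, ht⟩ := hc
  have ht' : d.coeff i = 2 * t - if i = g then 2 ^ m else 0 := by
    rw [← eq_sub_iff_add_eq] at ht
    exact ht
  rw [ht']
  split_ifs
  · exact ⟨t - 2 ^ m, by ring⟩
  · exact ⟨t, by ring⟩

theorem reflect_eq (hg : 0 < g) (hn : 1 ≤ n) :
    ∃ c : ℤ, Odd c ∧ ∃ P : ℤ[X], reflect (2 * g) D.A₁ =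
      C c * (1 + C (if n = 1 then 2 * (-1) ^ g else 0) * X ^ g) + 4 * (X * P) := by
  set c := D.A₁.coeff (2 * g) with hc
  refine ⟨c, D.odd_leading, ?_⟩
  set δ : ℤ := if n = 1 then 2 * (-1) ^ g else 0 with hδ
  set R := reflect (2 * g) D.A₁ - C c * (1 + C δ * X ^ g) with hR
  have hcoef (i : ℕ) : R.coeff i = D.A₁.coeff (revAt (2 * g) i) -
      c * ((if i = 0 then 1 else 0) + if i = g then δ else 0) := by
    rw [hR, coeff_sub, coeff_reflect, coeff_C_mul, coeff_add, coeff_one, coeff_C_mul_X_pow]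
  have h0 : R.coeff 0 = 0 := by
    rw [hcoef, revAt_le (Nat.zero_le _), Nat.sub_zero, if_pos rfl, if_neg hg.ne, add_zero, mul_one,
      hc, sub_self]
  have h4 : C (4 : ℤ) ∣ R := by
    rw [C_dvd_iff_dvd_coeff]
    intro i
    rcases Nat.eq_zero_or_pos i with rfl | hi
    · rw [h0]
      exact dvd_zero _
    rw [hcoef, if_neg hi.ne', zero_add]
    rcases le_or_gt i (2 * g) with hi2 | hi2
    · rw [revAt_le hi2]
      have h := D.four_dvd_coeff hn (i := 2 * g - i) (by lia)
      have hiff : (2 * g - i = g) ↔ i = g := by lia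
      simp only [hiff] at h
      split_ifs at h ⊢ with hig
      · have e : (4 : ℤ) ∣ 2 ^ n - c * δ := by
          rw [hδ]
          split_ifs with hn1
          · have ho : Odd (c * (-1) ^ g) := D.odd_leading.mul (Odd.pow ⟨-1, rfl⟩)
            obtain ⟨j, hj⟩ := ho
            rw [hn1]
            exact ⟨-j, by linear_combination -2 * hj⟩
          · rw [mul_zero, sub_zero]
            obtain ⟨j, rfl⟩ : ∃ j, n = j + 2 := ⟨n - 2, by lia⟩
            exact ⟨2 ^ j, by ring⟩
        have := dvd_add h e
        rwa [sub_add_sub_cancel] at this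
      · rwa [mul_zero]
    · rw [revAt_eq_self_of_lt hi2, if_neg (by lia), mul_zero, sub_zero,
        coeff_eq_zero_of_natDegree_lt (D.natDegree₁.trans_lt hi2)]
      exact dvd_zero _
  obtain ⟨S, hS⟩ := h4
  have hS0 : S.coeff 0 = 0 := by
    rw [hS, coeff_C_mul] at h0
    exact (mul_eq_zero.mp h0).resolve_left (by norm_num)
  obtain ⟨P, hP⟩ := X_dvd_iff.mpr hS0
  refine ⟨P, ?_⟩
  rw [← hP]
  have : (4 : ℤ[X]) * S = C 4 * S := rfl
  rw [this, ← hS, hR]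
  ring

end DescentDatum

theorem Polynomial.aeval_reflect_mul_pow {R K : Type*} [CommRing R] [Field K] [Algebra R K]
    {μ θ : K} (h : μ * θ = 1) {N : ℕ} {f : R[X]} (hf : f.natDegree ≤ N) :
    aeval μ (reflect N f) * θ ^ N = aeval θ f := by
  have hθ : θ ≠ 0 := right_ne_zero_of_mul_eq_one h
  let _ : Invertible θ := invertibleOfNonzero hθ
  have := eval₂_reflect_mul_pow (algebraMap R K) θ N f hf
  rwa [invOf_eq_inv, ← eq_inv_of_mul_eq_one_left h] at this

section Field

variable {K : Type*} [Field K] {α : K} {p : ℕ}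

theorem neg_sq_mul_neg_inv_sq (hα : α ≠ 0) : -α ^ 2 * -(α ^ 2)⁻¹ = 1 := by
  rw [neg_mul_neg, mul_inv_cancel₀ (pow_ne_zero 2 hα)]

theorem four_mul_neg_inv_sq_pow (hp : Odd p) (hα : α ^ p = 2) (h2 : (2 : K) ≠ 0) :
    4 * (-(α ^ 2)⁻¹) ^ p = -1 := by
  rw [hp.neg_pow, inv_pow, pow_right_comm, hα]
  have : (4 : K) = 2 ^ 2 := by norm_num
  rw [this, mul_neg, mul_inv_cancel₀ (pow_ne_zero 2 h2)]

theorem ne_zero_of_pow_eq_two (hp : p ≠ 0) (hα : α ^ p = 2) (h2 : (2 : K) ≠ 0) : α ≠ 0 := by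
  rintro rfl
  rw [zero_pow hp] at hα
  exact h2 hα.symm

end Field

theorem Rat.irreducible_X_pow_sub_neg_quarter {p : ℕ} (hp : p.Prime) (hp2 : p ≠ 2) :
    Irreducible (X ^ p - C (-4⁻¹) : ℚ[X]) := by
  refine X_pow_sub_C_irreducible_of_prime hp fun b hb => ?_
  have hodd := hp.odd_of_ne_two hp2
  obtain ⟨j, hj⟩ := hodd
  have hb0 : b ≠ 0 := by
    rintro rfl
    rw [zero_pow hp.ne_zero] at hb
    norm_num at hb
  refine Padic.pow_ne_two hp.ne_one (((-b⁻¹) ^ (j + 1) / 2 : ℚ) : ℚ_[2]) ?_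
  have : ((-b⁻¹) ^ (j + 1) / 2) ^ p = (2 : ℚ) := by
    rw [div_pow, ← pow_mul, mul_comm, pow_mul, (hp.odd_of_ne_two hp2).neg_pow, inv_pow, hb]
    have e : (2 : ℚ) ^ p = 2 * 4 ^ j := by
      rw [hj, pow_succ, pow_mul]; norm_num; ring
    rw [e]
    norm_num
    rw [pow_succ]
    field_simp
    norm_num
  exact_mod_cast congrArg (Rat.cast (K := ℚ_[2])) this

section NumberField

variable {L : Type*} [Field L] [NumberField L] {α : L} {p : ℕ}

theorem aeval_neg_inv_sq_ne_zero (hp : p.Prime) (hp2 : p ≠ 2) (hα : α ^ p = 2) {q : ℚ[X]}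
    (hq : q ≠ 0) (hqd : q.natDegree < p) : aeval (-(α ^ 2)⁻¹) q ≠ 0 := by
  intro h
  refine hq (eq_zero_of_aeval_eq_zero_of_degree_lt hp.ne_zero
    (Rat.irreducible_X_pow_sub_neg_quarter hp hp2) ?_ (natDegree_lt_iff_degree_lt hq |>.mp hqd) h)
  have := four_mul_neg_inv_sq_pow (hp.odd_of_ne_two hp2) hα two_ne_zero
  rw [map_neg, map_inv₀, map_ofNat]
  field_simp
  linear_combination this

open QuadraticAlgebra HyperRing in
/-- The elements `Aᵢ` attached to `κ` become squares locally away from `2`. -/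
theorem HyperRing.exists_locally_sq {κ : ℤ[X]} {b : ℚ[X]}
    {h : κ.map (Int.castRingHom ℚ) ∣ b ^ 2 + b - X ^ p} (hκ : κ.IsPrimitive) (hκd : κ.natDegree < p)
    (hp : p.Prime) (hp2 : p ≠ 2) (h1 : ¬ p ^ 2 ∣ 2 ^ (p - 1) - 1) {a : 𝓞 L} (ha : a ^ p = 2)
    {G : HyperRing ℤ p} {A : ℤ[X]} (hA : QuadraticAlgebra.norm G = κ * A)
    {g : ℕ} (hAd : A.natDegree ≤ 2 * g) {𝔮 : Ideal (𝓞 L)} (h𝔮 : 𝔮.IsPrime) (h𝔮0 : 𝔮 ≠ ⊥)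
    (h2 : (2 : 𝓞 L) ∉ 𝔮) :
    ∃ c x y : 𝓞 L, c ∉ 𝔮 ∧ x ≠ 0 ∧ aeval (-a ^ 2) (reflect (2 * g) A) * c * x ^ 2 = y ^ 2 := by
  have hodd := hp.odd_of_ne_two hp2
  set K' := FractionRing (𝓞 L ⧸ 𝔮)
  set φ : 𝓞 L →+* K' := (algebraMap (𝓞 L ⧸ 𝔮) K').comp (Ideal.Quotient.mk 𝔮) with hφ
  have hker {z : 𝓞 L} : φ z = 0 ↔ z ∈ 𝔮 := by
    rw [hφ, RingHom.comp_apply, IsFractionRing.to_map_eq_zero_iff, Ideal.Quotient.eq_zero_iff_mem]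
  have h2' : (2 : K') ≠ 0 := by
    rw [← map_ofNat φ 2, Ne, hker]
    exact h2
  have ha' : φ a ^ p = 2 := by rw [← map_pow, ha, map_ofNat]
  have ha0 : φ a ≠ 0 := ne_zero_of_pow_eq_two hp.ne_zero ha' h2'
  set θ' : K' := -(φ a ^ 2)⁻¹ with hθ'
  obtain ⟨q, hq⟩ := CharP.exists K'
  have hq0 : q ≠ 0 := by
    rintro rfl
    have h0 : CharZero K' := CharP.charP_to_charZero K'
    have h3 : φ (Ideal.absNorm 𝔮 : 𝓞 L) = 0 := hker.mpr (Ideal.absNorm_mem 𝔮)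
    rw [map_natCast, Nat.cast_eq_zero, Ideal.absNorm_eq_zero_iff] at h3
    exact h𝔮0 h3
  have hqp : Fact q.Prime := ⟨(CharP.char_is_prime_or_zero K' q).resolve_right hq0⟩
  have hq2 : q ≠ 2 := by
    rintro rfl
    exact h2' (CharP.cast_eq_zero K' 2)
  set 𝔪 : Ideal ℤ[X] := RingHom.ker (aeval θ' : ℤ[X] →ₐ[ℤ] K') with h𝔪
  have h𝔪p : 𝔪.IsPrime := RingHom.ker_isPrime _
  have hq𝔪 : C (q : ℤ) ∈ 𝔪 := by
    rw [h𝔪, RingHom.mem_ker, aeval_C, eq_intCast, Int.cast_natCast, CharP.cast_eq_zero]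
  have hf : 4 * X ^ p + 1 ∈ 𝔪 := by
    rw [h𝔪, RingHom.mem_ker]
    simp only [map_add, map_mul, map_pow, aeval_X, map_one, map_ofNat]
    rw [four_mul_neg_inv_sq_pow hodd ha' h2', neg_add_cancel]
  obtain ⟨H, hH, c, hc, hcm⟩ := exists_norm_eq_mul_not_mem (h := h) hκ hp hp2 h1 q hq2 𝔪 hq𝔪 hf
  set α : L := algebraMap (𝓞 L) L a with hα
  have hαp : α ^ p = 2 := by rw [hα, ← map_pow, ha, map_ofNat]
  have hα0 := ne_zero_of_pow_eq_two hp.ne_zero hαp two_ne_zero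
  set θ : L := -(α ^ 2)⁻¹ with hθ
  set m := c.natDegree with hm
  have hcd : c.natDegree ≤ 2 * m := by lia
  have hκθ : aeval θ κ ≠ 0 := by
    have : aeval θ κ = aeval θ (κ.map (Int.castRingHom ℚ)) := by
      rw [← algebraMap_int_eq, aeval_map_algebraMap]
    rw [this]
    refine aeval_neg_inv_sq_ne_zero hp hp2 hαp ?_ (natDegree_map_le.trans_lt hκd)
    rw [Ne, Polynomial.map_eq_zero_iff (RingHom.injective_int _)]
    exact hκ.ne_zero
  have hμ : -α ^ 2 * θ = 1 := neg_sq_mul_neg_inv_sq hα0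
  have hθ0 : θ ≠ 0 := right_ne_zero_of_mul_eq_one hμ
  have hmap (r : ℤ[X]) : algebraMap (𝓞 L) L (aeval (-a ^ 2) r) = aeval (-α ^ 2) r := by
    rw [← aeval_algebraMap_apply, map_neg, map_pow]
  have hmap' (r : ℤ[X]) : φ (aeval (-a ^ 2) r) = aeval (-φ a ^ 2) r := by
    rw [aeval_def, aeval_def, hom_eval₂, map_neg, map_pow]
    congr 1
  have hθ4 := four_mul_neg_inv_sq_pow hodd hαp two_ne_zero
  set ev := evalHalf (k := ℤ) θ two_ne_zero hθ4
  have hG2 : ev G ^ 2 = aeval θ κ * aeval θ A := by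
    rw [evalHalf_sq, hA, map_mul]
  have hH2 : ev H ^ 2 = aeval θ κ * aeval θ c := by
    rw [evalHalf_sq, hc, map_mul]
  obtain ⟨x₁, d₁, -, hx⟩ := IsFractionRing.div_surjective (𝓞 L) (aeval θ κ * θ ^ (m + g))
  obtain ⟨y₁, d₂, hd₂, hy⟩ := IsFractionRing.div_surjective (𝓞 L) (ev G * ev H)
  have hd₁ : algebraMap (𝓞 L) L d₁ ≠ 0 := by
    intro h0
    rw [h0, div_zero] at hx
    exact mul_ne_zero hκθ (pow_ne_zero _ hθ0) hx.symm
  have hd₂' : algebraMap (𝓞 L) L d₂ ≠ 0 := by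
    rw [Ne, IsFractionRing.to_map_eq_zero_iff]
    exact nonZeroDivisors.ne_zero hd₂
  have hx1 : x₁ ≠ 0 := by
    rintro rfl
    rw [map_zero, zero_div] at hx
    exact mul_ne_zero hκθ (pow_ne_zero _ hθ0) hx.symm
  refine ⟨aeval (-a ^ 2) (reflect (2 * m) c), x₁ * d₂, y₁ * d₁, ?_,
    mul_ne_zero hx1 (nonZeroDivisors.ne_zero hd₂), ?_⟩
  · rw [← hker, hmap']
    intro h0
    refine hcm ?_
    rw [h𝔪, RingHom.mem_ker, ← aeval_reflect_mul_pow (neg_sq_mul_neg_inv_sq ha0) hcd, h0, zero_mul]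
  · apply IsFractionRing.injective (𝓞 L) L
    have hcθ := aeval_reflect_mul_pow hμ hcd
    have hAθ := aeval_reflect_mul_pow hμ hAd
    rw [div_eq_iff hd₁] at hx
    rw [div_eq_iff hd₂'] at hy
    simp only [map_mul, map_pow, hmap, hx, hy]
    rw [← hcθ] at hH2
    rw [← hAθ] at hG2
    linear_combination (-(algebraMap (𝓞 L) L d₁) ^ 2 * (algebraMap (𝓞 L) L d₂) ^ 2) * (
      ev H ^ 2 * hG2 + (aeval θ κ * (aeval (-α ^ 2) (reflect (2 * g) A) * θ ^ (2 * g))) * hH2)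

end NumberField

namespace DescentDatum

open HyperRing

variable {g n : ℕ} (D : DescentDatum g n) {L : Type*} [Field L] [NumberField L]

theorem aeval_ne_zero {α : L} (hp : (2 * g + 1).Prime)
    (hα : α ^ (2 * g + 1) = 2) :
    aeval (-(α ^ 2)⁻¹) D.A₁ ≠ 0 := by
  rw [← aeval_map_algebraMap ℚ]
  refine aeval_neg_inv_sq_ne_zero hp (by lia) hα ?_
    ((natDegree_map_le.trans D.natDegree₁).trans_lt (Nat.lt_succ_self _))
  rw [Ne, Polynomial.map_eq_zero_iff (RingHom.injective_int _)]
  intro h0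
  have := D.odd_leading
  rw [h0, coeff_zero] at this
  exact absurd this (by decide)

theorem exists_unit_mul_sq (hp : (2 * g + 1).Prime) (hg : 0 < g) (hn : 1 ≤ n)
    (h1 : ¬ (2 * g + 1) ^ 2 ∣ 2 ^ (2 * g + 1 - 1) - 1) (h2 : Odd (NumberField.classNumber L))
    {a : 𝓞 L} (ha : a ^ (2 * g + 1) = 2) :
    ∃ (u : (𝓞 L)ˣ) (β : 𝓞 L), aeval (-a ^ 2) (reflect (2 * g) D.A₁) = u * β ^ 2 := by
  have hp2 : 2 * g + 1 ≠ 2 := by lia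
  set η := aeval (-a ^ 2) (reflect (2 * g) D.A₁) with hη
  have hαp : (algebraMap (𝓞 L) L a) ^ (2 * g + 1) = 2 := by rw [← map_pow, ha, map_ofNat]
  have hα0 := ne_zero_of_pow_eq_two hp.ne_zero hαp two_ne_zero
  have hη0 : η ≠ 0 := by
    intro h0
    have h : algebraMap (𝓞 L) L η = 0 := by rw [h0, map_zero]
    rw [hη, ← aeval_algebraMap_apply, map_neg, map_pow] at h
    have hA := aeval_reflect_mul_pow (neg_sq_mul_neg_inv_sq hα0) D.natDegree₁
    rw [h, zero_mul] at hA
    exact D.aeval_ne_zero hp hαp hA.symm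
  obtain ⟨b, hb⟩ := Ideal.exists_sq_eq_span_of_locally_sq hη0 (fun 𝔮 h𝔮 h𝔮0 => by
    by_cases h2𝔮 : (2 : 𝓞 L) ∈ 𝔮
    · refine ⟨η, 1, η, fun hη𝔮 => ?_, one_ne_zero, by ring⟩
      obtain ⟨c, ⟨j, hj⟩, P, hP⟩ := D.reflect_eq hg hn
      have ha𝔮 : a ∈ 𝔮 := h𝔮.mem_of_pow_mem (2 * g + 1) (by rwa [ha])
      have h4𝔮 : (4 : 𝓞 L) ∈ 𝔮 := by
        have : (4 : 𝓞 L) = 2 * 2 := by norm_num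
        rw [this]
        exact 𝔮.mul_mem_left _ h2𝔮
      obtain ⟨k, rfl⟩ := Nat.exists_eq_add_of_le' hg
      rw [hη, hP] at hη𝔮
      simp only [map_add, map_mul, map_pow, aeval_X, aeval_C, map_one, map_ofNat, hj] at hη𝔮
      refine h𝔮.ne_top ((Ideal.eq_top_iff_one _).mpr ?_)
      set d := algebraMap ℤ (𝓞 L) (if n = 1 then 2 * (-1) ^ (k + 1) else 0)
      set j' := algebraMap ℤ (𝓞 L) j
      set P' := aeval (-a ^ 2) P
      have e : (1 : 𝓞 L) = (2 * j' + 1) * (1 + d * (-a ^ 2) ^ (k + 1)) + 4 * (-a ^ 2 * P') -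
        (2 * j' + ((2 * j' + 1) * d * (-a ^ 2) ^ k * (-a)) * a + (4 * (-a ^ 2 * P'))) := by ring
      rw [e]
      exact 𝔮.sub_mem hη𝔮 (𝔮.add_mem (𝔮.add_mem (𝔮.mul_mem_right _ h2𝔮) (𝔮.mul_mem_left _ ha𝔮))
        (𝔮.mul_mem_right _ h4𝔮))
    · exact exists_locally_sq (h := D.dvd) D.prim (D.natDegree_κ.trans_lt (by lia)) hp hp2 h1 ha D.norm₁
        D.natDegree₁ h𝔮 h𝔮0 h2𝔮)
  exact exists_unit_mul_sq_of_span_eq_sq h2 hη0 hb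

variable {L₂ : Type*} [Field L₂] [Algebra ℚ_[2] L₂] {α : L} {lam : L₂} {ι : L →+* L₂}

theorem algebraMap_reflect_eq {a : 𝓞 L} {c δ : ℤ} {A P : ℤ[X]}
    (h : reflect (2 * g) A = C c * (1 + C δ * X ^ g) + 4 * (X * P)) :
    algebraMap (𝓞 L) L (aeval (-a ^ 2) (reflect (2 * g) A)) =
      c * (1 + δ * (-1) ^ g * (algebraMap (𝓞 L) L a) ^ (2 * g)) + 4 * (algebraMap (𝓞 L) L a *
        aeval (algebraMap (𝓞 L) L a) (-X * P.comp (-X ^ 2) : ℤ[X])) := by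
  rw [h]
  simp only [← aeval_algebraMap_apply, map_add, map_mul, map_pow, aeval_X, aeval_C, map_one,
    map_ofNat, map_neg, aeval_comp]
  simp only [eq_intCast, map_intCast]
  rw [neg_pow, ← pow_mul]
  ring

theorem not_of_one (D : DescentDatum g 1) (hp : (2 * g + 1).Prime) (hg : 0 < g)
    (h1 : ¬ (2 * g + 1) ^ 2 ∣ 2 ^ (2 * g + 1 - 1) - 1) (h2 : Odd (NumberField.classNumber L))
    (hα : α ^ (2 * g + 1) = 2) (hdeg : Module.finrank ℚ L = 2 * g + 1)
    (hlam : lam ^ (2 * g + 1) = 2) (hdeg2 : Module.finrank ℚ_[2] L₂ = 2 * g + 1) (hι : ι α = lam)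
    (h3 : ∀ u : (𝓞 L)ˣ, ¬ ∃ s : L₂, s ^ 2 = ι (algebraMap (𝓞 L) L (u : 𝓞 L)) *
      (1 + lam ^ (2 * (2 * g + 1) - 1))) : False := by
  have hp2 : 2 * g + 1 ≠ 2 := by lia
  have hfin : FiniteDimensional ℚ_[2] L₂ := Module.finite_of_finrank_pos (by lia)
  obtain ⟨a, rfl⟩ : ∃ a : 𝓞 L, algebraMap (𝓞 L) L a = α :=
    ⟨⟨α, .of_pow hp.pos (by rw [hα]; exact map_ofNat (algebraMap ℤ L) 2 ▸ isIntegral_algebraMap)⟩, rfl⟩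
  obtain ⟨u, β, hu⟩ := D.exists_unit_mul_sq hp hg le_rfl h1 h2
    (FaithfulSMul.algebraMap_injective (𝓞 L) L (by rw [map_pow, hα, map_ofNat]))
  obtain ⟨c, hc, P, hP⟩ := D.reflect_eq hg le_rfl
  have h := algebraMap_reflect_eq (a := a) hP
  rw [hu] at h
  set α := algebraMap (𝓞 L) L a
  have hQ : 1 + α * aeval α (2 * X ^ (2 * g - 1) : ℤ[X]) = 1 + 2 * α ^ (2 * g + 1 - 1) := by
    obtain ⟨k, rfl⟩ := Nat.exists_eq_add_of_le' hg
    simp only [map_mul, map_ofNat, map_pow, aeval_X]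
    rw [show 2 * (k + 1) - 1 = 2 * k + 1 by lia, show 2 * (k + 1) + 1 - 1 = 2 * k + 1 + 1 by lia]
    ring
  have hδ : ((if (1 : ℕ) = 1 then 2 * (-1) ^ g else 0 : ℤ) : L) * (-1) ^ g = 2 := by
    rw [if_pos rfl]
    push_cast
    rw [mul_assoc, ← mul_pow]
    norm_num
  rw [hδ] at h
  have hk : (2 : ℚ) ^ (2 * (2 * g + 1) - 1) = 8 * ((2 ^ (2 * (2 * g + 1) - 4) : ℤ) : ℚ) := by
    rw [show 2 * (2 * g + 1) - 1 = 2 * (2 * g + 1) - 4 + 3 by lia, pow_add]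
    push_cast
    ring
  obtain ⟨v, -, s, hs⟩ := exists_signed_unit_local_square hp hp2 hα hdeg hlam hdeg2 hι hc
    (-X * P.comp (-X ^ 2)) (2 * X ^ (2 * g - 1)) (k := 2 ^ (2 * (2 * g + 1) - 4))
    (by rw [hQ, norm_one_add_two_mul_pow hp hp2 hα hdeg, hk]) (u := u) (β := β)
    (by rw [hQ]; exact h)
  refine h3 v ⟨s, ?_⟩
  rw [hs, hQ, map_add, map_one, map_mul, map_ofNat, map_pow, hι, ← hlam, ← pow_add]
  congr 3
  lia

theorem exists_sq_eq_aeval (D : DescentDatum g n) (hn : 2 ≤ n) (hp : (2 * g + 1).Prime) (hg : 0 < g)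
    (h1 : ¬ (2 * g + 1) ^ 2 ∣ 2 ^ (2 * g + 1 - 1) - 1) (h2 : Odd (NumberField.classNumber L))
    (hα : α ^ (2 * g + 1) = 2) (hdeg : Module.finrank ℚ L = 2 * g + 1)
    (hlam : lam ^ (2 * g + 1) = 2) (hdeg2 : Module.finrank ℚ_[2] L₂ = 2 * g + 1) (hι : ι α = lam) :
    ∃ (ν : ℤ) (s : L), Odd ν ∧ s ^ 2 = ν * aeval (-(α ^ 2)⁻¹) D.κ := by
  have hp2 : 2 * g + 1 ≠ 2 := by lia
  have hfin : FiniteDimensional ℚ_[2] L₂ := Module.finite_of_finrank_pos (by lia)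
  obtain ⟨a, rfl⟩ : ∃ a : 𝓞 L, algebraMap (𝓞 L) L a = α :=
    ⟨⟨α, .of_pow hp.pos (by rw [hα]; exact map_ofNat (algebraMap ℤ L) 2 ▸ isIntegral_algebraMap)⟩, rfl⟩
  obtain ⟨u, β, hu⟩ := D.exists_unit_mul_sq hp hg (one_le_two.trans hn) h1 h2
    (FaithfulSMul.algebraMap_injective (𝓞 L) L (by rw [map_pow, hα, map_ofNat]))
  obtain ⟨c, hc, P, hP⟩ := D.reflect_eq hg (one_le_two.trans hn)
  have h := algebraMap_reflect_eq (a := a) hP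
  set α := algebraMap (𝓞 L) L a with hαa
  have hA := aeval_reflect_mul_pow (neg_sq_mul_neg_inv_sq
    (ne_zero_of_pow_eq_two hp.ne_zero hα two_ne_zero)) D.natDegree₁
  have hr : aeval (-α ^ 2) (reflect (2 * g) D.A₁) = algebraMap (𝓞 L) L (u * β ^ 2) := by
    rw [← hu, ← aeval_algebraMap_apply, map_neg, map_pow]
  rw [hr] at hA
  rw [hu, if_neg (by lia), Int.cast_zero, zero_mul, zero_mul] at h
  have hQ : 1 + α * aeval α (0 : ℤ[X]) = 1 := by rw [map_zero, mul_zero, add_zero]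
  obtain ⟨v, hv, s, hs⟩ := exists_signed_unit_local_square hp hp2 hα hdeg hlam hdeg2 hι hc
    (-X * P.comp (-X ^ 2)) 0 (k := 0)
    (by rw [hQ, map_one, Int.cast_zero, mul_zero, add_zero]) (u := u) (β := β)
    (by rw [hQ, h, add_zero])
  rw [hQ, map_one, mul_one] at hs
  obtain ⟨w, hw⟩ := isSquare_of_local_square h2 hp hp2 hα hdeg hlam hdeg2 hι v hs
  have hθ4 := four_mul_neg_inv_sq_pow (hp.odd_of_ne_two hp2) hα (two_ne_zero (α := L))
  have hev := evalHalf_sq (h2 := two_ne_zero) (hθ := hθ4) D.G₁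
  rw [D.norm₁, map_mul, ← hA] at hev
  set θ := -(α ^ 2)⁻¹ with hθ
  have hθ0 : θ ≠ 0 := neg_ne_zero.mpr (inv_ne_zero (pow_ne_zero 2
    (ne_zero_of_pow_eq_two hp.ne_zero hα two_ne_zero)))
  obtain ⟨ν, hν, hνu⟩ : ∃ ν : ℤ, Odd ν ∧
      algebraMap (𝓞 L) L u = ν * (algebraMap (𝓞 L) L w) ^ 2 := by
    rcases hv with rfl | rfl
    · exact ⟨1, odd_one, by rw [hw, Units.val_mul, map_mul]; push_cast; ring⟩
    · refine ⟨-1, ⟨-1, rfl⟩, ?_⟩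
      have := congrArg (fun z : (𝓞 L)ˣ => algebraMap (𝓞 L) L z) hw
      simp only [Units.val_neg, Units.val_mul, map_neg, map_mul] at this
      push_cast
      linear_combination -this
  have hw0 : algebraMap (𝓞 L) L w ≠ 0 := (w.isUnit.map (algebraMap (𝓞 L) L)).ne_zero
  have hη0 : algebraMap (𝓞 L) L (u * β ^ 2) ≠ 0 := by
    intro h0
    rw [h0, zero_mul] at hA
    exact D.aeval_ne_zero hp hα hA.symm
  have hβ0 : algebraMap (𝓞 L) L β ≠ 0 := by
    intro h0
    rw [map_mul, map_pow, h0] at hη0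
    exact hη0 (by ring)
  refine ⟨ν, evalHalf θ two_ne_zero hθ4 D.G₁ / (algebraMap (𝓞 L) L w * algebraMap (𝓞 L) L β * θ ^ g),
    hν, ?_⟩
  rw [div_pow, hev, div_eq_iff (by positivity), map_mul, map_pow, hνu]
  ring

end DescentDatum

theorem irreducible_four_mul_X_pow_add_one {p : ℕ} (hp : p.Prime) (hp2 : p ≠ 2) :
    Irreducible (4 * X ^ p + 1 : ℚ[X]) := by
  have e : (4 * X ^ p + 1 : ℚ[X]) = C 4 * (X ^ p - C (-4⁻¹)) := by
    rw [mul_sub, ← Polynomial.C_mul]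
    norm_num
    rfl
  rw [e, irreducible_isUnit_mul (isUnit_C.mpr (isUnit_iff_ne_zero.mpr four_ne_zero))]
  exact Rat.irreducible_X_pow_sub_neg_quarter hp hp2

namespace HyperRing

open QuadraticAlgebra

variable {p : ℕ}

/-- The function field of the curve `w² + w = x^p` over `ℚ`. -/
abbrev FunctionField (p : ℕ) :=
  QuadraticAlgebra (FractionRing ℚ[X]) (algebraMap ℚ[X] _ (X ^ p)) (-1)

theorem sq_ne (hp : p.Prime) (hp2 : p ≠ 2) (r : FractionRing ℚ[X]) :
    r ^ 2 ≠ algebraMap ℚ[X] _ (X ^ p) + (-1) * r := by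
  intro h
  have ht : (2 * r + 1) ^ 2 = algebraMap ℚ[X] _ (4 * X ^ p + 1) := by
    rw [map_add, map_mul, map_ofNat, map_one]
    linear_combination 4 * h
  obtain ⟨t, ht'⟩ := IsIntegrallyClosed.exists_algebraMap_eq_of_isIntegral_pow (n := 2) two_pos
    (by rw [ht]; exact isIntegral_algebraMap)
  rw [← ht', ← map_pow] at ht
  have h2 := IsFractionRing.injective _ _ ht
  have hi := irreducible_four_mul_X_pow_add_one hp hp2
  rw [← h2] at hi
  exact not_irreducible_pow (by decide : (2 : ℕ) ≠ 1) hi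

theorem norm_and_trace_mem {x : FunctionField p} (hx : IsIntegral ℚ[X] x) :
    (∃ n, algebraMap ℚ[X] _ n = QuadraticAlgebra.norm x) ∧
      ∃ t, algebraMap ℚ[X] _ t = 2 * x.re - x.im := by
  let σ : FunctionField p →ₐ[ℚ[X]] FunctionField p :=
    { starRingEnd (FunctionField p) with
      commutes' := fun r => by
        change star (algebraMap (FractionRing ℚ[X]) (FunctionField p) (algebraMap ℚ[X] _ r)) =
          algebraMap (FractionRing ℚ[X]) (FunctionField p) (algebraMap ℚ[X] _ r)
        ext <;> simp }
  have hs : IsIntegral ℚ[X] (star x) := hx.map σ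
  have hinj : Function.Injective (algebraMap (FractionRing ℚ[X]) (FunctionField p)) :=
    algebraMap_injective
  constructor
  · refine IsIntegrallyClosed.isIntegral_iff.mp ((isIntegral_algebraMap_iff hinj).mp ?_)
    rw [algebraMap_norm_eq_mul_star]
    exact hx.mul hs
  · refine IsIntegrallyClosed.isIntegral_iff.mp ((isIntegral_algebraMap_iff hinj).mp ?_)
    have e : algebraMap (FractionRing ℚ[X]) (FunctionField p) (2 * x.re - x.im) = x + star x := by
      rw [← algebraMap_trace_eq_add_star, trace_def]
      congr 1
      ring
    rw [e]
    exact hx.add hs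

theorem exists_eq_of_isIntegral (hp : p.Prime) (hp2 : p ≠ 2) {x : FunctionField p}
    (hx : IsIntegral ℚ[X] x) :
    ∃ F : HyperRing ℚ p, x = ⟨algebraMap ℚ[X] _ F.re, algebraMap ℚ[X] _ F.im⟩ := by
  obtain ⟨⟨n, hn⟩, t, ht⟩ := norm_and_trace_mem hx
  have hf := irreducible_four_mul_X_pow_add_one hp hp2
  set f : ℚ[X] := 4 * X ^ p + 1 with hfdef
  have hf' : algebraMap ℚ[X] (FractionRing ℚ[X]) f = 4 * algebraMap ℚ[X] _ (X ^ p) + 1 := by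
    rw [hfdef, map_add, map_mul, map_ofNat, map_one]
  rw [norm_def] at hn
  have h1 : (algebraMap ℚ[X] _ f * x.im) ^ 2 = algebraMap ℚ[X] _ (f * (t ^ 2 - 4 * n)) := by
    have e : algebraMap ℚ[X] (FractionRing ℚ[X]) (f * (t ^ 2 - 4 * n)) =
        algebraMap ℚ[X] _ f * (algebraMap ℚ[X] _ t ^ 2 - 4 * algebraMap ℚ[X] _ n) := by
      rw [map_mul, map_sub, map_mul, map_pow, map_ofNat]
    rw [e, hn, ht, hf']
    ring
  obtain ⟨s, hs⟩ := IsIntegrallyClosed.exists_algebraMap_eq_of_isIntegral_pow (n := 2) two_pos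
    (by rw [h1]; exact isIntegral_algebraMap)
  rw [← hs, ← map_pow] at h1
  obtain ⟨v, rfl⟩ := hf.prime.dvd_of_dvd_pow ⟨_, IsFractionRing.injective _ _ h1⟩
  rw [map_mul] at hs
  have hv := mul_left_cancel₀ (by
    rw [Ne, IsFractionRing.to_map_eq_zero_iff]
    exact hf.ne_zero) hs
  refine ⟨⟨C (1 / 2) * (t + v), v⟩, ?_⟩
  have h2 : (2 : ℚ[X]) * C (1 / 2) = 1 := by
    have : (2 : ℚ[X]) = C 2 := rfl
    rw [this, ← Polynomial.C_mul]
    norm_num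
  have h2' := congrArg (algebraMap ℚ[X] (FractionRing ℚ[X])) h2
  rw [map_mul, map_ofNat, map_one] at h2'
  ext
  · change x.re = algebraMap ℚ[X] _ (C (1 / 2) * (t + v))
    rw [map_mul, map_add, ht, hv]
    linear_combination -x.re * h2'
  · exact hv.symm

theorem isDedekindDomain (hp : p.Prime) (hp2 : p ≠ 2) : IsDedekindDomain (HyperRing ℚ p) := by
  have hdom := HyperRing.isDomain (k := ℚ) (hp.odd_of_ne_two hp2)
  have hfact : Fact (∀ r : FractionRing ℚ[X], r ^ 2 ≠ algebraMap ℚ[X] _ (X ^ p) + (-1) * r) :=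
    ⟨sq_ne hp hp2⟩
  let φ : HyperRing ℚ p →+* FunctionField p :=
    { toFun := fun F => ⟨algebraMap ℚ[X] _ F.re, algebraMap ℚ[X] _ F.im⟩
      map_one' := by ext <;> simp
      map_zero' := by ext <;> simp
      map_add' := fun F G => by ext <;> simp
      map_mul' := fun F G => by ext <;> simp }
  let _ : Algebra (HyperRing ℚ p) (FunctionField p) := φ.toAlgebra
  have htow : IsScalarTower ℚ[X] (HyperRing ℚ p) (FunctionField p) :=
    .of_algebraMap_eq fun r => by
      change algebraMap (FractionRing ℚ[X]) (FunctionField p) (algebraMap ℚ[X] _ r) =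
        φ (algebraMap ℚ[X] _ r)
      ext
      · rfl
      · exact (map_zero (algebraMap ℚ[X] (FractionRing ℚ[X]))).symm
  have hic : IsIntegralClosure (HyperRing ℚ p) ℚ[X] (FunctionField p) :=
    { algebraMap_injective := fun F G h => by
        refine QuadraticAlgebra.ext ?_ ?_
        · exact (IsFractionRing.injective ℚ[X] (FractionRing ℚ[X])
            (congrArg QuadraticAlgebra.re h))
        · exact (IsFractionRing.injective ℚ[X] (FractionRing ℚ[X])
            (congrArg QuadraticAlgebra.im h))
      isIntegral_iff := fun {x} => by
        constructor
        · intro hx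
          obtain ⟨F, hF⟩ := exists_eq_of_isIntegral hp hp2 hx
          exact ⟨F, hF.symm⟩
        · rintro ⟨F, rfl⟩
          exact (Algebra.IsIntegral.isIntegral F).algebraMap }
  exact IsIntegralClosure.isDedekindDomain ℚ[X] (FractionRing ℚ[X]) (FunctionField p)
    (HyperRing ℚ p)

end HyperRing

theorem Ideal.exists_eq_mul_sq_of_mul_map_eq_sq {R : Type*} [CommRing R] [IsDedekindDomain R]
    {σ : R →+* R} (hσ : ∀ x, σ (σ x) = x) {a : R} (ha : a ≠ 0) (hσa : σ a = a) {M : Ideal R}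
    (h : M * M.map σ = Ideal.span {a} ^ 2) :
    ∃ B J : Ideal R, M = J * B ^ 2 ∧ Ideal.span {a} = J * (B * B.map σ) ∧ B ⊔ B.map σ = ⊤ := by
  have hss (I : Ideal R) : (I.map σ).map σ = I := by
    rw [Ideal.map_map, show σ.comp σ = RingHom.id R from RingHom.ext hσ, Ideal.map_id]
  have hsa : (Ideal.span {a}).map σ = Ideal.span {a} := by
    rw [Ideal.map_span, Set.image_singleton, hσa]
  have ha0 : Ideal.span {a} ≠ 0 := by simpa using ha
  set J₀ := M ⊔ Ideal.span {a} with hJ₀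
  obtain ⟨B, hB⟩ : J₀ ∣ M := Ideal.dvd_iff_le.mpr le_sup_left
  obtain ⟨C, hC⟩ : J₀ ∣ Ideal.span {a} := Ideal.dvd_iff_le.mpr le_sup_right
  have hJ0 : J₀ ≠ 0 := by
    intro h0
    rw [h0, zero_mul] at hC
    exact ha0 hC
  have hBC : IsCoprime B C := by
    rw [Ideal.isCoprime_iff_sup_eq]
    refine mul_left_cancel₀ hJ0 ?_
    rw [Ideal.mul_sup, ← hB, ← hC, Ideal.mul_top]
  have hsJ0 : J₀.map σ ≠ 0 := by
    intro h0
    have := hss J₀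
    rw [h0, Ideal.zero_eq_bot, Ideal.map_bot] at this
    exact hJ0 this.symm
  have h2 : B * B.map σ = C * C.map σ := by
    refine mul_left_cancel₀ (mul_ne_zero hJ0 hsJ0) ?_
    have hl : J₀ * J₀.map σ * (B * B.map σ) = M * M.map σ := by
      conv_rhs => rw [hB, Ideal.map_mul]
      ring
    have hr : J₀ * J₀.map σ * (C * C.map σ) = Ideal.span {a} ^ 2 := by
      conv_rhs => rw [sq]; rw (occs := [2]) [← hsa]; rw [hC, Ideal.map_mul]
      ring
    rw [hl, hr, h]
  have hd1 : B ∣ C.map σ := hBC.dvd_of_dvd_mul_left (h2 ▸ dvd_mul_right _ _)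
  have hd2 : C ∣ B.map σ := hBC.symm.dvd_of_dvd_mul_left (h2.symm ▸ dvd_mul_right _ _)
  have hd3 : B.map σ ∣ C := by
    rw [Ideal.dvd_iff_le] at hd1 ⊢
    have := Ideal.map_mono (f := σ) hd1
    rwa [hss] at this
  have hCB : C = B.map σ := dvd_antisymm hd2 hd3
  have hspan : Ideal.span {a} = J₀.map σ * B := by
    rw [← hsa, hC, Ideal.map_mul, hCB, hss]
  obtain ⟨J, hJ⟩ : B ∣ J₀ := by
    refine hBC.dvd_of_dvd_mul_right (z := C) (y := J₀) ?_
    rw [← hC, hspan]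
    exact dvd_mul_left _ _
  refine ⟨B, J, by rw [hB, hJ]; ring, by rw [hC, hJ, hCB]; ring, ?_⟩
  rw [← hCB, ← Ideal.isCoprime_iff_sup_eq]
  exact hBC

namespace HyperRing

open QuadraticAlgebra

variable {p : ℕ}

theorem idl_mul_map_star {κ b : ℚ[X]} (h : κ ∣ b ^ 2 + b - X ^ p)
    (hcop : idl κ b h ⊔ (idl κ b h).map (starRingEnd _) = ⊤) :
    idl κ b h * (idl κ b h).map (starRingEnd _) = Ideal.span {algebraMap ℚ[X] _ κ} := by
  set I := idl κ b h with hI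
  have hκ : algebraMap ℚ[X] _ κ ∈ I := algebraMap_mem_idl
  apply le_antisymm
  · rw [Ideal.mul_le]
    intro F hF G hG
    obtain ⟨G', hG', rfl⟩ : ∃ G' ∈ I, star G' = G := by
      have h1 := Ideal.mem_map_of_mem (starRingEnd (HyperRing ℚ p)) hG
      rw [Ideal.map_map, show (starRingEnd (HyperRing ℚ p)).comp (starRingEnd _) = RingHom.id _ from
        RingHom.ext star_star, Ideal.map_id] at h1
      exact ⟨star G, h1, star_star G⟩
    obtain ⟨P, hP⟩ := exists_mul_star_eq_smul hF hG'
    rw [hP, Algebra.smul_def]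
    exact Ideal.mul_mem_right _ _ (Ideal.mem_span_singleton_self _)
  · rw [Ideal.mul_eq_inf_of_isCoprime (Ideal.isCoprime_iff_sup_eq.mpr hcop)]
    rw [Ideal.span_singleton_le_iff_mem]
    refine ⟨hκ, ?_⟩
    have := Ideal.mem_map_of_mem (starRingEnd (HyperRing ℚ p)) hκ
    rwa [starRingEnd_apply, show star (algebraMap ℚ[X] (HyperRing ℚ p) κ) = algebraMap _ _ κ by
      ext <;> simp] at this

theorem idl_sup_map_star (hp : p.Prime) (hp2 : p ≠ 2) {κ b : ℚ[X]} (h : κ ∣ b ^ 2 + b - X ^ p)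
    (hκ : κ ≠ 0) (hκd : κ.natDegree < p) :
    idl κ b h ⊔ (idl κ b h).map (starRingEnd _) = ⊤ := by
  have hirr := irreducible_four_mul_X_pow_add_one hp hp2
  have hcop : IsCoprime κ (2 * b + 1) := by
    have h1 : IsCoprime κ (4 * X ^ p + 1) := by
      refine (hirr.coprime_iff_not_dvd.mpr fun hd => ?_).symm
      have hle := natDegree_le_of_dvd hd hκ
      have : (4 * X ^ p + 1 : ℚ[X]).natDegree = p := by
        have := natDegree_C_mul_X_pow p (4 : ℚ) four_ne_zero
        rw [natDegree_add_eq_left_of_natDegree_lt]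
        · exact this
        · exact natDegree_one.trans_lt (hp.pos.trans_eq this.symm)
      lia
    obtain ⟨r, hr⟩ := h
    refine IsCoprime.of_mul_right_left (z := 2 * b + 1) ?_
    have e : (2 * b + 1) * (2 * b + 1) = 4 * X ^ p + 1 + κ * (4 * r) := by linear_combination 4 * hr
    rw [e]
    exact h1.add_mul_left_right _
  obtain ⟨x, y, hxy⟩ := hcop
  rw [Ideal.eq_top_iff_one]
  set w : HyperRing ℚ p := ⟨-b, 1⟩
  have hw : w ∈ idl κ b h := by
    rw [mem_idl]
    exact ⟨0, by change -b + b * 1 = κ * 0; ring⟩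
  have hsw := Ideal.mem_map_of_mem (starRingEnd (HyperRing ℚ p)) hw
  have e : (1 : HyperRing ℚ p) = algebraMap ℚ[X] _ x * algebraMap ℚ[X] _ κ +
      (algebraMap ℚ[X] _ (-y)) * w + algebraMap ℚ[X] _ (-y) * starRingEnd _ w := by
    ext1
    · simp only [starRingEnd_apply, re_add, re_mul, re_star, algebraMap_re, algebraMap_im, im_star, w,
        QuadraticAlgebra.re_one]
      linear_combination -hxy
    · simp only [starRingEnd_apply, im_add, im_mul, re_star, algebraMap_re, algebraMap_im, im_star, w,
        QuadraticAlgebra.im_one]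
      ring
  rw [e]
  exact Ideal.add_mem _ (Ideal.add_mem _
    (Ideal.mul_mem_left _ _ (Ideal.mem_sup_left algebraMap_mem_idl))
    (Ideal.mul_mem_left _ _ (Ideal.mem_sup_left hw)))
    (Ideal.mul_mem_left _ _ (Ideal.mem_sup_right hsw))

/-- An ideal prime to its conjugate is of the form `idl κ b`. -/
theorem exists_eq_idl {B : Ideal (HyperRing ℚ p)} (h : B ⊔ B.map (starRingEnd _) = ⊤) :
    ∃ (κ b : ℚ[X]) (hd : κ ∣ b ^ 2 + b - X ^ p), B = idl κ b hd := by
  obtain ⟨β, hβ, γ, hγ, hbc⟩ := Submodule.mem_sup.mp ((Ideal.eq_top_iff_one _).mp h)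
  obtain ⟨δ, hδ, rfl⟩ : ∃ δ ∈ B, star δ = γ := by
    have h1 := Ideal.mem_map_of_mem (starRingEnd (HyperRing ℚ p)) hγ
    rw [Ideal.map_map, show (starRingEnd (HyperRing ℚ p)).comp (starRingEnd _) = RingHom.id _ from
      RingHom.ext star_star, Ideal.map_id] at h1
    exact ⟨star γ, h1, star_star γ⟩
  set w : HyperRing ℚ p := ⟨0, 1⟩ with hw
  set b : ℚ[X] := trace (w * star δ) with hb
  have hwb : w - algebraMap ℚ[X] _ b ∈ B := by
    have e : w - algebraMap ℚ[X] _ b = w * β - star w * δ := by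
      rw [hb, algebraMap_trace_eq_add_star, star_mul, star_star]
      linear_combination -w * hbc
    rw [e]
    exact B.sub_mem (B.mul_mem_left _ hβ) (B.mul_mem_left _ hδ)
  obtain ⟨κ, hκ⟩ := (inferInstance : (B.comap (algebraMap ℚ[X] (HyperRing ℚ p))).IsPrincipal)
  have hmem (r : ℚ[X]) : algebraMap ℚ[X] (HyperRing ℚ p) r ∈ B ↔ κ ∣ r := by
    rw [← Ideal.mem_comap, ← Ideal.mem_span_singleton]
    exact iff_of_eq (congrArg (r ∈ ·) hκ)
  refine ⟨κ, b, ?_, ?_⟩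
  · rw [← hmem]
    have e : algebraMap ℚ[X] (HyperRing ℚ p) (b ^ 2 + b - X ^ p) =
        (star w - algebraMap ℚ[X] _ b) * (w - algebraMap ℚ[X] _ b) := by
      ext1 <;> simp only [hw, re_sub, im_sub, re_mul, im_mul, re_star, im_star, algebraMap_re,
        algebraMap_im] <;> ring
    rw [e]
    exact B.mul_mem_left _ hwb
  · ext F
    rw [mem_idl, ← hmem]
    have e : F = algebraMap ℚ[X] _ F.im * (w - algebraMap ℚ[X] _ b) +
        algebraMap ℚ[X] _ (F.re + b * F.im) := by
      ext1
      · simp [hw]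
        ring
      · simp [hw]
    constructor
    · intro hF
      rw [e] at hF
      exact (B.add_mem_iff_right (B.mul_mem_left _ hwb)).mp hF
    · intro hF
      rw [e]
      exact (B.add_mem_iff_right (B.mul_mem_left _ hwb)).mpr hF

end HyperRing

theorem Polynomial.mem_degreeLT_succ_iff {R : Type*} [Semiring R] {f : R[X]} {n : ℕ} :
    f ∈ degreeLT R (n + 1) ↔ f.natDegree ≤ n := by
  rw [mem_degreeLT, degree_lt_iff_coeff_zero, natDegree_le_iff_coeff_eq_zero]
  rfl

theorem Polynomial.finrank_degreeLT {k : Type*} [CommRing k] [Nontrivial k] (n : ℕ) :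
    Module.finrank k (degreeLT k n) = n := by
  rw [(degreeLTEquiv k n).finrank_eq, Module.finrank_fin_fun]

theorem Polynomial.free_degreeLT {k : Type*} [CommRing k] (n : ℕ) :
    Module.Free k (degreeLT k n) := .of_equiv (degreeLTEquiv k n).symm

theorem Polynomial.finite_degreeLT {k : Type*} [CommRing k] (n : ℕ) :
    Module.Finite k (degreeLT k n) := .equiv (degreeLTEquiv k n).symm

namespace HyperRing

open QuadraticAlgebra

variable {p : ℕ}

theorem natDegree_norm_le_iff_mem_degreeLT {k : Type*} [CommRing k] [IsDomain k] (hp : Odd p) {F : HyperRing k p}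
    {m : ℕ} : (norm F).natDegree ≤ m ↔
      F.re ∈ degreeLT k (m / 2 + 1) ∧ F.im ∈ degreeLT k ((m + 2 - p) / 2) := by
  rw [natDegree_norm_le_iff hp, mem_degreeLT_succ_iff, Nat.le_div_iff_mul_le two_pos,
    mul_comm F.re.natDegree]
  refine and_congr_right fun _ => ?_
  by_cases h0 : F.im = 0
  · simp [h0]
  rw [mem_degreeLT, ← natDegree_lt_iff_degree_lt h0]
  constructor
  · intro h
    have := h h0
    lia
  · intro h _
    lia

section Field

variable {L : Type*} [Field L] [Algebra ℚ L] {θ : L} {g : ℕ}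

theorem exists_norm_eq_mul_sq (hp : Odd (2 * g + 1)) (hdeg : Module.finrank ℚ L = 2 * g + 1)
    (hθ : 4 * θ ^ (2 * g + 1) = -1)
    (hinj : ∀ q : ℚ[X], q ≠ 0 → q.natDegree < 2 * g + 1 → aeval θ q ≠ 0)
    {κ b : ℚ[X]} {h : κ ∣ b ^ 2 + b - X ^ (2 * g + 1)} (hκ : κ ≠ 0) (hκd : κ.natDegree ≤ g)
    {ν : ℚ} {s : L} (hs : s ^ 2 = algebraMap ℚ L ν * aeval θ κ) :
    ∃ F ∈ idl κ b h, ∃ A : ℚ[X], A ≠ 0 ∧ A.natDegree ≤ g ∧ norm F = C ν * κ * A ^ 2 := by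
  have hchar : CharZero L := algebraRat.charZero L
  have hfin : FiniteDimensional ℚ L := Module.finite_of_finrank_pos (by lia)
  set d := κ.natDegree with hd
  set n₁ := (d + 2 * g) / 2 + 1 with hn₁
  set n₂ := (d + 2 * g + 2 - (2 * g + 1)) / 2 with hn₂
  have hf₁ := finite_degreeLT (k := ℚ) n₁
  have hf₂ := finite_degreeLT (k := ℚ) n₂
  have hf₃ := finite_degreeLT (k := ℚ) (g + 1)
  have hf₄ : Module.Finite ℚ (ℚ[X] ⧸ Ideal.span {κ}) := (AdjoinRoot.powerBasis hκ).finite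
  let φ : (degreeLT ℚ n₁ × degreeLT ℚ n₂) × degreeLT ℚ (g + 1) →ₗ[ℚ]
      (ℚ[X] ⧸ Ideal.span {κ}) × L :=
    { toFun := fun v => (Ideal.Quotient.mk _ ((v.1.1 : ℚ[X]) + b * (v.1.2 : ℚ[X])),
        aeval θ (v.1.1 : ℚ[X]) - aeval θ (v.1.2 : ℚ[X]) / 2 - s * aeval θ (v.2 : ℚ[X]))
      map_add' := fun v w => by
        ext
        · simp only [Prod.fst_add, Prod.snd_add, Submodule.coe_add, ← map_add]
          congr 1
          ring
        · simp only [Prod.fst_add, Prod.snd_add, Submodule.coe_add, map_add]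
          ring
      map_smul' := fun r v => by
        ext
        · simp only [Prod.smul_fst, Prod.smul_snd, Submodule.coe_smul, RingHom.id_apply,
            mul_smul_comm, ← smul_add]
          rfl
        · simp only [Prod.smul_fst, Prod.smul_snd, Submodule.coe_smul, RingHom.id_apply,
            (aeval θ).map_smul_of_tower, Algebra.smul_def r (_ : L)]
          ring }
  have hker : LinearMap.ker φ ≠ ⊥ := by
    apply LinearMap.ker_ne_bot_of_finrank_lt
    simp only [Module.finrank_prod, finrank_degreeLT, hdeg, finrank_quotient_span_eq_natDegree]
    lia
  obtain ⟨⟨⟨⟨U, hU⟩, V, hV⟩, A, hA⟩, hv, hne⟩ := Submodule.exists_mem_ne_zero_of_ne_bot hker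
  rw [LinearMap.mem_ker] at hv
  have hv1 : Ideal.Quotient.mk (Ideal.span {κ}) (U + b * V) = 0 := congrArg Prod.fst hv
  have hv2 : aeval θ U - aeval θ V / 2 - s * aeval θ A = 0 := congrArg Prod.snd hv
  rw [Ideal.Quotient.eq_zero_iff_mem, Ideal.mem_span_singleton] at hv1
  set F : HyperRing ℚ (2 * g + 1) := ⟨U, V⟩ with hF
  have hFd : (norm F).natDegree ≤ d + 2 * g := (natDegree_norm_le_iff_mem_degreeLT hp).mpr ⟨hU, hV⟩
  have hAd : A.natDegree ≤ g := mem_degreeLT_succ_iff.mp hA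
  have hFI : F ∈ idl κ b h := hv1
  obtain ⟨M, hM⟩ := dvd_norm hFI
  have hev := evalHalf_sq (h2 := two_ne_zero) (hθ := hθ) F
  rw [evalHalf_apply, sub_eq_zero.mp hv2, mul_pow, hs, hM, map_mul] at hev
  have hκθ := hinj κ hκ (by lia)
  have hMA : M = C ν * A ^ 2 := by
    by_contra hne
    refine hinj (M - C ν * A ^ 2) (sub_ne_zero.mpr hne) ?_ ?_
    · have hMd : M.natDegree ≤ 2 * g := by
        by_cases hM0 : M = 0
        · rw [hM0, natDegree_zero]
          exact Nat.zero_le _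
        rw [hM, natDegree_mul hκ hM0] at hFd
        lia
      have h2 : (C ν * A ^ 2).natDegree ≤ 2 * g :=
        (natDegree_C_mul_le _ _).trans (natDegree_pow_le_of_le 2 hAd)
      exact (natDegree_sub_le_of_le hMd h2).trans_lt (by simp)
    · refine mul_left_cancel₀ hκθ ?_
      rw [map_sub, map_mul, map_pow, aeval_C]
      linear_combination -hev
  refine ⟨F, hFI, A, ?_, hAd, by rw [hM, hMA]; ring⟩
  rintro rfl
  rw [hMA, zero_pow two_ne_zero, mul_zero, mul_zero, norm_eq_zero hp] at hM
  have hU0 : U = 0 := congrArg QuadraticAlgebra.re hM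
  have hV0 : V = 0 := congrArg QuadraticAlgebra.im hM
  subst hU0 hV0
  exact hne rfl

end Field

/-- A class whose first invariant is a square becomes divisible by two. -/
theorem exists_half {g : ℕ} (hp : (2 * g + 1).Prime) (hp2 : 2 * g + 1 ≠ 2) {κ b : ℚ[X]}
    {h : κ ∣ b ^ 2 + b - X ^ (2 * g + 1)} (hκ : κ ≠ 0) (hκd : κ.natDegree < 2 * g + 1) {ν : ℚ}
    (hν : ν ≠ 0) {F : HyperRing ℚ (2 * g + 1)} (hF : F ∈ idl κ b h) {A : ℚ[X]} (hA : A ≠ 0)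
    (hN : norm F = C ν * κ * A ^ 2) :
    ∃ (κ' b' : ℚ[X]) (h' : κ' ∣ b' ^ 2 + b' - X ^ (2 * g + 1)), κ' ∣ A ∧
      ∃ F' ∈ idl κ b h, norm F' = C ν * κ * κ' ^ 2 ∧
        ∀ G ∈ idl κ' b' h', ∀ G₀ ∈ idl κ b h, F' ∣ G ^ 2 * G₀ := by
  have hded := isDedekindDomain hp hp2
  have hdom := HyperRing.isDomain (k := ℚ) (hp.odd_of_ne_two hp2)
  set I := idl κ b h with hI
  set σ := starRingEnd (HyperRing ℚ (2 * g + 1))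
  have hσ (r : ℚ[X]) : σ (algebraMap ℚ[X] _ r) = algebraMap ℚ[X] _ r := by
    rw [starRingEnd_apply]
    ext1 <;> simp
  have hcop := idl_sup_map_star hp hp2 h hκ hκd
  have hII := idl_mul_map_star h hcop
  have hκ0 : Ideal.span {algebraMap ℚ[X] (HyperRing ℚ (2 * g + 1)) κ} ≠ 0 := by
    rw [Ne, Ideal.zero_eq_bot, Ideal.span_singleton_eq_bot]
    exact fun h0 => hκ (algebraMap_injective (h0.trans (map_zero _).symm))
  have hI0 : I ≠ 0 := by
    intro h0
    exact hκ0 (hII.symm.trans (by rw [← hI, h0, zero_mul]))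
  obtain ⟨M, hM⟩ : I ∣ Ideal.span {F} :=
    Ideal.dvd_iff_le.mpr ((Ideal.span_singleton_le_iff_mem I).mpr hF)
  have hνu : IsUnit (algebraMap ℚ[X] (HyperRing ℚ (2 * g + 1)) (C ν)) :=
    (isUnit_C.mpr (isUnit_iff_ne_zero.mpr hν)).map _
  have hMM : M * M.map σ = Ideal.span {algebraMap ℚ[X] _ A} ^ 2 := by
    refine mul_left_cancel₀ hκ0 ?_
    have e : Ideal.span {algebraMap ℚ[X] _ κ} * (M * M.map σ) =
        Ideal.span {F} * (Ideal.span {F}).map σ := by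
      rw [← hII, hM, Ideal.map_mul]
      ring
    rw [e, Ideal.map_span, Set.image_singleton, Ideal.span_singleton_mul_span_singleton,
      starRingEnd_apply, mul_star_self, hN, map_mul, map_mul, mul_assoc,
      Ideal.span_singleton_mul_left_unit hνu, map_pow, Ideal.span_singleton_pow,
      Ideal.span_singleton_mul_span_singleton]
  have hA0 : algebraMap ℚ[X] (HyperRing ℚ (2 * g + 1)) A ≠ 0 :=
    fun h0 => hA (algebraMap_injective (h0.trans (map_zero _).symm))
  obtain ⟨B, J, hMB, hAB, hBB⟩ := Ideal.exists_eq_mul_sq_of_mul_map_eq_sq (σ := σ) star_star hA0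
    (hσ A) hMM
  obtain ⟨κ', b', h', rfl⟩ := exists_eq_idl hBB
  have hBk := idl_mul_map_star h' hBB
  rw [hBk] at hAB
  have hdvd : algebraMap ℚ[X] (HyperRing ℚ (2 * g + 1)) κ' ∣ algebraMap ℚ[X] _ A := by
    rw [← Ideal.mem_span_singleton, ← Ideal.span_singleton_le_iff_mem, hAB]
    exact Ideal.mul_le_right
  rw [algebraMap_dvd_iff_dvd] at hdvd
  refine ⟨κ', b', h', hdvd, ?_⟩
  obtain ⟨A₁, rfl⟩ := hdvd
  have hκ'0 : κ' ≠ 0 := left_ne_zero_of_mul hA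
  have hA₁0 : A₁ ≠ 0 := right_ne_zero_of_mul hA
  have hJ : J = Ideal.span {algebraMap ℚ[X] _ A₁} := by
    refine mul_right_cancel₀ (b := Ideal.span {algebraMap ℚ[X] (HyperRing ℚ (2 * g + 1)) κ'}) ?_ ?_
    · rw [Ne, Ideal.zero_eq_bot, Ideal.span_singleton_eq_bot]
      exact fun h0 => hκ'0 (algebraMap_injective (h0.trans (map_zero _).symm))
    · rw [← hAB, Ideal.span_singleton_mul_span_singleton, map_mul,
        mul_comm (algebraMap ℚ[X] _ κ')]
  have hA₁0' : algebraMap ℚ[X] (HyperRing ℚ (2 * g + 1)) A₁ ≠ 0 :=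
    fun h0 => hA₁0 (algebraMap_injective (h0.trans (map_zero _).symm))
  obtain ⟨F', rfl⟩ : algebraMap ℚ[X] (HyperRing ℚ (2 * g + 1)) A₁ ∣ F := by
    rw [← Ideal.mem_span_singleton, ← Ideal.span_singleton_le_iff_mem, hM, hMB, hJ]
    exact Ideal.mul_le_right.trans Ideal.mul_le_left
  have hF' : Ideal.span {F'} = I * idl κ' b' h' ^ 2 := by
    refine mul_left_cancel₀ (a := Ideal.span {algebraMap ℚ[X] (HyperRing ℚ (2 * g + 1)) A₁}) ?_ ?_
    · rwa [Ne, Ideal.zero_eq_bot, Ideal.span_singleton_eq_bot]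
    · rw [Ideal.span_singleton_mul_span_singleton, hM, hMB, hJ]
      ring
  refine ⟨F', ?_, ?_, fun G hG G₀ hG₀ => ?_⟩
  · rw [← Ideal.span_singleton_le_iff_mem, hF']
    exact Ideal.mul_le_left
  · have hm : norm (algebraMap ℚ[X] (HyperRing ℚ (2 * g + 1)) A₁ * F') = A₁ ^ 2 * norm F' := by
      rw [← QuadraticAlgebra.norm_algebraMap]
      exact map_mul _ _ _
    refine mul_left_cancel₀ (pow_ne_zero 2 hA₁0) ?_
    rw [← hm, hN]
    ring
  · rw [← Ideal.mem_span_singleton, hF', mul_comm (G ^ 2)]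
    exact Ideal.mul_mem_mul hG₀ (Ideal.pow_mem_pow hG 2)

end HyperRing

namespace HyperRing

open QuadraticAlgebra

variable {p : ℕ}

theorem isUnit_C_rat {m : ℤ} (hm : m ≠ 0) : IsUnit (C (m : ℚ)) :=
  isUnit_C.mpr (isUnit_iff_ne_zero.mpr (Int.cast_ne_zero.mpr hm))

theorem toRat_C_smul (m : ℤ) (F : HyperRing ℤ p) :
    toRat ((C m : ℤ[X]) • F) = (C (m : ℚ) : ℚ[X]) • toRat F := by
  have hC : (C m).map (Int.castRingHom ℚ) = C (m : ℚ) := map_C _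
  rw [map_smul, hC]

theorem toRat_injective : Function.Injective (toRat (p := p)) :=
  map_injective (RingHom.injective_int _)

theorem exists_C_smul_eq_toRat (T : HyperRing ℚ p) :
    ∃ (m : ℤ) (T' : HyperRing ℤ p), m ≠ 0 ∧ toRat T' = (C (m : ℚ) : ℚ[X]) • T := by
  obtain ⟨d, u, hd, hu⟩ := exists_int_smul_eq_map T.re
  obtain ⟨e, v, he, hv⟩ := exists_int_smul_eq_map T.im
  refine ⟨d * e, ⟨C e * u, C d * v⟩, mul_ne_zero hd he, QuadraticAlgebra.ext ?_ ?_⟩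
  · have hC : (C e).map (Int.castRingHom ℚ) = C (e : ℚ) := map_C _
    rw [map_re, re_smul, smul_eq_mul, Polynomial.map_mul, hu, hC, Int.cast_mul, Polynomial.C_mul]
    ring
  · have hC : (C d).map (Int.castRingHom ℚ) = C (d : ℚ) := map_C _
    rw [map_im, im_smul, smul_eq_mul, Polynomial.map_mul, hv, hC, Int.cast_mul, Polynomial.C_mul]
    ring

theorem exists_eq_C_smul {F : HyperRing ℤ p} (hF : F ≠ 0) :
    ∃ (m : ℤ) (G : HyperRing ℤ p), m ≠ 0 ∧ F = (C m : ℤ[X]) • G ∧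
      ∀ q : ℕ, q.Prime → red q G ≠ 0 := by
  set d := gcd F.re.content F.im.content with hd
  obtain ⟨u, hu⟩ : C d ∣ F.re := (dvd_content_iff_C_dvd).mp (gcd_dvd_left _ _)
  obtain ⟨v, hv⟩ : C d ∣ F.im := (dvd_content_iff_C_dvd).mp (gcd_dvd_right _ _)
  have hd0 : d ≠ 0 := by
    intro h0
    rw [h0, C_0, zero_mul] at hu hv
    exact hF (QuadraticAlgebra.ext hu hv)
  refine ⟨d, ⟨u, v⟩, hd0, QuadraticAlgebra.ext hu hv, fun q hq h0 => ?_⟩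
  obtain ⟨H, hH⟩ := red_eq_zero_iff.mp h0
  have h1 : d * q ∣ d := by
    refine dvd_gcd (dvd_content_iff_C_dvd.mpr ⟨H.re, ?_⟩) (dvd_content_iff_C_dvd.mpr ⟨H.im, ?_⟩)
    · have : u = C (q : ℤ) * H.re := congrArg QuadraticAlgebra.re hH
      rw [hu, this, Polynomial.C_mul, mul_assoc]
    · have : v = C (q : ℤ) * H.im := congrArg QuadraticAlgebra.im hH
      rw [hv, this, Polynomial.C_mul, mul_assoc]
  obtain ⟨c, hc⟩ := h1
  rw [mul_assoc, left_eq_mul₀ hd0] at hc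
  exact (Nat.prime_iff_prime_int.mp hq).not_isUnit (.of_mul_eq_one _ hc)

/-- Gauss's lemma. -/
theorem dvd_of_toRat_dvd (hp : Odd p) {F Y : HyperRing ℤ p}
    (hF : ∀ q : ℕ, q.Prime → red q F ≠ 0) (h : toRat F ∣ toRat Y) : F ∣ Y := by
  obtain ⟨T, hT⟩ := h
  obtain ⟨m, T', hm, hT'⟩ := exists_C_smul_eq_toRat T
  by_cases hT0 : T' = 0
  · have h0 : T = 0 := by
      have hz : (C (m : ℚ) : ℚ[X]) • T = 0 := by rw [← hT', hT0, map_zero]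
      have h1 := congrArg QuadraticAlgebra.re hz
      have h2 := congrArg QuadraticAlgebra.im hz
      rw [re_smul, smul_eq_mul, QuadraticAlgebra.re_zero, (isUnit_C_rat hm).mul_right_eq_zero] at h1
      rw [im_smul, smul_eq_mul, QuadraticAlgebra.im_zero, (isUnit_C_rat hm).mul_right_eq_zero] at h2
      exact QuadraticAlgebra.ext h1 h2
    rw [h0, mul_zero] at hT
    have : Y = 0 := toRat_injective (hT.trans (map_zero _).symm)
    exact this ▸ dvd_zero F
  obtain ⟨c, S, hc, hTS, hS⟩ := exists_eq_C_smul hT0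
  have heq : (C m : ℤ[X]) • Y = (C c : ℤ[X]) • (F * S) := by
    apply toRat_injective
    rw [toRat_C_smul, hT, ← mul_smul_comm, ← hT', hTS, toRat_C_smul, toRat_C_smul, map_mul,
      mul_smul_comm]
  obtain ⟨m', c', hg, d, hm', hc'⟩ :
      ∃ m' c' : ℤ, Int.gcd m' c' = 1 ∧ ∃ d, m = m' * d ∧ c = c' * d := by
    obtain ⟨m', c', hg, hm', hc'⟩ := Int.exists_gcd_one (Int.gcd_pos_of_ne_zero_left c hm)
    exact ⟨m', c', hg, _, hm', hc'⟩
  have heq' : (C m' : ℤ[X]) • Y = (C c' : ℤ[X]) • (F * S) := by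
    have hC0 : (C d : ℤ[X]) ≠ 0 := C_ne_zero.mpr fun h0 => hm (by rw [hm', h0, mul_zero])
    rw [hm', hc', Polynomial.C_mul, Polynomial.C_mul, mul_comm (C m'), mul_comm (C c'), mul_smul,
      mul_smul] at heq
    exact QuadraticAlgebra.ext (mul_left_cancel₀ hC0 (congrArg QuadraticAlgebra.re heq))
      (mul_left_cancel₀ hC0 (congrArg QuadraticAlgebra.im heq))
  have hunit : m'.natAbs = 1 := by
    by_contra hne
    obtain ⟨q, hq, hqm⟩ := Nat.exists_prime_and_dvd hne
    have hfact : Fact q.Prime := ⟨hq⟩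
    have hdom := isDomain (k := ZMod q) hp
    have h1 := congrArg (red q) heq'
    have hr (c : ℤ) (G : HyperRing ℤ p) : red q ((C c : ℤ[X]) • G) =
        (C (c : ZMod q) : (ZMod q)[X]) • red q G := by
      have hC : (C c).map (Int.castRingHom (ZMod q)) = C (c : ZMod q) := map_C _
      rw [red, map_smul, hC]
    rw [hr, hr, (ZMod.intCast_zmod_eq_zero_iff_dvd m' q).mpr (Int.natCast_dvd.mpr hqm), C_0,
      zero_smul, map_mul, Algebra.smul_def] at h1
    have h2 := (mul_eq_zero.mp h1.symm).resolve_right (mul_ne_zero (hF q hq) (hS q hq))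
    have h3 : C (c' : ZMod q) = 0 := algebraMap_injective (h2.trans (map_zero _).symm)
    rw [C_eq_zero, ZMod.intCast_zmod_eq_zero_iff_dvd] at h3
    have h4 := Int.dvd_coe_gcd (Int.natCast_dvd.mpr hqm) h3
    rw [hg] at h4
    exact hq.not_dvd_one (Int.natCast_dvd_natCast.mp h4)
  have hsq : m' * m' = 1 := by
    rcases Int.natAbs_eq m' with h | h <;> rw [h, hunit] <;> rfl
  refine ⟨(C (m' * c') : ℤ[X]) • S, ?_⟩
  rw [mul_smul_comm, Polynomial.C_mul, mul_smul, ← heq', ← mul_smul, ← Polynomial.C_mul, hsq, C_1,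
    one_smul]

end HyperRing

theorem exists_isPrimitive_eq_C_mul {b : ℚ[X]} (hb : b ≠ 0) :
    ∃ (c : ℚ) (β : ℤ[X]), c ≠ 0 ∧ β.IsPrimitive ∧ b = C c * β.map (Int.castRingHom ℚ) := by
  obtain ⟨d, β, hd, hβ⟩ := exists_int_smul_eq_map b
  have hd' : (d : ℚ) ≠ 0 := Int.cast_ne_zero.mpr hd
  have hβ0 : β ≠ 0 := by
    rintro rfl
    rw [Polynomial.map_zero] at hβ
    exact hb ((isUnit_C.mpr (isUnit_iff_ne_zero.mpr hd')).mul_right_eq_zero.mp hβ.symm)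
  refine ⟨(d : ℚ)⁻¹ * β.content, β.primPart, mul_ne_zero (inv_ne_zero hd')
    (Int.cast_ne_zero.mpr (content_eq_zero_iff.not.mpr hβ0)), β.isPrimitive_primPart, ?_⟩
  have hC : (C β.content).map (Int.castRingHom ℚ) = C (β.content : ℚ) := map_C _
  rw [Polynomial.C_mul, mul_assoc, ← hC, ← Polynomial.map_mul, ← eq_C_content_mul_primPart, hβ,
    ← mul_assoc, ← Polynomial.C_mul, inv_mul_cancel₀ hd', C_1, one_mul]

namespace DescentDatum

open QuadraticAlgebra HyperRing

variable {g n : ℕ} {L : Type*} [Field L] [NumberField L]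
variable {L₂ : Type*} [Field L₂] [Algebra ℚ_[2] L₂] {α : L} {lam : L₂} {ι : L →+* L₂}

theorem exists_half (D : DescentDatum g n) (hn : 2 ≤ n) (hp : (2 * g + 1).Prime) (hg : 0 < g)
    (h1 : ¬ (2 * g + 1) ^ 2 ∣ 2 ^ (2 * g + 1 - 1) - 1) (h2 : Odd (NumberField.classNumber L))
    (hα : α ^ (2 * g + 1) = 2) (hdeg : Module.finrank ℚ L = 2 * g + 1)
    (hlam : lam ^ (2 * g + 1) = 2) (hdeg2 : Module.finrank ℚ_[2] L₂ = 2 * g + 1) (hι : ι α = lam) :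
    ∃ (κ' : ℤ[X]) (b' : ℚ[X])
      (h' : κ'.map (Int.castRingHom ℚ) ∣ b' ^ 2 + b' - X ^ (2 * g + 1)), κ'.IsPrimitive ∧
      κ'.natDegree ≤ g ∧ ∃ F ∈ idlInt D.κ D.b D.dvd, (∀ q : ℕ, q.Prime → red q F ≠ 0) ∧
      (∃ ν : ℤ, Odd ν ∧ QuadraticAlgebra.norm F = C ν * D.κ * κ' ^ 2) ∧
      ∀ G ∈ idlInt κ' b' h', ∀ G₀ ∈ idlInt D.κ D.b D.dvd, F ∣ G ^ 2 * G₀ := by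
  have hp2 : 2 * g + 1 ≠ 2 := by lia
  have hodd : Odd (2 * g + 1) := odd_two_mul_add_one g
  obtain ⟨ν, s, hν, hs⟩ := D.exists_sq_eq_aeval hn hp hg h1 h2 hα hdeg hlam hdeg2 hι
  have hν0 : ν ≠ 0 := by rintro rfl; exact absurd hν (by decide)
  have hκ0 : D.κ.map (Int.castRingHom ℚ) ≠ 0 :=
    (Polynomial.map_ne_zero_iff (RingHom.injective_int _)).mpr D.prim.ne_zero
  have hκd : (D.κ.map (Int.castRingHom ℚ)).natDegree ≤ g := natDegree_map_le.trans D.natDegree_κ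
  obtain ⟨F₁, hF₁, A, hA, hAd, hN⟩ := exists_norm_eq_mul_sq (h := D.dvd) (ν := (ν : ℚ)) (s := s)
    hodd hdeg (four_mul_neg_inv_sq_pow hodd hα two_ne_zero)
    (fun q hq hqd => aeval_neg_inv_sq_ne_zero hp hp2 hα hq hqd) hκ0 hκd (by
      rw [hs, map_intCast]
      congr 1
      exact (aeval_map_algebraMap ℚ _ D.κ).symm)
  obtain ⟨κ₁, b', h₁, hκA, F₂, hF₂, hN₂, hdiv⟩ := HyperRing.exists_half hp hp2 hκ0 (by lia)
    (Int.cast_ne_zero.mpr hν0) hF₁ hA hN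
  have hκ₁0 : κ₁ ≠ 0 := ne_zero_of_dvd_ne_zero hA hκA
  obtain ⟨c, κ', hc, hprim, hκ'⟩ := exists_isPrimitive_eq_C_mul hκ₁0
  have hcu : IsUnit (C c) := isUnit_C.mpr (isUnit_iff_ne_zero.mpr hc)
  have hκd' : κ'.natDegree ≤ g := by
    have := natDegree_le_of_dvd hκA hA
    rw [hκ', natDegree_C_mul hc, natDegree_map_eq_of_injective (RingHom.injective_int _)] at this
    lia
  have h' : κ'.map (Int.castRingHom ℚ) ∣ b' ^ 2 + b' - X ^ (2 * g + 1) :=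
    dvd_trans ⟨C c, by rw [hκ', mul_comm]⟩ h₁
  have hF₂0 : F₂ ≠ 0 := by
    rintro rfl
    rw [QuadraticAlgebra.norm_zero] at hN₂
    exact mul_ne_zero (mul_ne_zero (C_ne_zero.mpr (Int.cast_ne_zero.mpr hν0)) hκ0)
      (pow_ne_zero 2 hκ₁0) hN₂.symm
  obtain ⟨m, T, hm, hT⟩ := exists_C_smul_eq_toRat F₂
  have hT0 : T ≠ 0 := by
    rintro rfl
    rw [map_zero] at hT
    refine hF₂0 (QuadraticAlgebra.ext ?_ ?_)
    · exact ((isUnit_C_rat hm).mul_right_eq_zero).mp (congrArg QuadraticAlgebra.re hT).symm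
    · exact ((isUnit_C_rat hm).mul_right_eq_zero).mp (congrArg QuadraticAlgebra.im hT).symm
  obtain ⟨e, F, he, hTF, hFprim⟩ := exists_eq_C_smul hT0
  have hFF : (C (e : ℚ) : ℚ[X]) • toRat F = (C (m : ℚ) : ℚ[X]) • F₂ := by
    rw [← toRat_C_smul, ← hTF, hT]
  have hFmem : F ∈ idlInt D.κ D.b D.dvd := by
    refine mem_idlInt_of_C_smul_mem he ?_
    change toRat _ ∈ idl _ D.b D.dvd
    rw [toRat_C_smul, hFF, Algebra.smul_def]
    exact Ideal.mul_mem_left _ _ hF₂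
  have hFN : C (e : ℚ) ^ 2 * (QuadraticAlgebra.norm F).map (Int.castRingHom ℚ) =
      C (m : ℚ) ^ 2 * (C (ν : ℚ) * C c ^ 2) *
        ((D.κ * κ' ^ 2).map (Int.castRingHom ℚ)) := by
    rw [← HyperRing.norm_map, ← HyperRing.norm_smul]
    change QuadraticAlgebra.norm ((C (e : ℚ) : ℚ[X]) • toRat F) = _
    rw [hFF, HyperRing.norm_smul, hN₂, hκ', Polynomial.map_mul, Polynomial.map_pow]
    ring
  have hKprim : (D.κ * κ' ^ 2).IsPrimitive := D.prim.mul (by rw [pow_two]; exact hprim.mul hprim)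
  obtain ⟨Q, hQ⟩ : D.κ * κ' ^ 2 ∣ QuadraticAlgebra.norm F := by
    rw [IsPrimitive.Int.dvd_iff_map_cast_dvd_map_cast _ _ hKprim,
      ← ((isUnit_C_rat he).pow 2).dvd_mul_left, hFN]
    exact dvd_mul_left _ _
  have hQC : Q.natDegree = 0 := by
    have hK0 : (D.κ * κ' ^ 2).map (Int.castRingHom ℚ) ≠ 0 :=
      (Polynomial.map_ne_zero_iff (RingHom.injective_int _)).mpr hKprim.ne_zero
    rw [hQ, Polynomial.map_mul, mul_left_comm, mul_comm] at hFN
    have hcan := mul_right_cancel₀ hK0 hFN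
    rw [← natDegree_map_eq_of_injective (RingHom.injective_int (Int.castRingHom ℚ)),
      ← natDegree_C_mul (pow_ne_zero 2 (Int.cast_ne_zero.mpr he) : (e : ℚ) ^ 2 ≠ 0),
      Polynomial.C_pow, hcan, ← Polynomial.C_pow, ← Polynomial.C_pow,
      ← Polynomial.C_mul, ← Polynomial.C_mul, natDegree_C]
  rw [eq_C_of_natDegree_eq_zero hQC] at hQ
  set ν' := Q.coeff 0
  refine ⟨κ', b', h', hprim, hκd', F, hFmem, hFprim, ⟨ν', ?_, by rw [hQ]; ring⟩,
    fun G hG G₀ hG₀ => ?_⟩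
  · have h3 := (norm_eq_zero (k := ZMod 2) hodd).not.mpr (hFprim 2 Nat.prime_two)
    rw [red, HyperRing.norm_map, hQ] at h3
    rw [← Int.not_even_iff_odd, even_iff_two_dvd]
    intro h4
    refine h3 (redPoly_eq_zero_iff.mpr (dvd_mul_of_dvd_right (map_dvd C h4) _))
  · refine dvd_of_toRat_dvd hodd hFprim ?_
    have h3 : toRat G ∈ idl κ₁ b' h₁ := by
      rw [mem_idl, hκ', hcu.mul_left_dvd]
      exact hG
    have h4 := hdiv _ h3 _ hG₀
    rw [map_mul, map_pow]
    refine dvd_trans ⟨algebraMap _ _ (C ((m : ℚ)⁻¹ * e)), ?_⟩ h4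
    rw [mul_comm (toRat F), ← Algebra.smul_def, Polynomial.C_mul, mul_smul, hFF, ← mul_smul,
      ← Polynomial.C_mul, inv_mul_cancel₀ (Int.cast_ne_zero.mpr hm), C_1, one_smul]

end DescentDatum

/-- The reduction modulo two of a saturated lattice has the dimension of the lattice. -/
theorem finrank_le_and_surjOn_of_ker {M V E : Type*} [AddCommGroup M] [Module.Free ℤ M]
    [Module.Finite ℤ M] [AddCommGroup V] [Module ℚ V] [Module.Finite ℚ V] [AddCommGroup E]
    [Module (ZMod 2) E] (f : M →ₗ[ℤ] V) (φ : LinearMap.ker f →+ E) (S : Submodule (ZMod 2) E)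
    [Module.Finite (ZMod 2) S] (hS : ∀ x, φ x ∈ S)
    (hφ : ∀ x, φ x = 0 → ∃ y : M, (x : M) = (2 : ℤ) • y) :
    Module.finrank ℤ M ≤ Module.finrank ℚ V + Module.finrank (ZMod 2) S ∧
      (Module.finrank ℚ V + Module.finrank (ZMod 2) S ≤ Module.finrank ℤ M →
        ∀ e ∈ S, ∃ x, φ x = e) := by
  have hrank : Module.finrank ℤ M ≤ Module.finrank ℚ V + Module.finrank ℤ (LinearMap.ker f) := by
    rw [← (LinearMap.ker f).finrank_quotient_add_finrank]
    refine Nat.add_le_add_right ?_ _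
    rw [f.quotKerEquivRange.finrank_eq]
    refine Module.finrank_le_of_rank_le ?_
    rw [Module.finrank_eq_rank, IsLocalization.rank_eq ℚ (nonZeroDivisors ℤ) le_rfl]
    exact Submodule.rank_le _
  set b := Module.finBasis ℤ (LinearMap.ker f)
  let v : Fin (Module.finrank ℤ (LinearMap.ker f)) → S := fun i => ⟨φ (b i), hS _⟩
  have hv (c : Fin (Module.finrank ℤ (LinearMap.ker f)) → ZMod 2) :
      ((∑ i, c i • v i : S) : E) = φ (∑ i, ((c i).cast : ℤ) • b i) := by
    simp only [Submodule.coe_sum, Submodule.coe_smul, map_sum, map_zsmul]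
    refine Finset.sum_congr rfl fun i _ => ?_
    rw [← Int.cast_smul_eq_zsmul (ZMod 2), ZMod.intCast_zmod_cast]
  have hli : LinearIndependent (ZMod 2) v := by
    rw [Fintype.linearIndependent_iff]
    intro c hc i
    obtain ⟨y, hy⟩ := hφ _ ((hv c).symm.trans (congrArg Subtype.val hc))
    have hyk : y ∈ LinearMap.ker f := by
      have h1 : f ((∑ i, ((c i).cast : ℤ) • b i : LinearMap.ker f) : M) = 0 :=
        LinearMap.map_coe_ker f _
      rw [hy, map_smul, ← Int.cast_smul_eq_zsmul ℚ] at h1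
      exact (smul_eq_zero.mp h1).resolve_left (by norm_num)
    have h2 : (∑ i, ((c i).cast : ℤ) • b i : LinearMap.ker f) = (2 : ℤ) • ⟨y, hyk⟩ := Subtype.ext hy
    have h3 := congrArg (fun x => b.repr x i) h2
    simp only [map_sum, map_smul, Finsupp.coe_finsetSum, Finset.sum_apply, Finsupp.smul_apply,
      b.repr_self, Finsupp.single_apply, smul_eq_mul, mul_ite, mul_one, mul_zero,
      Finset.sum_ite_eq', Finset.mem_univ, if_true] at h3
    rw [← ZMod.intCast_zmod_cast (c i), h3, Int.cast_mul]
    exact mul_eq_zero_of_left rfl _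
  have hcard := hli.fintype_card_le_finrank
  rw [Fintype.card_fin] at hcard
  refine ⟨by lia, fun hle e he => ?_⟩
  have htop := hli.span_eq_top_of_card_eq_finrank' (by rw [Fintype.card_fin]; lia)
  have he' : (⟨e, he⟩ : S) ∈ Submodule.span (ZMod 2) (Set.range v) := htop ▸ Submodule.mem_top
  obtain ⟨c, hc⟩ := (Submodule.mem_span_range_iff_exists_fun _).mp he'
  exact ⟨_, (hv c).symm.trans (congrArg Subtype.val hc)⟩

theorem Polynomial.exists_sqrt_generator {k : Type*} [Field k] [CharP k 2] {κ : k[X]} (hκ : κ ≠ 0) :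
    ∃ ψ : k[X], ψ ≠ 0 ∧ κ ∣ ψ ^ 2 ∧ ∀ z, κ ∣ z ^ 2 → ψ ∣ z := by
  obtain ⟨ψ, hψ⟩ := IsPrincipalIdealRing.principal
    ((Ideal.span {κ}).comap (frobenius k[X] 2))
  have hmem (z : k[X]) : ψ ∣ z ↔ κ ∣ z ^ 2 := by
    rw [← Ideal.mem_span_singleton (x := z), ← Ideal.mem_span_singleton, ← frobenius_def,
      ← Ideal.mem_comap, hψ]
  have h2 := (hmem ψ).mp dvd_rfl
  refine ⟨ψ, ?_, h2, fun z => (hmem z).mpr⟩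
  rintro rfl
  have := (hmem κ).mpr (dvd_pow_self κ two_ne_zero)
  exact hκ (zero_dvd_iff.mp this)

namespace HyperRing

open QuadraticAlgebra

theorem exists_smul_of_smul_eq_sq {k : Type*} [Field k] [CharP k 2] {p m d : ℕ} (hp : Odd p)
    (hm : m < p) {κ ψ τ A : k[X]} (hψ0 : ψ ≠ 0) (hτ : ψ ^ 2 = κ * τ) (hψ : ∀ z, κ ∣ z ^ 2 → ψ ∣ z)
    {G W : HyperRing k p} (hW : κ • W = G ^ 2) (hN : norm G = κ * A) (hA : A.natDegree ≤ m)
    (hd : m + 2 ≤ 2 * d + τ.natDegree + 1) :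
    ∃ z ∈ degreeLT k d, G = algebraMap k[X] _ (ψ * z) := by
  have hre := congrArg QuadraticAlgebra.re hW
  have him := congrArg QuadraticAlgebra.im hW
  rw [pow_two, re_mul, re_smul, smul_eq_mul] at hre
  rw [pow_two, im_mul, im_smul, smul_eq_mul] at him
  obtain ⟨V, hV⟩ : ψ ∣ G.im := hψ _ ⟨-W.im, by
    linear_combination him + G.re * G.im * CharTwo.two_eq_zero (R := k[X])⟩
  obtain ⟨U, hU⟩ : ψ ∣ G.re := hψ _ ⟨W.re + X ^ p * W.im, by
    linear_combination -hre - X ^ p * him - X ^ p * G.re * G.im * CharTwo.two_eq_zero (R := k[X])⟩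
  set T : HyperRing k p := ⟨U, V⟩ with hT
  have hGT : G = ψ • T := QuadraticAlgebra.ext hU hV
  have hκ0 : κ ≠ 0 := left_ne_zero_of_mul (hτ ▸ pow_ne_zero 2 hψ0)
  have hτ0 : τ ≠ 0 := right_ne_zero_of_mul (hτ ▸ pow_ne_zero 2 hψ0)
  have hTA : τ * norm T = A := by
    refine mul_left_cancel₀ hκ0 ?_
    rw [← hN, hGT, HyperRing.norm_smul, hτ, mul_assoc]
  by_cases hT0 : norm T = 0
  · rw [norm_eq_zero hp] at hT0
    refine ⟨0, Submodule.zero_mem _, ?_⟩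
    rw [hGT, hT0, smul_zero, mul_zero, map_zero]
  have hTd : τ.natDegree + (norm T).natDegree ≤ m := by
    rwa [← natDegree_mul hτ0 hT0, hTA]
  obtain ⟨h1, h2⟩ := (natDegree_norm_le_iff hp).mp (le_refl (norm T).natDegree)
  have hV0 : V = 0 := by
    by_contra hV0
    have := h2 hV0
    lia
  refine ⟨U, ?_, QuadraticAlgebra.ext ?_ ?_⟩
  · rw [mem_degreeLT]
    refine degree_le_natDegree.trans_lt (Nat.cast_lt.mpr ?_)
    change 2 * U.natDegree ≤ _ at h1
    lia
  · rw [hU, algebraMap_re]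
  · rw [hV, hV0, mul_zero, algebraMap_im]

variable {g : ℕ} {κ : ℤ[X]} {b : ℚ[X]}
  {h : κ.map (Int.castRingHom ℚ) ∣ b ^ 2 + b - X ^ (2 * g + 1)}

theorem exists_sqrt_lift (hκ : κ.IsPrimitive)
    (hdiv : ∀ G ∈ idlInt κ b h, ∃ W, redPoly 2 κ • W = red 2 G ^ 2) :
    ∃ ψ, ψ ^ 2 = redPoly 2 κ ∧ ∀ z : (ZMod 2)[X], z.natDegree ≤ g →
      ∃ G ∈ idlInt κ b h, (norm G).natDegree ≤ 2 * g + κ.natDegree ∧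
        red 2 G = algebraMap (ZMod 2)[X] _ (ψ * z) := by
  have hodd : Odd (2 * g + 1) := odd_two_mul_add_one g
  have hκ2 := redPoly_ne_zero hκ 2
  obtain ⟨ψ, hψ0, ⟨τ, hτ⟩, hψ⟩ := exists_sqrt_generator hκ2
  set m := 2 * g + κ.natDegree with hm
  set n₁ := m / 2 + 1 with hn₁
  set n₂ := (m + 2 - (2 * g + 1)) / 2 with hn₂
  set d := g + 1 - (τ.natDegree + 1) / 2 with hd
  have hf₁ := finite_degreeLT (k := ℤ) n₁
  have hf₂ := finite_degreeLT (k := ℤ) n₂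
  have hf₁' := free_degreeLT (k := ℤ) n₁
  have hf₂' := free_degreeLT (k := ℤ) n₂
  have hf₃ := finite_degreeLT (k := ZMod 2) d
  have hκ0 : κ.map (Int.castRingHom ℚ) ≠ 0 :=
    (Polynomial.map_ne_zero_iff (RingHom.injective_int _)).mpr hκ.ne_zero
  have hf₄ : Module.Finite ℚ (ℚ[X] ⧸ Ideal.span {κ.map (Int.castRingHom ℚ)}) :=
    (AdjoinRoot.powerBasis hκ0).finite
  let f : (degreeLT ℤ n₁ × degreeLT ℤ n₂) →ₗ[ℤ] (ℚ[X] ⧸ Ideal.span {κ.map (Int.castRingHom ℚ)}) :=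
    AddMonoidHom.toIntLinearMap (AddMonoidHom.mk' (fun v => Ideal.Quotient.mk _
      ((v.1 : ℤ[X]).map (Int.castRingHom ℚ) + b * (v.2 : ℤ[X]).map (Int.castRingHom ℚ)))
      fun v w => by
        simp only [Prod.fst_add, Prod.snd_add, Submodule.coe_add, ← map_add, Polynomial.map_add]
        congr 1
        ring)
  let φ : LinearMap.ker f →+ (ZMod 2)[X] := AddMonoidHom.mk' (fun v => redPoly 2 (v.1.1 : ℤ[X]))
    fun v w => by
      simp only [Submodule.coe_add, Prod.fst_add, map_add]
  let S := (degreeLT (ZMod 2) d).map (LinearMap.mulLeft (ZMod 2) ψ)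
  have hSd : Module.finrank (ZMod 2) S ≤ d :=
    (Submodule.finrank_map_le _ _).trans (finrank_degreeLT d).le
  let G (v : LinearMap.ker f) : HyperRing ℤ (2 * g + 1) := ⟨v.1.1, v.1.2⟩
  have hGm (v) : G v ∈ idlInt κ b h := by
    have hv : Ideal.Quotient.mk _ _ = 0 := LinearMap.map_coe_ker f v
    rwa [Ideal.Quotient.eq_zero_iff_mem, Ideal.mem_span_singleton] at hv
  have hGd (v) : (norm (G v)).natDegree ≤ m :=
    (natDegree_norm_le_iff_mem_degreeLT hodd).mpr ⟨v.1.1.2, v.1.2.2⟩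
  have hGr (v) : ∃ z ∈ degreeLT (ZMod 2) d, red 2 (G v) = algebraMap (ZMod 2)[X] _ (ψ * z) := by
    obtain ⟨W, hW⟩ := hdiv _ (hGm v)
    obtain ⟨A, hA⟩ := dvd_norm_int hκ (hGm v)
    refine exists_smul_of_smul_eq_sq hodd (Nat.lt_succ_self _) hψ0 hτ hψ hW (A := redPoly 2 A) ?_ ?_ ?_
    · rw [red, norm_map, hA]
      exact map_mul (redPoly 2) _ _
    · refine natDegree_map_le.trans ?_
      by_cases hA0 : A = 0
      · rw [hA0, natDegree_zero]
        exact Nat.zero_le _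
      have := hGd v
      rw [hA, natDegree_mul hκ.ne_zero hA0] at this
      lia
    · lia
  have key := finrank_le_and_surjOn_of_ker f φ S (fun v => ?_) (fun v hv => ?_)
  · have hM : Module.finrank ℤ (degreeLT ℤ n₁ × degreeLT ℤ n₂) = κ.natDegree + (g + 1) := by
      rw [Module.finrank_prod, finrank_degreeLT, finrank_degreeLT]
      lia
    have hV : Module.finrank ℚ (ℚ[X] ⧸ Ideal.span {κ.map (Int.castRingHom ℚ)}) = κ.natDegree := by
      rw [finrank_quotient_span_eq_natDegree, natDegree_map_eq_of_injective (RingHom.injective_int _)]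
    rw [hM, hV] at key
    have hτ0 : τ.natDegree = 0 := by lia
    have hτ1 : τ = 1 := by
      rw [eq_C_of_natDegree_eq_zero hτ0] at hτ ⊢
      have hne : τ.coeff 0 ≠ 0 := by
        intro h0
        rw [h0, C_0, mul_zero] at hτ
        exact hψ0 (pow_eq_zero_iff two_ne_zero |>.mp hτ)
      rw [show τ.coeff 0 = 1 by revert hne; generalize τ.coeff 0 = t; revert t; decide, C_1]
    rw [hτ1, mul_one] at hτ
    refine ⟨ψ, hτ, fun z hz => ?_⟩
    obtain ⟨v, hv⟩ := key.2 (by lia) (ψ * z) ⟨z, mem_degreeLT_succ_iff.mpr hz |> fun h => by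
      rwa [show d = g + 1 by lia], rfl⟩
    refine ⟨G v, hGm v, hGd v, ?_⟩
    obtain ⟨z', -, hz'⟩ := hGr v
    have h1 : redPoly 2 (v.1.1 : ℤ[X]) = ψ * z' := congrArg QuadraticAlgebra.re hz'
    have h2 : ψ * z' = ψ * z := h1.symm.trans hv
    rw [hz', h2]
  · obtain ⟨z, hz, hzG⟩ := hGr v
    exact ⟨z, hz, (congrArg QuadraticAlgebra.re hzG).symm⟩
  · obtain ⟨z, hz, hzG⟩ := hGr v
    have hre : redPoly 2 (v.1.1 : ℤ[X]) = 0 := hv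
    have him : redPoly 2 (v.1.2 : ℤ[X]) = 0 := congrArg QuadraticAlgebra.im hzG
    obtain ⟨u, hu⟩ := redPoly_eq_zero_iff.mp hre
    obtain ⟨w, hw⟩ := redPoly_eq_zero_iff.mp him
    have hmem {r s : ℤ[X]} {l : ℕ} (hr : r ∈ degreeLT ℤ l) (hrs : r = C ((2 : ℕ) : ℤ) * s) :
        s ∈ degreeLT ℤ l := by
      rw [mem_degreeLT] at hr ⊢
      rwa [hrs, degree_C_mul (by norm_num)] at hr
    refine ⟨(⟨u, hmem v.1.1.2 hu⟩, ⟨w, hmem v.1.2.2 hw⟩), Prod.ext (Subtype.ext ?_)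
      (Subtype.ext ?_)⟩
    · exact hu.trans (smul_eq_C_mul _).symm
    · exact hw.trans (smul_eq_C_mul _).symm

end HyperRing

namespace HyperRing

open QuadraticAlgebra

theorem eq_algebraMap_of_norm_eq_sq {k : Type*} [Field k] [CharP k 2] {p m : ℕ} (hp : Odd p)
    (hm : m < p) {F : HyperRing k p} {c : k[X]} (hF : norm F = c ^ 2) (hc : 2 * c.natDegree ≤ m) :
    F = algebraMap k[X] _ c := by
  have hd : (norm F).natDegree ≤ m := by rwa [hF, natDegree_pow]
  obtain ⟨-, h2⟩ := (natDegree_norm_le_iff hp).mp hd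
  have hV : F.im = 0 := by
    by_contra hV
    have := h2 hV
    lia
  refine QuadraticAlgebra.ext ?_ hV
  rw [norm_apply, hV, mul_zero, zero_pow two_ne_zero, mul_zero, sub_zero, sub_zero] at hF
  exact CharTwo.sq_inj.mp hF

theorem smul_right_injective' {k : Type*} [CommRing k] [IsDomain k] {p : ℕ} {c : k[X]} (hc : c ≠ 0)
    {F G : HyperRing k p} (h : c • F = c • G) : F = G :=
  QuadraticAlgebra.ext (mul_left_cancel₀ hc (congrArg QuadraticAlgebra.re h))
    (mul_left_cancel₀ hc (congrArg QuadraticAlgebra.im h))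

theorem red_smul {p : ℕ} (q : ℕ) (r : ℤ[X]) (F : HyperRing ℤ p) :
    red q (r • F) = redPoly q r • red q F := map_smul _ _ _

theorem norm_red {p : ℕ} (q : ℕ) (F : HyperRing ℤ p) : norm (red q F) = redPoly q (norm F) :=
  HyperRing.norm_map _ _

theorem star_algebraMap' {k : Type*} [CommRing k] {p : ℕ} (r : k[X]) :
    star (algebraMap k[X] (HyperRing k p) r) = algebraMap k[X] _ r := by
  ext1 <;> simp

end HyperRing

theorem redPoly_C_of_odd {ν : ℤ} (hν : Odd ν) : redPoly 2 (C ν) = 1 := by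
  rw [coe_mapRingHom, map_C, eq_intCast]
  obtain ⟨m, rfl⟩ := hν
  have : (2 : ZMod 2) = 0 := rfl
  rw [Int.cast_add, Int.cast_mul, Int.cast_ofNat, this, zero_mul, zero_add, Int.cast_one, C_1]

namespace DescentDatum

open QuadraticAlgebra HyperRing

variable {g n : ℕ} {L : Type*} [Field L] [NumberField L]
variable {L₂ : Type*} [Field L₂] [Algebra ℚ_[2] L₂] {α : L} {lam : L₂} {ι : L →+* L₂}

theorem red_Ψ (D : DescentDatum g n) (hn : 1 ≤ n) :
    red 2 D.Ψ = algebraMap (ZMod 2)[X] _ (X ^ g) := by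
  refine QuadraticAlgebra.ext D.red_re ?_
  have him : redPoly 2 D.Ψ.im = 0 := by
    rw [D.im_eq, map_mul, map_pow, redPoly_two_two, zero_pow (by lia), zero_mul]
  rw [algebraMap_im]
  exact him

theorem exists_pred (D : DescentDatum g n) (hn : 2 ≤ n) (hp : (2 * g + 1).Prime) (hg : 0 < g)
    (h1 : ¬ (2 * g + 1) ^ 2 ∣ 2 ^ (2 * g + 1 - 1) - 1) (h2 : Odd (NumberField.classNumber L))
    (hα : α ^ (2 * g + 1) = 2) (hdeg : Module.finrank ℚ L = 2 * g + 1)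
    (hlam : lam ^ (2 * g + 1) = 2) (hdeg2 : Module.finrank ℚ_[2] L₂ = 2 * g + 1) (hι : ι α = lam) :
    Nonempty (DescentDatum g (n - 1)) := by
  have hodd : Odd (2 * g + 1) := odd_two_mul_add_one g
  have hdomZ := isDomain (k := ℤ) hodd
  have hdom2 := isDomain (k := ZMod 2) hodd
  obtain ⟨κ, b, h, hκ, hκd, F, hF, hFp, ⟨ν, hν, hFN⟩, hdiv⟩ :=
    D.exists_half hn hp hg h1 h2 hα hdeg hlam hdeg2 hι
  have hν0 : ν ≠ 0 := by rintro rfl; exact absurd hν (by decide)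
  have hκ2 := redPoly_ne_zero hκ 2
  obtain ⟨F₀, hF₀⟩ := exists_mul_star_eq_smul_int D.prim hF D.mem₀
  have hF₀N : norm F₀ = C ν * κ ^ 2 * D.A₀ := by
    have := congrArg QuadraticAlgebra.norm hF₀
    rw [map_mul, QuadraticAlgebra.norm_star, hFN, D.norm₀, HyperRing.norm_smul] at this
    refine mul_left_cancel₀ (pow_ne_zero 2 D.prim.ne_zero) ?_
    linear_combination -this
  have hF₀2 : red 2 F₀ = algebraMap (ZMod 2)[X] _ (redPoly 2 κ) := by
    refine eq_algebraMap_of_norm_eq_sq hodd (Nat.lt_succ_self (2 * g)) ?_ ?_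
    · rw [norm_red, hF₀N, map_mul, map_mul, redPoly_C_of_odd hν, D.red₀, map_pow, one_mul, mul_one]
    · have : (redPoly 2 κ).natDegree ≤ g := natDegree_map_le.trans hκd
      lia
  have hquot {T G Y Q : HyperRing ℤ (2 * g + 1)} (hT : G ^ 2 * Y = F * T)
      (hY : Y * star D.G₀ = D.κ • Q) : T * F₀ = G ^ 2 * Q := by
    refine smul_right_injective' D.prim.ne_zero ?_
    rw [← mul_smul_comm, ← mul_smul_comm, ← hF₀, ← hY]
    linear_combination -star D.G₀ * hT
  have hA₀ : D.G₀ * star D.G₀ = D.κ • algebraMap ℤ[X] _ D.A₀ := by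
    rw [mul_star_self, D.norm₀, map_mul, Algebra.smul_def]
  have hA2 : red 2 (algebraMap ℤ[X] (HyperRing ℤ (2 * g + 1)) D.A₀) = 1 := by
    refine QuadraticAlgebra.ext D.red₀ ?_
    change redPoly 2 0 = 0
    rw [map_zero]
  obtain ⟨ψ, hψ, hlift⟩ := exists_sqrt_lift (h := h) hκ fun G hG => by
    obtain ⟨T, hT⟩ := hdiv G hG _ D.mem₀
    have := congrArg (red 2) (hquot hT hA₀)
    rw [map_mul, map_mul, hF₀2, hA2, mul_one] at this
    refine ⟨red 2 T, ?_⟩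
    rw [Algebra.smul_def, mul_comm (algebraMap _ _ _), this]
    exact map_pow (red 2) G 2
  have hψ0 : ψ ≠ 0 := by
    rintro rfl
    rw [zero_pow two_ne_zero] at hψ
    exact hκ2 hψ.symm
  obtain ⟨G₀, hG₀, hG₀d, hG₀2⟩ := hlift 1 (by rw [natDegree_one]; exact Nat.zero_le _)
  obtain ⟨G₁, hG₁, hG₁d, hG₁2⟩ := hlift (X ^ g) (natDegree_X_pow_le g)
  rw [mul_one] at hG₀2
  obtain ⟨A₀, hA₀'⟩ := dvd_norm_int hκ hG₀
  obtain ⟨A₁, hA₁'⟩ := dvd_norm_int hκ hG₁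
  have hdegA {G : HyperRing ℤ (2 * g + 1)} {A : ℤ[X]}
      (hGd : (norm G).natDegree ≤ 2 * g + κ.natDegree) (hA : norm G = κ * A) :
      A.natDegree ≤ 2 * g := by
    by_cases hA0 : A = 0
    · rw [hA0, natDegree_zero]
      exact Nat.zero_le _
    rw [hA, natDegree_mul hκ.ne_zero hA0] at hGd
    lia
  have hredA {G : HyperRing ℤ (2 * g + 1)} {A : ℤ[X]} {z : (ZMod 2)[X]}
      (hG : red 2 G = algebraMap (ZMod 2)[X] _ (ψ * z)) (hA : norm G = κ * A) :
      redPoly 2 A = z ^ 2 := by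
    have := congrArg (redPoly 2) hA
    rw [← norm_red, hG, QuadraticAlgebra.norm_algebraMap, map_mul, ← hψ, mul_pow] at this
    exact (mul_left_cancel₀ (pow_ne_zero 2 hψ0) this).symm
  obtain ⟨Φ, hΦ⟩ := exists_mul_star_eq_smul_int hκ hG₁ hG₀
  obtain ⟨E, hE⟩ := hdiv _ hG₀ _ D.mem₀
  obtain ⟨K, hK⟩ := hdiv _ hG₁ _ D.mem₁
  have hA₀d := hdegA hG₀d hA₀'
  have hA₁d := hdegA hG₁d hA₁'
  have hΦ2 : red 2 Φ = algebraMap (ZMod 2)[X] _ (X ^ g) := by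
    have := congrArg (red 2) hΦ
    have hs : red 2 (star G₀) = star (red 2 G₀) := HyperRing.map_star _ _
    rw [map_mul, red_smul, ← hψ, hs, hG₁2, hG₀2, star_algebraMap', ← map_mul] at this
    refine smul_right_injective' (pow_ne_zero 2 hψ0) ?_
    rw [← this, Algebra.smul_def, ← map_mul]
    congr 1
    ring
  have hcancel {T Y : HyperRing ℤ (2 * g + 1)} {r z : (ZMod 2)[X]} (hT : T * F₀ = Y)
      (hY : red 2 Y = algebraMap (ZMod 2)[X] _ r) (hr : r = z * ψ ^ 2) :
      red 2 T = algebraMap (ZMod 2)[X] _ z := by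
    have := congrArg (red 2) hT
    rw [map_mul, hF₀2, hY, ← hψ, hr, map_mul (algebraMap _ _) z] at this
    refine mul_right_cancel₀ ?_ this
    exact fun h0 => pow_ne_zero 2 hψ0 (algebraMap_injective (h0.trans (map_zero _).symm))
  have hsq (G Y : HyperRing ℤ (2 * g + 1)) : red 2 (G ^ 2 * Y) = red 2 G * red 2 G * red 2 Y := by
    rw [pow_two, map_mul, map_mul]
  have hE2 : red 2 E = 1 := by
    rw [← map_one (algebraMap (ZMod 2)[X] (HyperRing (ZMod 2) (2 * g + 1)))]
    refine hcancel (hquot hE hA₀) (r := ψ ^ 2) ?_ (one_mul _).symm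
    rw [hsq, hA2, hG₀2, mul_one, ← map_mul, pow_two]
  have hK2 : red 2 K = algebraMap (ZMod 2)[X] _ (X ^ (3 * g)) := by
    refine hcancel (hquot hK D.mul_star) (r := (ψ * X ^ g) * (ψ * X ^ g) * X ^ g) ?_ (by ring)
    rw [hsq, D.red_Ψ (one_le_two.trans hn), hG₁2, ← map_mul, ← map_mul]
  have hΦN : norm Φ = A₀ * A₁ := by
    have := congrArg QuadraticAlgebra.norm hΦ
    rw [map_mul, QuadraticAlgebra.norm_star, hA₀', hA₁', HyperRing.norm_smul] at this
    refine mul_left_cancel₀ (pow_ne_zero 2 hκ.ne_zero) ?_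
    linear_combination -this
  have hΦd : Φ.im.natDegree < g := by
    obtain ⟨-, h3⟩ := (natDegree_norm_le_iff hodd).mp
      (hΦN ▸ natDegree_mul_le_of_le hA₀d hA₁d : (norm Φ).natDegree ≤ 2 * g + 2 * g)
    by_cases h0 : Φ.im = 0
    · rwa [h0, natDegree_zero]
    have := h3 h0
    lia
  have hKN : C ν * norm K = A₁ ^ 2 * D.A₁ := by
    have := congrArg QuadraticAlgebra.norm hK
    rw [map_mul, map_pow, map_mul, hA₁', D.norm₁, hFN] at this
    refine mul_left_cancel₀ (mul_ne_zero D.prim.ne_zero (pow_ne_zero 2 hκ.ne_zero)) ?_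
    linear_combination -this
  have hKd : K.im.natDegree < 2 * g := by
    have hd : (norm K).natDegree ≤ 2 * (2 * g) + 2 * g := by
      rw [← natDegree_C_mul hν0, hKN]
      exact natDegree_mul_le_of_le (natDegree_pow_le_of_le 2 hA₁d) D.natDegree₁
    obtain ⟨-, h3⟩ := (natDegree_norm_le_iff hodd).mp hd
    by_cases h0 : K.im = 0
    · rw [h0, natDegree_zero]
      lia
    have := h3 h0
    lia
  have heq : (C ν : ℤ[X]) • (K * star E) = Φ ^ 2 * D.Ψ := by
    refine smul_right_injective' (mul_ne_zero D.prim.ne_zero (pow_ne_zero 2 hκ.ne_zero)) ?_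
    have hE' : star G₀ ^ 2 * star D.G₀ = star F * star E := by
      have := congrArg star hE
      rwa [star_mul', star_mul', star_pow] at this
    have hFF : F * star F = (D.κ * κ ^ 2 * C ν) • (1 : HyperRing ℤ (2 * g + 1)) := by
      rw [mul_star_self, hFN, ← Algebra.algebraMap_eq_smul_one]
      congr 1
      ring
    calc (D.κ * κ ^ 2) • (C ν : ℤ[X]) • (K * star E) = F * star F * (K * star E) := by
          rw [hFF, smul_mul_assoc, one_mul, ← mul_smul]
      _ = (G₁ * star G₀) ^ 2 * (D.G₁ * star D.G₀) := by
          linear_combination -star F * star E * hK - G₁ ^ 2 * D.G₁ * hE'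
      _ = (D.κ * κ ^ 2) • (Φ ^ 2 * D.Ψ) := by
          rw [hΦ, D.mul_star, _root_.smul_pow, smul_mul_smul_comm, mul_comm D.κ]
  obtain ⟨y, hy, hy2⟩ := exists_im_eq_two_pow_mul hg hn hν heq hE2 hK2 hKd D.red_re D.im_eq
    D.red_v hΦ2 hΦd
  exact ⟨{
    κ := κ
    b := b
    prim := hκ
    natDegree_κ := hκd
    dvd := h
    G₀ := G₀
    G₁ := G₁
    mem₀ := hG₀
    mem₁ := hG₁
    A₀ := A₀
    A₁ := A₁
    norm₀ := hA₀'
    norm₁ := hA₁'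
    natDegree₀ := hA₀d
    natDegree₁ := hA₁d
    Ψ := Φ
    mul_star := hΦ
    red₀ := by
      rw [hredA (z := 1) (by rw [hG₀2, mul_one]) hA₀', one_pow]
    red₁ := by
      rw [hredA hG₁2 hA₁', ← pow_mul, mul_comm]
    red_re := congrArg QuadraticAlgebra.re hΦ2
    v := y
    im_eq := hy
    red_v := hy2 }⟩

end DescentDatum

theorem isPrimitive_C_mul_X_add_C {r s : ℤ} (h : IsCoprime r s) : (C r * X + C s).IsPrimitive := by
  intro d hd
  rw [C_dvd_iff_dvd_coeff] at hd
  have h0 := hd 0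
  have h1 := hd 1
  simp only [coeff_add, coeff_C_mul, coeff_X_zero, coeff_X_one, coeff_C_zero, mul_zero, zero_add,
    mul_one, coeff_C_succ, add_zero] at h0 h1
  exact h.isUnit_of_dvd' h1 h0

namespace DescentDatum

open QuadraticAlgebra HyperRing

/-- The descent datum attached to a nontrivial solution of the Fermat equation. -/
theorem nonempty_of_fermat {g n : ℕ} (hg : 0 < g) (hn : 1 ≤ n) {a b c d : ℤ} (ha : Odd a)
    (hb : Odd b) (hd : Odd d) (hc : c = 2 ^ n * d) (hcop : IsCoprime c (a * b))
    (h : a ^ (2 * g + 1) + b ^ (2 * g + 1) + c ^ (2 * g + 1) = 0) :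
    Nonempty (DescentDatum g n) := by
  have hd0 : d ≠ 0 := by
    rintro rfl
    exact absurd hd (by decide)
  have hc0 : c ≠ 0 := hc ▸ mul_ne_zero (pow_ne_zero n two_ne_zero) hd0
  have hcQ : (c : ℚ) ≠ 0 := Int.cast_ne_zero.mpr hc0
  have hQ : (a : ℚ) ^ (2 * g + 1) + b ^ (2 * g + 1) + c ^ (2 * g + 1) = 0 := by exact_mod_cast h
  have hCm (m : ℤ) : (C m).map (Int.castRingHom ℚ) = C (m : ℚ) := map_C _
  set ℓ : ℤ[X] := C (c ^ 2) * X + C (a * b) with hℓ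
  have hprim : ℓ.IsPrimitive := isPrimitive_C_mul_X_add_C hcop.pow_left
  have hdegℓ : ℓ.natDegree = 1 := natDegree_linear (pow_ne_zero 2 hc0)
  set t : ℚ := -(a * b) / c ^ 2 with ht
  have hℓQ : ℓ.map (Int.castRingHom ℚ) = C ((c : ℚ) ^ 2) * (X - C t) := by
    rw [hℓ, Polynomial.map_add, Polynomial.map_mul, map_X, hCm, hCm, mul_sub, ← Polynomial.C_mul,
      ← sub_neg_eq_add, ← Polynomial.C_neg, ht, neg_div, mul_neg, mul_div_cancel₀ _ (pow_ne_zero 2 hcQ)]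
    push_cast
    rfl
  have hu : IsUnit (C ((c : ℚ) ^ 2)) := isUnit_C.mpr (isUnit_iff_ne_zero.mpr (pow_ne_zero 2 hcQ))
  have hdvd_iff (f : ℚ[X]) : ℓ.map (Int.castRingHom ℚ) ∣ f ↔ f.eval t = 0 := by
    rw [hℓQ, hu.mul_left_dvd, dvd_iff_isRoot, IsRoot.def]
  set B : ℚ[X] := C ((a : ℚ) ^ (2 * g + 1) / c ^ (2 * g + 1)) with hB
  have hdvd : ℓ.map (Int.castRingHom ℚ) ∣ B ^ 2 + B - X ^ (2 * g + 1) := by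
    rw [hdvd_iff, hB, eval_sub, eval_add, eval_pow, eval_C, eval_pow, eval_X, ht, neg_div,
      Odd.neg_pow ⟨g, rfl⟩, div_pow, div_pow, mul_pow, ← pow_mul, ← pow_mul, ← pow_mul,
      mul_comm 2 (2 * g + 1), pow_mul, pow_mul]
    have : (c : ℚ) ^ (2 * g + 1) ≠ 0 := pow_ne_zero _ hcQ
    generalize (c : ℚ) ^ (2 * g + 1) = z at *
    field_simp
    linear_combination (a : ℚ) ^ (2 * g + 1) * hQ
  set s : ℤ := -((-1) ^ g * b ^ g) with hs
  have hsodd : Odd s := ((odd_neg_one.pow).mul hb.pow).neg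
  set G : HyperRing ℤ (2 * g + 1) := ⟨C (a ^ (g + 1)) * X ^ g, C (s * c)⟩ with hG
  have hGmem : G ∈ idlInt ℓ B hdvd := by
    rw [mem_idlInt, hdvd_iff, hG, hB]
    simp only [Polynomial.map_mul, hCm, Polynomial.map_pow, map_X, eval_add, eval_mul, eval_C,
      eval_pow, eval_X]
    rw [hs, ht, neg_div, neg_pow, div_pow, ← pow_mul]
    push_cast
    field_simp
    ring
  obtain ⟨A, hA⟩ := dvd_norm_int hprim hGmem
  have hnorm : QuadraticAlgebra.norm G = C (a ^ (2 * g + 2)) * X ^ (2 * g)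
      - C (a ^ (g + 1) * s * c) * X ^ g - C ((s * c) ^ 2) * X ^ (2 * g + 1) := by
    rw [norm_apply, hG]
    simp only [Polynomial.C_mul, Polynomial.C_pow]
    ring
  have hdegG : (QuadraticAlgebra.norm G).natDegree ≤ 2 * g + 1 := by
    rw [hnorm]
    compute_degree
    lia
  have hA0 : A.natDegree ≤ 2 * g := by
    by_cases h0 : A = 0
    · rw [h0, natDegree_zero]
      lia
    rw [hA, natDegree_mul hprim.ne_zero h0, hdegℓ] at hdegG
    lia
  have hred2 : redPoly 2 (C c) = 0 := by
    rw [coe_mapRingHom, map_C, eq_intCast, (ZMod.intCast_zmod_eq_zero_iff_dvd c 2).mpr, C_0]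
    exact hc ▸ ((dvd_pow_self 2 (by lia)).mul_right d)
  have hℓ2 : redPoly 2 ℓ = 1 := by
    have : redPoly 2 (C (c ^ 2)) = 0 := by rw [Polynomial.C_pow, map_pow, hred2, zero_pow two_ne_zero]
    rw [hℓ, map_add, map_mul, this, zero_mul, zero_add, redPoly_C_of_odd (ha.mul hb)]
  have hX : redPoly 2 X = X := map_X _
  exact ⟨{
    κ := ℓ
    b := B
    prim := hprim
    natDegree_κ := hdegℓ ▸ hg
    dvd := hdvd
    G₀ := algebraMap ℤ[X] _ ℓ
    G₁ := G
    mem₀ := by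
      rw [mem_idlInt, algebraMap_re, algebraMap_im, Polynomial.map_zero, mul_zero, add_zero]
    mem₁ := hGmem
    A₀ := ℓ
    A₁ := A
    norm₀ := by rw [QuadraticAlgebra.norm_algebraMap, pow_two]
    norm₁ := hA
    natDegree₀ := by lia
    natDegree₁ := hA0
    Ψ := G
    mul_star := by rw [star_algebraMap', mul_comm G, Algebra.smul_def]
    red₀ := hℓ2
    red₁ := by
      have := congrArg (redPoly 2) hA
      rw [map_mul, hℓ2, one_mul] at this
      rw [← this, hnorm]
      simp only [mul_pow, map_sub, map_mul, map_pow, hred2,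
        mul_zero, zero_mul, zero_pow two_ne_zero, sub_zero, redPoly_C_of_odd ha, hX, one_pow, one_mul]
    red_re := by
      rw [hG, map_mul, map_pow (redPoly 2) X, hX, redPoly_C_of_odd ha.pow, one_mul]
    v := C (s * d)
    im_eq := by
      have h2 : (2 : ℤ[X]) = C 2 := rfl
      rw [hG, hc, h2, ← Polynomial.C_pow, ← Polynomial.C_mul]
      exact congrArg Polynomial.C (mul_left_comm s (2 ^ n) d)
    red_v := redPoly_C_of_odd (hsodd.mul hd) }⟩

end DescentDatum

theorem exists_eq_two_pow_mul_odd_of_even {c : ℤ} (hc : c ≠ 0) (he : Even c) :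
    ∃ n d, 1 ≤ n ∧ Odd d ∧ c = 2 ^ n * d := by
  obtain ⟨d, hd, h2⟩ := (Int.finiteMultiplicity_iff.mpr ⟨by decide, hc⟩ :
    FiniteMultiplicity (2 : ℤ) c).exists_eq_pow_mul_and_not_dvd
  refine ⟨_, d, ?_, Int.not_even_iff_odd.mp (mt even_iff_two_dvd.mp h2), hd⟩
  rw [Nat.one_le_iff_ne_zero]
  intro h0
  rw [h0, pow_zero, one_mul] at hd
  exact h2 (hd ▸ even_iff_two_dvd.mp he)

theorem not_forall_fermat_of_even {p : ℕ} (hp : p.Prime) (hp2 : Odd p)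
    (hdat : ∀ g n, p = 2 * g + 1 → 1 ≤ n → IsEmpty (DescentDatum g n)) {a b c : ℤ} (hc : c ≠ 0)
    (hbc : IsCoprime b c) (hac : IsCoprime a c) (he : Even c) :
    a ^ p + b ^ p + c ^ p ≠ 0 := by
  intro h
  obtain ⟨g, rfl⟩ := hp2
  obtain ⟨n, d, hn, hd, hcd⟩ := exists_eq_two_pow_mul_odd_of_even hc he
  have hodd {x : ℤ} (hx : IsCoprime x c) : Odd x := by
    rw [← Int.not_even_iff_odd]
    intro hxe
    have := hx.isUnit_of_dvd' hxe.two_dvd he.two_dvd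
    exact absurd (Int.isUnit_iff.mp this) (by decide)
  have hg : 0 < g := by
    have := hp.two_le
    lia
  obtain ⟨D⟩ := DescentDatum.nonempty_of_fermat hg hn (hodd hac) (hodd hbc) hd hcd
    (hac.symm.mul_right hbc.symm) h
  exact (hdat g n rfl hn).false D

theorem fermatLastTheoremFor_of_isEmpty_descentDatum {p : ℕ} (hp : p.Prime) (hp2 : Odd p)
    (hdat : ∀ g n, p = 2 * g + 1 → 1 ≤ n → IsEmpty (DescentDatum g n)) :
    FermatLastTheoremWith ℤ p := by
  refine fermatLastTheoremWith_of_fermatLastTheoremWith_coprime fun a b c ha hb hc hgcd h => ?_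
  have hgcd' : Finset.gcd {a, b, -c} id = 1 := by
    rw [← hgcd]
    simp [Finset.gcd_insert, Finset.gcd_singleton, ← Int.abs_eq_normalize]
  have h' : a ^ p + b ^ p + (-c) ^ p = 0 := by
    rw [hp2.neg_pow, h, add_neg_cancel]
  have hc' : -c ≠ 0 := neg_ne_zero.mpr hc
  generalize -c = e at hgcd' h' hc'
  have hab := isCoprime_of_gcd_eq_one_of_FLT hgcd' h'
  have hbc : IsCoprime b e := by
    refine isCoprime_of_gcd_eq_one_of_FLT (n := p) (c := a) ?_ (by linear_combination h')
    rw [← hgcd']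
    congr 1
    ext
    simp
    tauto
  have hac : IsCoprime a e := by
    refine isCoprime_of_gcd_eq_one_of_FLT (n := p) (c := b) ?_ (by linear_combination h')
    rw [← hgcd']
    congr 1
    ext
    simp
    tauto
  rcases Int.even_or_odd e with he | he
  · exact not_forall_fermat_of_even hp hp2 hdat hc' hbc hac he h'
  rcases Int.even_or_odd b with hbe | hbo
  · exact not_forall_fermat_of_even hp hp2 hdat hb hbc.symm hab hbe
      (by linear_combination h')
  rcases Int.even_or_odd a with hae | hao
  · exact not_forall_fermat_of_even hp hp2 hdat ha hac.symm hab.symm hae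
      (by linear_combination h')
  have hodd := ((hao.pow (n := p)).add_odd (hbo.pow (n := p))).add_odd (he.pow (n := p))
  rw [h'] at hodd
  exact absurd hodd (by decide)

theorem isEmpty_descentDatum {g n : ℕ} {L : Type*} [Field L] [NumberField L] {L₂ : Type*} [Field L₂]
    [Algebra ℚ_[2] L₂] {α : L} {lam : L₂} {ι : L →+* L₂} (hp : (2 * g + 1).Prime)
    (h1 : ¬ (2 * g + 1) ^ 2 ∣ 2 ^ (2 * g + 1 - 1) - 1) (h2 : Odd (NumberField.classNumber L))
    (hα : α ^ (2 * g + 1) = 2) (hdeg : Module.finrank ℚ L = 2 * g + 1)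
    (hlam : lam ^ (2 * g + 1) = 2) (hdeg2 : Module.finrank ℚ_[2] L₂ = 2 * g + 1) (hι : ι α = lam)
    (h3 : ∀ u : (𝓞 L)ˣ, ¬ ∃ s : L₂, s ^ 2 = ι (algebraMap (𝓞 L) L (u : 𝓞 L)) *
      (1 + lam ^ (2 * (2 * g + 1) - 1))) (hn : 1 ≤ n) : IsEmpty (DescentDatum g n) := by
  have hg : 0 < g := by
    have := hp.two_le
    lia
  induction n, hn using Nat.le_induction with
  | base => exact ⟨fun D => D.not_of_one hp hg h1 h2 hα hdeg hlam hdeg2 hι h3⟩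
  | succ n hn ih =>
    refine ⟨fun D => ?_⟩
    obtain ⟨E⟩ := D.exists_pred (by lia) hp hg h1 h2 hα hdeg hlam hdeg2 hι
    exact ih.false E

/-- The criterion for Fermat's Last Theorem for exponent `p` (Proposition 6.4):
`L = ℚ(2^{1/p})`, `L₂ = ℚ₂(2^{1/p})`, `ι : L → L₂` the natural map. If
(1) `p² ∤ 2^{p-1} - 1`, (2) the class number of `L` is odd, and (3) no element `ι(u)·z`
with `u` a unit of `O_L` and `z ∈ Z = {1 + λ^{p+2}, 1 + λ^{2p-1}, ∏_{2^k ≤ p}(1 + λ^{p+2^k})}`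
is a square in `L₂`, then FLT holds for exponent `p`. -/
theorem stmt5 (p : ℕ) (hp : p.Prime) (hp5 : 5 ≤ p)
    (L : Type*) [Field L] [Algebra ℚ L] [NumberField L]
    (α : L) (hα : α ^ p = 2) (hgen : Algebra.adjoin ℚ {α} = ⊤)
    (hdeg : Module.finrank ℚ L = p)
    (L₂ : Type*) [Field L₂] [Algebra ℚ_[2] L₂]
    (lam : L₂) (hlam : lam ^ p = 2)
    (hdeg2 : Module.finrank ℚ_[2] L₂ = p)
    (ι : L →+* L₂) (hι : ι α = lam)
    (h1 : ¬ (p ^ 2 ∣ 2 ^ (p - 1) - 1))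
    (h2 : Odd (NumberField.classNumber L))
    (h3 : ∀ u : (𝓞 L)ˣ,
      ∀ z ∈ ({1 + lam ^ (p + 2), 1 + lam ^ (2 * p - 1),
          ∏ k ∈ (Finset.Icc 1 p).filter (fun k => 2 ^ k ≤ p), (1 + lam ^ (p + 2 ^ k))} :
          Set L₂),
      ¬ ∃ s : L₂, s ^ 2 = ι (algebraMap (𝓞 L) L (u : 𝓞 L)) * z) :
    ∀ x y z : ℤ, x * y * z ≠ 0 → x ^ p + y ^ p ≠ z ^ p := by
  intro x y z hxyz
  obtain rfl : ‹Algebra ℚ L› = DivisionRing.toRatAlgebra := Subsingleton.elim _ _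
  refine fermatLastTheoremFor_of_isEmpty_descentDatum hp (hp.odd_of_ne_two (by lia)) ?_ x y z
    (left_ne_zero_of_mul (left_ne_zero_of_mul hxyz))
    (right_ne_zero_of_mul (left_ne_zero_of_mul hxyz)) (right_ne_zero_of_mul hxyz)
  rintro g n rfl hn
  exact isEmpty_descentDatum hp h1 h2 hα hdeg hlam hdeg2 hι (fun u => h3 u _ (by simp)) hn
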